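/- Channels of energy for the odd-in-time part around a soliton: fix a smooth cutoff χ₀ with χ₀ = 1 on [0,10] and χ₀ = 0 on [12,∞). There exists C > 0, independent of R, such that for every R ≥ 0 and every radial C² function u solving ∂_t²u − Δu + Vu = 0 on the exterior region {(t,x) : |x| ≥ R + |t|} ⊂ ℝ × ℝ⁶, with data (u₀,u₁) = (u(0,·), ∂_t u(0,·)) satisfying ∫_{|x|>R}(|∇u₀|² + u₁²) < ∞ and for which both limits lim_{t→±∞} ∫_{|x|≥R+|t|} |∇_{t,x}u|² dx exist, one has ‖Π⊥_{L²_R} u₁‖²_{L²_R} ≤ C Σ_± lim_{t→±∞} ∫_{|x|≥R+|t|} |∇_{t,x}u(t,x)|² dx. -/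

import Mathlib

open MeasureTheory Real Filter Set Topology ENNReal RealInnerProductSpace

noncomputable section

abbrev E6 := EuclideanSpace ℝ (Fin 6)

/-- The ground state `W(x) = (1+|x|²/24)⁻²` on `ℝ⁶`. -/
def W6 (x : E6) : ℝ := ((1 + ‖x‖ ^ 2 / 24) ^ 2)⁻¹

/-- The potential `V = -2W` of the linearized equation. -/
def V6 (x : E6) : ℝ := -2 * W6 x

/-- `ΛW(x) = x·∇W(x) + 2W(x)`. -/
def LW6 (x : E6) : ℝ := fderiv ℝ W6 x x + 2 * W6 x

/-- The Laplacian of `f : ℝ⁶ → ℝ`. -/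
def lap6 (f : E6 → ℝ) (x : E6) : ℝ :=
  ∑ i : Fin 6, fderiv ℝ (fun y => fderiv ℝ f y (EuclideanSpace.single i 1)) x
    (EuclideanSpace.single i 1)

/-- `∂ₜ u`. -/
def dtu (u : ℝ → E6 → ℝ) (t : ℝ) (x : E6) : ℝ := deriv (fun s => u s x) t

/-- `∂ₜ² u`. -/
def dttu (u : ℝ → E6 → ℝ) (t : ℝ) (x : E6) : ℝ := deriv (fun s => dtu u s x) t

/-- `|∇_{t,x} u|² = (∂ₜ u)² + |∇u|²`. -/
def eDensity (u : ℝ → E6 → ℝ) (t : ℝ) (x : E6) : ℝ :=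
  dtu u t x ^ 2 + ‖gradient (u t) x‖ ^ 2

/-- `u` is a radial finite-energy solution of `∂ₜ²u - Δu + P·u = 0` on `ℝ × ℝ⁶`. -/
def IsRadSolOf (P : E6 → ℝ) (u : ℝ → E6 → ℝ) : Prop :=
  ContDiff ℝ 2 (fun p : ℝ × E6 => u p.1 p.2) ∧
  (∀ t x y, ‖x‖ = ‖y‖ → u t x = u t y) ∧
  (∀ t x, dttu u t x - lap6 (u t) x + P x * u t x = 0) ∧
  Integrable (fun x => eDensity u 0 x)

/-- The radial profile of the ground state on `ℝ⁶`: `W(r) = (1+r²/24)⁻²`. -/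
def W1 (r : ℝ) : ℝ := ((1 + r ^ 2 / 24) ^ 2)⁻¹

/-- The radial potential `V = -2W`. -/
def V1 (r : ℝ) : ℝ := -2 * W1 r

/-- `ΛW(r) = r W'(r) + 2W(r)`. -/
def LW1 (r : ℝ) : ℝ := r * deriv W1 r + 2 * W1 r

/-- The second radial zero of `-Δ + V`: `Γ(r) = -ΛW(r) ∫₁^r s⁻⁵ ΛW(s)⁻² ds`. -/
def Gam (r : ℝ) : ℝ := -LW1 r * ∫ s in (1 : ℝ)..r, (s ^ 5 * LW1 s ^ 2)⁻¹

/-- The resonance profile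
`Υ(r) = -ΛW(r) ∫₀^r ΛW Γ s⁵ ds - Γ(r) ∫_r^∞ ΛW² s⁵ ds`, solving `-ΔΥ + VΥ = ΛW`. -/
def Ups (r : ℝ) : ℝ :=
  -LW1 r * (∫ s in (0 : ℝ)..r, LW1 s * Gam s * s ^ 5) -
    Gam r * ∫ s in Ioi r, LW1 s ^ 2 * s ^ 5

/-- A fixed unit vector of `ℝ⁶`, used to take radial profiles. -/
def e0 : E6 := EuclideanSpace.single 0 1

/-- Membership in the radial weighted space `L²_ρ`. -/
def L2 (ρ : ℝ) (f : ℝ → ℝ) : Prop :=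
  AEStronglyMeasurable f (volume.restrict (Ioi ρ)) ∧
    IntegrableOn (fun r => f r ^ 2 * r ^ 5) (Ioi ρ)

/-- The norm of `L²_ρ`. -/
def nrm (ρ : ℝ) (f : ℝ → ℝ) : ℝ := √(∫ r in Ioi ρ, f r ^ 2 * r ^ 5)

lemma cauchy_schwarz {α : Type*} [MeasurableSpace α] {μ : Measure α} {f g : α → ℝ}
    (hf : Integrable (fun x => f x ^ 2) μ) (hg : Integrable (fun x => g x ^ 2) μ)
    (hfg : Integrable (fun x => f x * g x) μ) :
    |∫ x, f x * g x ∂μ| ≤ √(∫ x, f x ^ 2 ∂μ) * √(∫ x, g x ^ 2 ∂μ) := by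
  set A := ∫ x, f x ^ 2 ∂μ
  set B := ∫ x, g x ^ 2 ∂μ
  set D := ∫ x, f x * g x ∂μ
  have hA : 0 ≤ A := integral_nonneg fun x => sq_nonneg _
  have key : ∀ l : ℝ, 0 ≤ B * (l * l) + (2 * D) * l + A := by
    intro l
    have h : ∫ x, (f x + l * g x) ^ 2 ∂μ = B * (l * l) + (2 * D) * l + A := by
      have h1 : (fun x => (f x + l * g x) ^ 2) =
          fun x => (f x ^ 2 + (2 * l) * (f x * g x)) + (l * l) * g x ^ 2 := by
        ext x; ring
      have i1 : Integrable (fun x => (2 * l) * (f x * g x)) μ := hfg.const_mul _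
      have i2 : Integrable (fun x => f x ^ 2 + (2 * l) * (f x * g x)) μ := hf.add i1
      rw [h1, integral_add i2 (hg.const_mul _),
        integral_add hf i1, integral_const_mul, integral_const_mul]
      ring
    rw [← h]
    exact integral_nonneg fun x => sq_nonneg _
  have hd := discrim_le_zero key
  rw [discrim] at hd
  rw [← Real.sqrt_mul hA]
  apply Real.abs_le_sqrt
  nlinarith

lemma L2.integrable_mul {ρ : ℝ} (hρ : 0 ≤ ρ) {f g : ℝ → ℝ} (hf : L2 ρ f) (hg : L2 ρ g) :
    IntegrableOn (fun r => f r * g r * r ^ 5) (Ioi ρ) := by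
  have h := (hf.2.add hg.2)
  refine Integrable.mono' h ((hf.1.mul hg.1).mul
    (by fun_prop : Continuous fun r : ℝ => r ^ 5).aestronglyMeasurable) ?_
  refine (ae_restrict_iff' measurableSet_Ioi).2 (Eventually.of_forall fun r hr => ?_)
  have hr0 : 0 < r := lt_of_le_of_lt hρ hr
  have h5 : 0 < r ^ 5 := by positivity
  simp only [Pi.add_apply, norm_mul, Real.norm_eq_abs, abs_of_pos h5]
  have : |f r| * |g r| ≤ f r ^ 2 + g r ^ 2 := by
    rw [← sq_abs (f r), ← sq_abs (g r)]; nlinarith [sq_nonneg (|f r| - |g r|), sq_nonneg (|f r| + |g r|)]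
  nlinarith

lemma L2.add {ρ : ℝ} (hρ : 0 ≤ ρ) {f g : ℝ → ℝ} (hf : L2 ρ f) (hg : L2 ρ g) :
    L2 ρ (fun r => f r + g r) := by
  refine ⟨hf.1.add hg.1, ?_⟩
  have h := (hf.2.add hg.2).add ((hf.integrable_mul hρ hg).const_mul 2)
  refine h.congr (Eventually.of_forall fun r => ?_)
  simp only [Pi.add_apply]; ring

lemma L2.const_mul {ρ : ℝ} (c : ℝ) {f : ℝ → ℝ} (hf : L2 ρ f) : L2 ρ (fun r => c * f r) := by
  refine ⟨hf.1.const_mul c, (hf.2.const_mul (c ^ 2)).congr (Eventually.of_forall fun r => ?_)⟩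
  simp only; ring

lemma L2.sub {ρ : ℝ} (hρ : 0 ≤ ρ) {f g : ℝ → ℝ} (hf : L2 ρ f) (hg : L2 ρ g) :
    L2 ρ (fun r => f r - g r) := by
  have := hf.add hρ (hg.const_mul (-1))
  simpa [sub_eq_add_neg] using this

lemma L2.mono {ρ ρ' : ℝ} (h : ρ ≤ ρ') {f : ℝ → ℝ} (hf : L2 ρ f) : L2 ρ' f :=
  ⟨hf.1.mono_measure (Measure.restrict_mono (Ioi_subset_Ioi h) le_rfl),
    hf.2.mono_set (Ioi_subset_Ioi h)⟩

lemma nrm_nonneg (ρ : ℝ) (f : ℝ → ℝ) : 0 ≤ nrm ρ f := Real.sqrt_nonneg _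

lemma integral_sq_nonneg {ρ : ℝ} (hρ : 0 ≤ ρ) (f : ℝ → ℝ) :
    0 ≤ ∫ r in Ioi ρ, f r ^ 2 * r ^ 5 := by
  refine setIntegral_nonneg measurableSet_Ioi fun r hr => ?_
  have : 0 < r := lt_of_le_of_lt hρ hr
  positivity

lemma nrm_sq {ρ : ℝ} (hρ : 0 ≤ ρ) (f : ℝ → ℝ) :
    nrm ρ f ^ 2 = ∫ r in Ioi ρ, f r ^ 2 * r ^ 5 :=
  Real.sq_sqrt (integral_sq_nonneg hρ f)

lemma nrm_le_of_sq {ρ : ℝ} {f : ℝ → ℝ} {K : ℝ} (hK : 0 ≤ K)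
    (h : (∫ r in Ioi ρ, f r ^ 2 * r ^ 5) ≤ K ^ 2) : nrm ρ f ≤ K :=
  (Real.sqrt_le_sqrt h).trans (Real.sqrt_sq hK).le

lemma inner_le_nrm {ρ : ℝ} (hρ : 0 ≤ ρ) {f g : ℝ → ℝ} (hf : L2 ρ f) (hg : L2 ρ g) :
    |∫ r in Ioi ρ, f r * g r * r ^ 5| ≤ nrm ρ f * nrm ρ g := by
  have e1 : ∀ r ∈ Ioi ρ, √(r ^ 5) ^ 2 = r ^ 5 := fun r hr => by
    have : 0 < r := lt_of_le_of_lt hρ hr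
    exact Real.sq_sqrt (by positivity)
  have hf' : ∀ f : ℝ → ℝ, EqOn (fun r => f r ^ 2 * r ^ 5) (fun r => (f r * √(r ^ 5)) ^ 2) (Ioi ρ) :=
    fun f r hr => by simp only [mul_pow, e1 r hr]
  have hfg : EqOn (fun r => f r * g r * r ^ 5)
      (fun r => (f r * √(r ^ 5)) * (g r * √(r ^ 5))) (Ioi ρ) := fun r hr => by
    simp only; nth_rw 1 [← e1 r hr]; ring
  have := cauchy_schwarz (μ := volume.restrict (Ioi ρ)) (f := fun r => f r * √(r ^ 5))
    (g := fun r => g r * √(r ^ 5)) (hf.2.congr_fun (hf' f) measurableSet_Ioi)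
    (hg.2.congr_fun (hf' g) measurableSet_Ioi)
    ((hf.integrable_mul hρ hg).congr_fun hfg measurableSet_Ioi)
  rw [nrm, nrm, setIntegral_congr_fun measurableSet_Ioi (hf' f),
    setIntegral_congr_fun measurableSet_Ioi (hf' g), setIntegral_congr_fun measurableSet_Ioi hfg]
  exact this

lemma nrm_add_sq {ρ : ℝ} (hρ : 0 ≤ ρ) {f g : ℝ → ℝ} (hf : L2 ρ f) (hg : L2 ρ g) :
    nrm ρ (fun r => f r + g r) ^ 2 =
      nrm ρ f ^ 2 + nrm ρ g ^ 2 + 2 * ∫ r in Ioi ρ, f r * g r * r ^ 5 := by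
  have i1 : IntegrableOn (fun r => f r ^ 2 * r ^ 5 + g r ^ 2 * r ^ 5) (Ioi ρ) := hf.2.add hg.2
  rw [nrm_sq hρ, nrm_sq hρ, nrm_sq hρ, ← integral_add hf.2 hg.2, ← integral_const_mul,
    ← integral_add i1 ((hf.integrable_mul hρ hg).const_mul 2)]
  refine integral_congr_ae (Eventually.of_forall fun r => ?_)
  simp only; ring

lemma nrm_add_le {ρ : ℝ} (hρ : 0 ≤ ρ) {f g : ℝ → ℝ} (hf : L2 ρ f) (hg : L2 ρ g) :
    nrm ρ (fun r => f r + g r) ≤ nrm ρ f + nrm ρ g := by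
  have h1 := nrm_add_sq hρ hf hg
  have h2 := (le_abs_self _).trans (inner_le_nrm hρ hf hg)
  refine abs_le_of_sq_le_sq' ?_ (add_nonneg (nrm_nonneg _ _) (nrm_nonneg _ _)) |>.2
  nlinarith

lemma nrm_const_mul (ρ c : ℝ) (f : ℝ → ℝ) : nrm ρ (fun r => c * f r) = |c| * nrm ρ f := by
  rw [nrm, nrm, ← Real.sqrt_sq_eq_abs, ← Real.sqrt_mul (sq_nonneg c), ← integral_const_mul]
  congr 1
  refine integral_congr_ae (Eventually.of_forall fun r => ?_)
  simp only; ring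

lemma nrm_sub_le {ρ : ℝ} (hρ : 0 ≤ ρ) {f g : ℝ → ℝ} (hf : L2 ρ f) (hg : L2 ρ g) :
    nrm ρ (fun r => f r - g r) ≤ nrm ρ f + nrm ρ g := by
  have h := nrm_add_le hρ hf (hg.const_mul (-1))
  rw [nrm_const_mul] at h
  simpa [sub_eq_add_neg] using h

lemma nrm_mono {ρ ρ' : ℝ} (hρ : 0 ≤ ρ) (h : ρ ≤ ρ') {f : ℝ → ℝ} (hf : L2 ρ f) :
    nrm ρ' f ≤ nrm ρ f := by
  refine Real.sqrt_le_sqrt (setIntegral_mono_set hf.2 ?_ (Ioi_subset_Ioi h).eventuallyLE)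
  refine (ae_restrict_iff' measurableSet_Ioi).2 (Eventually.of_forall fun r hr => ?_)
  have : 0 < r := lt_of_le_of_lt hρ hr
  simp only [Pi.zero_apply]; positivity

lemma nrm_congr {ρ : ℝ} {f g : ℝ → ℝ} (h : EqOn f g (Ioi ρ)) : nrm ρ f = nrm ρ g := by
  rw [nrm, nrm, setIntegral_congr_fun measurableSet_Ioi
    (fun r hr => by simp only [h hr] : EqOn (fun r => f r ^ 2 * r ^ 5) (fun r => g r ^ 2 * r ^ 5) _)]

lemma L2.congr {ρ : ℝ} {f g : ℝ → ℝ} (hf : L2 ρ f) (h : EqOn f g (Ioi ρ)) : L2 ρ g :=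
  ⟨hf.1.congr ((ae_restrict_iff' measurableSet_Ioi).2 (Eventually.of_forall fun r hr => h hr)),
    hf.2.congr_fun (fun r hr => by simp only [h hr]) measurableSet_Ioi⟩

/-- Cauchy-Schwarz on a compact interval, for continuous functions. -/
lemma cs_interval {a b : ℝ} (hab : a ≤ b) {f g : ℝ → ℝ} (hf : ContinuousOn f (Icc a b))
    (hg : ContinuousOn g (Icc a b)) :
    |∫ x in a..b, f x * g x| ≤ √(∫ x in a..b, f x ^ 2) * √(∫ x in a..b, g x ^ 2) := by
  simp only [intervalIntegral.integral_of_le hab]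
  have H : ∀ h : ℝ → ℝ, ContinuousOn h (Icc a b) → IntegrableOn h (Ioc a b) := fun h hh =>
    hh.integrableOn_Icc.mono_set Ioc_subset_Icc_self
  exact cauchy_schwarz (H _ (hf.pow 2)) (H _ (hg.pow 2)) (H _ (hf.mul hg))

/-- A nonnegative function with bounded integrals over compact subintervals of `(A, ∞)` is
integrable there. -/
lemma integrableOn_of_exhaustion {A C : ℝ} {f : ℝ → ℝ} (hf : ContinuousOn f (Ioi A))
    (h0 : ∀ x ∈ Ioi A, 0 ≤ f x) (hC : ∀ x M, A < x → x ≤ M → (∫ r in x..M, f r) ≤ C) :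
    IntegrableOn f (Ioi A) ∧ (∫ r in Ioi A, f r) ≤ C := by
  let φ : ℕ → Set ℝ := fun n => Ioc (A + 1 / ((n : ℝ) + 1)) (A + ((n : ℝ) + 1))
  have hφ : AECover (volume.restrict (Ioi A)) atTop φ := by
    refine ⟨?_, fun n => measurableSet_Ioc⟩
    refine (ae_restrict_iff' measurableSet_Ioi).2 (Eventually.of_forall fun x hx => ?_)
    have h1 : ∀ᶠ n : ℕ in atTop, 1 / ((n : ℝ) + 1) < x - A :=
      (tendsto_order.1 tendsto_one_div_add_atTop_nhds_zero_nat).2 _ (sub_pos.2 hx)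
    have h2 : ∀ᶠ n : ℕ in atTop, x - A ≤ (n : ℝ) :=
      tendsto_natCast_atTop_atTop.eventually_ge_atTop _
    filter_upwards [h1, h2] with n hn hn2
    exact ⟨by linarith, by linarith⟩
  have hle : ∀ n : ℕ, 1 / ((n : ℝ) + 1) ≤ (n : ℝ) + 1 := fun n => by
    have h1 : (1 : ℝ) ≤ (n : ℝ) + 1 := by linarith [Nat.cast_nonneg (α := ℝ) n]
    exact (div_le_one (by linarith)).2 h1 |>.trans h1
  have hpos : ∀ n : ℕ, 0 < 1 / ((n : ℝ) + 1) := fun n => by positivity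
  have hsub : ∀ n, φ n ⊆ Ioi A := fun n x hx => by
    have := hpos n; have := hx.1; simp only [mem_Ioi]; linarith
  have hr : ∀ n, (volume.restrict (Ioi A)).restrict (φ n) = volume.restrict (φ n) := fun n => by
    rw [Measure.restrict_restrict measurableSet_Ioc, inter_eq_left.2 (hsub n)]
  have hgam : ∀ n, IntegrableOn f (φ n) (volume.restrict (Ioi A)) := fun n => by
    rw [IntegrableOn, hr]
    refine (ContinuousOn.integrableOn_Icc (hf.mono fun x hx => ?_)).mono_set Ioc_subset_Icc_self
    have := hpos n; have := hx.1; simp only [mem_Ioi]; linarith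
  have hb : ∀ n, (∫ x in φ n, f x ∂(volume.restrict (Ioi A))) ≤ C := fun n => by
    rw [hr, ← intervalIntegral.integral_of_le (by linarith [hle n])]
    exact hC _ _ (by linarith [hpos n]) (by linarith [hle n])
  have hI : Integrable f (volume.restrict (Ioi A)) := by
    refine hφ.integrable_of_integral_norm_bounded C hgam (Eventually.of_forall fun n => ?_)
    refine le_trans (le_of_eq ?_) (hb n)
    rw [hr]
    exact setIntegral_congr_fun measurableSet_Ioc fun x hx => by
      simp only [Real.norm_eq_abs, abs_of_nonneg (h0 x (hsub n hx))]
  exact ⟨hI, le_of_tendsto (hφ.integral_tendsto_of_countably_generated hI)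
    (Eventually.of_forall hb)⟩

lemma interval_le_Ioi {A x M : ℝ} {f : ℝ → ℝ} (hf : IntegrableOn f (Ioi A))
    (h0 : ∀ r ∈ Ioi A, 0 ≤ f r) (hx : A ≤ x) (hM : x ≤ M) :
    (∫ r in x..M, f r) ≤ ∫ r in Ioi A, f r := by
  rw [intervalIntegral.integral_of_le hM]
  refine setIntegral_mono_set hf ((ae_restrict_iff' measurableSet_Ioi).2
    (Eventually.of_forall h0)) (Eventually.of_forall fun r hr => ?_)
  exact lt_of_le_of_lt hx hr.1

/-- A segment inside an open planar set has a product neighbourhood inside the set. -/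
lemma exists_tube {D : Set (ℝ × ℝ)} (hD : IsOpen D) {t0 α β : ℝ}
    (h : ∀ a ∈ Icc α β, (t0, a) ∈ D) :
    ∃ ε > 0, ∀ t a, |t - t0| ≤ ε → a ∈ Icc (α - ε) (β + ε) → α ≤ β → (t, a) ∈ D := by
  obtain ⟨u, v, hu, hv, htu, hav, huv⟩ := generalized_tube_lemma (s := {t0}) (t := Icc α β)
    isCompact_singleton isCompact_Icc hD (by rintro ⟨x, y⟩ ⟨hx, hy⟩; cases hx; exact h y hy)
  obtain ⟨ε1, h1, h1'⟩ := Metric.isOpen_iff.1 hu t0 (htu rfl)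
  obtain ⟨ε2, h2, h2'⟩ := isCompact_Icc.exists_thickening_subset_open hv hav
  refine ⟨min ε1 ε2 / 2, by positivity, fun t a ht ha hab => huv ⟨h1' ?_, h2' ?_⟩⟩
  · rw [Metric.mem_ball, Real.dist_eq]
    have := min_le_left ε1 ε2
    have : 0 < min ε1 ε2 := lt_min h1 h2
    linarith
  · have h3 := min_le_right ε1 ε2
    have h4 : 0 < min ε1 ε2 := lt_min h1 h2
    rw [Metric.mem_thickening_iff]
    rcases le_total a α with h | h
    · exact ⟨α, left_mem_Icc.2 hab, by rw [Real.dist_eq, abs_sub_lt_iff]; constructor <;> linarith [ha.1]⟩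
    rcases le_total a β with h' | h'
    · exact ⟨a, ⟨h, h'⟩, by simpa using h2⟩
    · exact ⟨β, right_mem_Icc.2 hab, by rw [Real.dist_eq, abs_sub_lt_iff]; constructor <;> linarith [ha.2]⟩

/-- Differentiation under the integral sign over a fixed compact interval. -/
lemma hasDerivAt_integral_fixed {D : Set (ℝ × ℝ)} (hD : IsOpen D) {f f' : ℝ → ℝ → ℝ} {t0 α β : ℝ}
    (hab : α ≤ β) (h : ∀ a ∈ Icc α β, (t0, a) ∈ D)
    (hf : ContinuousOn (fun z : ℝ × ℝ => f z.1 z.2) D)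
    (hf' : ContinuousOn (fun z : ℝ × ℝ => f' z.1 z.2) D)
    (hd : ∀ t a, (t, a) ∈ D → HasDerivAt (fun t => f t a) (f' t a) t) :
    HasDerivAt (fun t => ∫ a in α..β, f t a) (∫ a in α..β, f' t0 a) t0 := by
  obtain ⟨ε, hε, H⟩ := exists_tube hD h
  have hin : ∀ t a, |t - t0| ≤ ε → a ∈ Icc α β → (t, a) ∈ D := fun t a ht ha =>
    H t a ht ⟨by linarith [ha.1], by linarith [ha.2]⟩ hab
  have hcont : ∀ g : ℝ → ℝ → ℝ, ContinuousOn (fun z : ℝ × ℝ => g z.1 z.2) D → ∀ t, |t - t0| ≤ ε →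
      ContinuousOn (g t) (Icc α β) := fun g hg t ht =>
    hg.comp (f := fun a => (t, a)) (by fun_prop) (fun a ha => hin t a ht ha)
  have hK : IsCompact (Icc (t0 - ε) (t0 + ε) ×ˢ Icc α β) := isCompact_Icc.prod isCompact_Icc
  have habs : ∀ t, t ∈ Icc (t0 - ε) (t0 + ε) → |t - t0| ≤ ε := fun t ht => by
    rw [abs_le]; constructor <;> linarith [ht.1, ht.2]
  obtain ⟨C, hC⟩ := hK.exists_bound_of_continuousOn
    (hf'.mono (by rintro ⟨t, a⟩ ⟨ht, ha⟩; exact hin t a (habs t ht) ha))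
  have hnb : Metric.ball t0 ε ∈ 𝓝 t0 := Metric.ball_mem_nhds _ hε
  have hball : ∀ t ∈ Metric.ball t0 ε, |t - t0| ≤ ε := fun t ht => by
    rw [Metric.mem_ball, Real.dist_eq] at ht; exact ht.le
  have hmeas : ∀ g : ℝ → ℝ, ContinuousOn g (Icc α β) →
      AEStronglyMeasurable g (volume.restrict (uIoc α β)) := fun g hg => by
    rw [uIoc_of_le hab]
    exact (hg.mono Ioc_subset_Icc_self).aestronglyMeasurable measurableSet_Ioc
  refine (intervalIntegral.hasDerivAt_integral_of_dominated_loc_of_deriv_le (F := f) (F' := f')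
    (bound := fun _ => C) hnb ?_ ?_ ?_ ?_ ?_ ?_).2
  · filter_upwards [hnb] with t ht
    exact hmeas _ (hcont f hf t (hball t ht))
  · exact (hcont f hf t0 (by simp [hε.le])).intervalIntegrable_of_Icc hab
  · exact hmeas _ (hcont f' hf' t0 (by simp [hε.le]))
  · refine Eventually.of_forall fun a ha t ht => ?_
    rw [uIoc_of_le hab] at ha
    have := hball t ht
    rw [abs_le] at this
    exact hC (t, a) ⟨⟨by linarith, by linarith⟩, Ioc_subset_Icc_self ha⟩
  · exact intervalIntegrable_const
  · refine Eventually.of_forall fun a ha t ht => ?_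
    rw [uIoc_of_le hab] at ha
    exact hd t a (hin t a (hball t ht) (Ioc_subset_Icc_self ha))

/-- Leibniz' rule with a moving upper endpoint. -/
lemma hasDerivAt_integral_moving {D : Set (ℝ × ℝ)} (hD : IsOpen D) {f f' : ℝ → ℝ → ℝ} {b : ℝ → ℝ}
    {t0 α b' : ℝ} (hab : α < b t0) (hb : HasDerivAt b b' t0)
    (h : ∀ a ∈ Icc α (b t0), (t0, a) ∈ D)
    (hf : ContinuousOn (fun z : ℝ × ℝ => f z.1 z.2) D)
    (hf' : ContinuousOn (fun z : ℝ × ℝ => f' z.1 z.2) D)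
    (hd : ∀ t a, (t, a) ∈ D → HasDerivAt (fun t => f t a) (f' t a) t) :
    HasDerivAt (fun t => ∫ a in α..b t, f t a)
      (b' * f t0 (b t0) + ∫ a in α..b t0, f' t0 a) t0 := by
  obtain ⟨ε, hε, H⟩ := exists_tube hD h
  have hc : ∀ t, |t - t0| ≤ ε → ContinuousOn (f t) (Icc α (b t0 + ε)) := fun t ht =>
    hf.comp (f := fun a => (t, a)) (by fun_prop)
      (fun a ha => H t a ht ⟨by linarith [ha.1], by linarith [ha.2]⟩ hab.le)
  have hnt : ∀ᶠ t in 𝓝 t0, |t - t0| ≤ ε := by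
    filter_upwards [Metric.ball_mem_nhds t0 hε] with t ht
    rw [Metric.mem_ball, Real.dist_eq] at ht; exact ht.le
  have hbt : ∀ δ > 0, ∀ᶠ t in 𝓝 t0, |b t - b t0| < δ := fun δ hδ => by
    filter_upwards [hb.continuousAt (Metric.ball_mem_nhds (b t0) hδ)] with t ht
    rwa [mem_preimage, Metric.mem_ball, Real.dist_eq] at ht
  have hsplit : (fun t => ∫ a in α..b t, f t a) =ᶠ[𝓝 t0]
      fun t => (∫ a in α..b t0, f t a) + ∫ a in b t0..b t, f t a := by
    filter_upwards [hnt, hbt ε hε, hbt (b t0 - α) (by linarith)] with t ht h1 h2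
    rw [abs_lt] at h1 h2
    refine (intervalIntegral.integral_add_adjacent_intervals ?_ ?_).symm
    · exact ((hc t ht).mono (Icc_subset_Icc_right (by linarith))).intervalIntegrable_of_Icc hab.le
    · refine ((hc t ht).mono ?_).intervalIntegrable
      exact uIcc_subset_Icc ⟨hab.le, by linarith⟩ ⟨by linarith, by linarith⟩
  have h1 := hasDerivAt_integral_fixed hD hab.le h hf hf' hd
  have h2 : HasDerivAt (fun t => ∫ a in b t0..b t, f t a) (b' * f t0 (b t0)) t0 := by
    rw [hasDerivAt_iff_isLittleO]
    have e : (fun t => (∫ a in b t0..b t, f t a) - (∫ a in b t0..b t0, f t0 a) -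
        (t - t0) • (b' * f t0 (b t0))) = fun t =>
        ((∫ a in b t0..b t, f t a) - (b t - b t0) * f t0 (b t0)) +
          f t0 (b t0) * (b t - b t0 - (t - t0) • b') := by
      ext t; simp only [intervalIntegral.integral_same, smul_eq_mul]; ring
    rw [e]
    refine Asymptotics.IsLittleO.add ?_ ((hasDerivAt_iff_isLittleO.1 hb).const_mul_left _)
    refine Asymptotics.IsLittleO.trans_isBigO (g := fun t => b t - b t0) ?_ hb.isBigO_sub
    rw [Asymptotics.isLittleO_iff]
    intro c hc0
    have hcat : ContinuousAt (fun z : ℝ × ℝ => f z.1 z.2) (t0, b t0) :=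
      hf.continuousAt (hD.mem_nhds (h _ (right_mem_Icc.2 hab.le)))
    obtain ⟨δ, hδ, Hδ⟩ := Metric.continuousAt_iff.1 hcat c hc0
    filter_upwards [hnt, hbt ε hε, hbt (b t0 - α) (by linarith), hbt δ hδ,
      Metric.ball_mem_nhds t0 hδ] with t ht h1 h2 h3 h4
    have hcon : (∫ a in b t0..b t, f t a) - (b t - b t0) * f t0 (b t0) =
        ∫ a in b t0..b t, (f t a - f t0 (b t0)) := by
      rw [intervalIntegral.integral_sub _ intervalIntegrable_const, intervalIntegral.integral_const,
        smul_eq_mul]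
      rw [abs_lt] at h1 h2
      refine ((hc t ht).mono ?_).intervalIntegrable
      exact uIcc_subset_Icc ⟨hab.le, by linarith⟩ ⟨by linarith, by linarith⟩
    rw [hcon]
    refine (intervalIntegral.norm_integral_le_of_norm_le_const fun a ha => ?_)
    have := Hδ (x := (t, a)) ?_
    · rw [Real.dist_eq] at this; exact this.le
    · rw [Prod.dist_eq, max_lt_iff]
      refine ⟨h4, ?_⟩
      rw [Real.dist_eq]
      refine lt_of_le_of_lt ?_ h3
      have := uIoc_subset_uIcc ha
      exact abs_sub_left_of_mem_uIcc this
  have := (h1.add h2).congr_of_eventuallyEq hsplit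
  rwa [add_comm] at this

/-- Continuity of an integral over `[R, a]` in the parameters and the endpoint. -/
lemma continuousOn_integral_moving {D : Set (ℝ × ℝ)} {R : ℝ} {F : ℝ × ℝ → ℝ → ℝ}
    (hR : ∀ z ∈ D, R < z.2)
    (hF : ContinuousOn (fun w : (ℝ × ℝ) × ℝ => F w.1 w.2)
      {w | w.1 ∈ D ∧ w.2 ∈ Icc R w.1.2}) (hD : IsOpen D) :
    ContinuousOn (fun z : ℝ × ℝ => ∫ s in R..z.2, F z s) D := by
  have key : ContinuousOn (fun z : ℝ × ℝ => (z.2 - R) *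
      ∫ θ in (0 : ℝ)..1, F z (R + (z.2 - R) * (projIcc (0 : ℝ) 1 zero_le_one θ : ℝ))) D := by
    refine ContinuousOn.mul (by fun_prop) ?_
    rw [continuousOn_iff_continuous_domRestrict]
    have : LocallyCompactSpace D := hD.locallyCompactSpace
    refine intervalIntegral.continuous_parametric_intervalIntegral_of_continuous'
      (f := fun (z : D) θ => F z (R + ((z : ℝ × ℝ).2 - R) *
        (projIcc (0 : ℝ) 1 zero_le_one θ : ℝ))) ?_ 0 1
    refine hF.comp_continuous (f := fun w : D × ℝ => ((w.1 : ℝ × ℝ), R + ((w.1 : ℝ × ℝ).2 - R) *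
        (projIcc (0 : ℝ) 1 zero_le_one w.2 : ℝ))) ?_ ?_
    · have : Continuous fun w : D × ℝ => (projIcc (0 : ℝ) 1 zero_le_one w.2 : ℝ) :=
        continuous_subtype_val.comp (continuous_projIcc.comp continuous_snd)
      fun_prop
    · rintro ⟨z, θ⟩
      have hz := hR z z.2
      have hp := (projIcc (0 : ℝ) 1 zero_le_one θ).2
      refine ⟨z.2, ?_, ?_⟩
      · have := mul_nonneg (sub_pos.2 hz).le hp.1
        simp only; linarith
      · have := mul_le_mul_of_nonneg_left hp.2 (sub_pos.2 hz).le
        simp only; linarith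
  refine key.congr fun z hz => ?_
  have hz' := hR z hz
  have e := intervalIntegral.smul_integral_comp_mul_add (fun s => F z s) (a := 0) (b := 1)
    (z.2 - R) R
  simp only [mul_zero, zero_add, mul_one, sub_add_cancel, smul_eq_mul] at e
  simp only
  rw [← e]
  congr 1
  refine intervalIntegral.integral_congr fun θ hθ => ?_
  rw [uIcc_of_le zero_le_one] at hθ
  simp only [projIcc_of_mem _ hθ]
  rw [add_comm]

/-- The Euler-type integrals `∫₀¹ √(1-σ²) σ^{2k} (1+σ²Y)^{-(5/2+k)} dσ`. -/
def eul (k : ℕ) (Y : ℝ) : ℝ :=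
  ∫ σ in (0 : ℝ)..1, √(1 - σ ^ 2) * σ ^ (2 * k) * (1 + σ ^ 2 * Y) ^ (-(5 / 2 + (k : ℝ)))

lemma eul_base_pos {Y σ : ℝ} (hY : -1 < Y) (hσ : σ ∈ Icc (0 : ℝ) 1) : 0 < 1 + σ ^ 2 * Y := by
  have h1 : σ ^ 2 ≤ 1 := by nlinarith [hσ.1, hσ.2]
  have h2 : 0 ≤ σ ^ 2 := sq_nonneg _
  rcases le_or_gt 0 Y with h | h
  · positivity
  · nlinarith

lemma eul_isOpen : IsOpen {z : ℝ × ℝ | 0 < 1 + z.2 ^ 2 * z.1} :=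
  isOpen_lt continuous_const (by fun_prop)

lemma eul_continuousOn (k : ℕ) (c : ℝ) : ContinuousOn (fun z : ℝ × ℝ =>
    √(1 - z.2 ^ 2) * z.2 ^ (2 * k) * (1 + z.2 ^ 2 * z.1) ^ c) {z : ℝ × ℝ | 0 < 1 + z.2 ^ 2 * z.1} := by
  refine ContinuousOn.mul (by fun_prop) ?_
  exact ContinuousOn.rpow_const (by fun_prop) fun z hz => Or.inl (ne_of_gt hz)

lemma eul_integrand_continuousOn (k : ℕ) (c : ℝ) {Y : ℝ} (hY : -1 < Y) : ContinuousOn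
    (fun σ : ℝ => √(1 - σ ^ 2) * σ ^ (2 * k) * (1 + σ ^ 2 * Y) ^ c) (Icc 0 1) :=
  (eul_continuousOn k c).comp (f := fun σ => (Y, σ)) (by fun_prop)
    fun _ hσ => eul_base_pos hY hσ

lemma eul_hasDerivAt (k : ℕ) {Y : ℝ} (hY : -1 < Y) :
    HasDerivAt (eul k) (-(5 / 2 + (k : ℝ)) * eul (k + 1) Y) Y := by
  have h := hasDerivAt_integral_fixed (f := fun Y σ => √(1 - σ ^ 2) * σ ^ (2 * k) *
      (1 + σ ^ 2 * Y) ^ (-(5 / 2 + (k : ℝ))))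
    (f' := fun Y σ => -(5 / 2 + (k : ℝ)) * (√(1 - σ ^ 2) * σ ^ (2 * (k + 1)) *
      (1 + σ ^ 2 * Y) ^ (-(5 / 2 + ((k + 1 : ℕ) : ℝ))))) (α := 0) (β := 1) (t0 := Y)
    eul_isOpen zero_le_one (fun σ hσ => eul_base_pos hY hσ) (eul_continuousOn k _)
    (continuousOn_const.mul (eul_continuousOn (k + 1) _)) ?_
  · rw [intervalIntegral.integral_const_mul] at h
    exact h
  · intro Y σ hz
    have h1 : HasDerivAt (fun Y => 1 + σ ^ 2 * Y) (σ ^ 2) Y := by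
      simpa using ((hasDerivAt_id Y).const_mul (σ ^ 2)).const_add 1
    have h2 := (h1.rpow_const (p := -(5 / 2 + (k : ℝ))) (Or.inl (ne_of_gt hz))).const_mul
      (√(1 - σ ^ 2) * σ ^ (2 * k))
    refine h2.congr_deriv ?_
    push_cast
    rw [show -(5 / 2 + (k : ℝ)) - 1 = -(5 / 2 + ((k : ℝ) + 1)) by ring]
    ring

lemma eul_nonneg (k : ℕ) {Y : ℝ} (hY : -1 < Y) : 0 ≤ eul k Y :=
  intervalIntegral.integral_nonneg zero_le_one fun σ hσ => by
    have := eul_base_pos hY hσ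
    have := hσ.1
    positivity

lemma sqrt_one_sub_le (σ : ℝ) : √(1 - σ ^ 2) ≤ 1 :=
  Real.sqrt_le_one.2 (by nlinarith [sq_nonneg σ])

lemma eul_rpow_hasDerivAt {Y σ : ℝ} (p : ℝ) (h : 0 < 1 + σ ^ 2 * Y) :
    HasDerivAt (fun σ : ℝ => (1 + σ ^ 2 * Y) ^ p) (2 * σ * Y * p * (1 + σ ^ 2 * Y) ^ (p - 1)) σ := by
  have h1 : HasDerivAt (fun σ : ℝ => 1 + σ ^ 2 * Y) (2 * σ * Y) σ := by
    simpa using ((hasDerivAt_pow 2 σ).mul_const Y).const_add 1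
  exact h1.rpow_const (Or.inl h.ne')

lemma eul_zero_le {Y : ℝ} (hY : 0 ≤ Y) : eul 0 Y ≤ (1 + Y) ^ (-(1 / 2) : ℝ) := by
  have hY' : -1 < Y := by linarith
  have hb : ∀ σ : ℝ, 1 ≤ 1 + σ ^ 2 * Y := fun σ => by
    have := mul_nonneg (sq_nonneg σ) hY; linarith
  have hp : ∀ σ : ℝ, 0 < 1 + σ ^ 2 * Y := fun σ => by linarith [hb σ]
  have hc : ∀ p : ℝ, Continuous fun σ : ℝ => (1 + σ ^ 2 * Y) ^ p := fun p =>
    Continuous.rpow_const (by fun_prop) fun σ => Or.inl (hp σ).ne'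
  have hd : ∀ σ : ℝ, HasDerivAt (fun σ : ℝ => σ * (1 + σ ^ 2 * Y) ^ (-(1 / 2) : ℝ))
      ((1 + σ ^ 2 * Y) ^ (-(3 / 2) : ℝ)) σ := fun σ => by
    have := (hasDerivAt_id σ).mul (eul_rpow_hasDerivAt (-(1 / 2)) (hp σ))
    refine this.congr_deriv ?_
    have e : (1 + σ ^ 2 * Y) ^ (-(1 / 2) : ℝ) =
        (1 + σ ^ 2 * Y) ^ (-(3 / 2) : ℝ) * (1 + σ ^ 2 * Y) := by
      rw [← Real.rpow_add_one (hp σ).ne']; norm_num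
    rw [e, show (-(1 / 2) - 1 : ℝ) = -(3 / 2) by norm_num]
    simp only [id]; ring
  have hI := intervalIntegral.integral_eq_sub_of_hasDerivAt (a := 0) (b := 1) (fun σ _ => hd σ)
    ((hc _).intervalIntegrable _ _)
  have : (1 : ℝ) * (1 + 1 ^ 2 * Y) ^ (-(1 / 2) : ℝ) - 0 * (1 + 0 ^ 2 * Y) ^ (-(1 / 2) : ℝ) =
    (1 + Y) ^ (-(1 / 2) : ℝ) := by simp
  rw [← this, ← hI]
  refine intervalIntegral.integral_mono_on zero_le_one
    ((eul_integrand_continuousOn 0 _ hY').intervalIntegrable_of_Icc zero_le_one)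
    ((hc _).intervalIntegrable _ _) fun σ hσ => ?_
  simp only [mul_zero, pow_zero, mul_one]
  refine (mul_le_mul (sqrt_one_sub_le σ) (Real.rpow_le_rpow_of_exponent_le (hb σ)
    (by norm_num : (-(5 / 2 + ((0 : ℕ) : ℝ)) ≤ -(3 / 2)))) (by have := hp σ; positivity) zero_le_one).trans
    (one_mul _).le

lemma eul_one_le {Y : ℝ} (hY : 0 ≤ Y) : eul 1 Y ≤ (1 + Y) ^ (-(3 / 2) : ℝ) / 3 := by
  have hY' : -1 < Y := by linarith
  have hb : ∀ σ : ℝ, 1 ≤ 1 + σ ^ 2 * Y := fun σ => by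
    have := mul_nonneg (sq_nonneg σ) hY; linarith
  have hp : ∀ σ : ℝ, 0 < 1 + σ ^ 2 * Y := fun σ => by linarith [hb σ]
  have hc : ∀ p : ℝ, Continuous fun σ : ℝ => (1 + σ ^ 2 * Y) ^ p := fun p =>
    Continuous.rpow_const (by fun_prop) fun σ => Or.inl (hp σ).ne'
  have hd : ∀ σ : ℝ, HasDerivAt (fun σ : ℝ => σ ^ 3 / 3 * (1 + σ ^ 2 * Y) ^ (-(3 / 2) : ℝ))
      (σ ^ 2 * (1 + σ ^ 2 * Y) ^ (-(5 / 2) : ℝ)) σ := fun σ => by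
    have := ((hasDerivAt_pow 3 σ).div_const 3).mul (eul_rpow_hasDerivAt (-(3 / 2)) (hp σ))
    refine this.congr_deriv ?_
    have e : (1 + σ ^ 2 * Y) ^ (-(3 / 2) : ℝ) =
        (1 + σ ^ 2 * Y) ^ (-(5 / 2) : ℝ) * (1 + σ ^ 2 * Y) := by
      rw [← Real.rpow_add_one (hp σ).ne']; norm_num
    rw [e, show (-(3 / 2) - 1 : ℝ) = -(5 / 2) by norm_num]
    push_cast; ring
  have hI := intervalIntegral.integral_eq_sub_of_hasDerivAt (a := 0) (b := 1) (fun σ _ => hd σ)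
    (((continuous_pow 2).mul (hc _)).intervalIntegrable _ _)
  have : (1 : ℝ) ^ 3 / 3 * (1 + 1 ^ 2 * Y) ^ (-(3 / 2) : ℝ) -
      0 ^ 3 / 3 * (1 + 0 ^ 2 * Y) ^ (-(3 / 2) : ℝ) =
    (1 + Y) ^ (-(3 / 2) : ℝ) / 3 := by simp; ring
  rw [← this, ← hI]
  refine intervalIntegral.integral_mono_on zero_le_one
    ((eul_integrand_continuousOn 1 _ hY').intervalIntegrable_of_Icc zero_le_one)
    (((continuous_pow 2).mul (hc _)).intervalIntegrable _ _) fun σ hσ => ?_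
  refine mul_le_mul ?_ (Real.rpow_le_rpow_of_exponent_le (hb σ)
    (by norm_num : (-(5 / 2 + ((1 : ℕ) : ℝ)) ≤ -(5 / 2)))) (by have := hp σ; positivity) (sq_nonneg σ)
  have := mul_le_mul_of_nonneg_right (sqrt_one_sub_le σ) (sq_nonneg σ)
  simpa using this

lemma eul_ode {Y : ℝ} (hY : -1 < Y) :
    35 / 4 * (Y * (1 + Y)) * eul 2 Y - 5 / 2 * (2 + 4 * Y) * eul 1 Y + 5 / 4 * eul 0 Y = 0 := by
  have hi : ∀ (k : ℕ) (c : ℝ), IntervalIntegrable (fun σ : ℝ => √(1 - σ ^ 2) * σ ^ (2 * k) *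
      (1 + σ ^ 2 * Y) ^ c) volume 0 1 := fun k c =>
    (eul_integrand_continuousOn k c hY).intervalIntegrable_of_Icc zero_le_one
  have hcont : ContinuousOn (fun σ : ℝ => 5 / 4 * σ * ((1 - σ ^ 2) * √(1 - σ ^ 2)) *
      (1 + σ ^ 2 * Y) ^ (-(7 / 2) : ℝ)) (Icc 0 1) := by
    refine ContinuousOn.mul (by fun_prop) ?_
    exact ContinuousOn.rpow_const (by fun_prop) fun σ hσ => Or.inl (eul_base_pos hY hσ).ne'
  have hd : ∀ σ ∈ Ioo (0 : ℝ) 1, HasDerivAt (fun σ : ℝ => 5 / 4 * σ * ((1 - σ ^ 2) * √(1 - σ ^ 2)) *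
      (1 + σ ^ 2 * Y) ^ (-(7 / 2) : ℝ))
      (35 / 4 * (Y * (1 + Y)) * (√(1 - σ ^ 2) * σ ^ (2 * 2) *
          (1 + σ ^ 2 * Y) ^ (-(5 / 2 + ((2 : ℕ) : ℝ)))) -
        5 / 2 * (2 + 4 * Y) * (√(1 - σ ^ 2) * σ ^ (2 * 1) *
          (1 + σ ^ 2 * Y) ^ (-(5 / 2 + ((1 : ℕ) : ℝ)))) +
        5 / 4 * (√(1 - σ ^ 2) * σ ^ (2 * 0) *
          (1 + σ ^ 2 * Y) ^ (-(5 / 2 + ((0 : ℕ) : ℝ))))) σ := fun σ hσ => by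
    have hX := eul_base_pos hY (Ioo_subset_Icc_self hσ)
    have h1 : 0 < 1 - σ ^ 2 := by nlinarith [hσ.1, hσ.2]
    have hq : HasDerivAt (fun σ : ℝ => 1 - σ ^ 2) (-(2 * σ)) σ := by
      simpa using (hasDerivAt_pow 2 σ).const_sub 1
    have h2 := ((((hasDerivAt_id σ).const_mul (5 / 4 : ℝ)).mul (hq.mul (hq.sqrt h1.ne'))).mul
      (eul_rpow_hasDerivAt (-(7 / 2)) hX))
    refine h2.congr_deriv ?_
    have hs : √(1 - σ ^ 2) ≠ 0 := (Real.sqrt_pos.2 h1).ne'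
    have hs2 : √(1 - σ ^ 2) ^ 2 = 1 - σ ^ 2 := Real.sq_sqrt h1.le
    have e1 : (1 + σ ^ 2 * Y) ^ (-(7 / 2) : ℝ) =
        (1 + σ ^ 2 * Y) ^ (-(9 / 2) : ℝ) * (1 + σ ^ 2 * Y) := by
      rw [← Real.rpow_add_one hX.ne']; norm_num
    have e2 : (1 + σ ^ 2 * Y) ^ (-(5 / 2) : ℝ) =
        (1 + σ ^ 2 * Y) ^ (-(9 / 2) : ℝ) * (1 + σ ^ 2 * Y) * (1 + σ ^ 2 * Y) := by
      rw [← Real.rpow_add_one hX.ne', ← Real.rpow_add_one hX.ne']; norm_num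
    rw [show (-(5 / 2 + ((2 : ℕ) : ℝ))) = -(9 / 2) by norm_num,
      show (-(5 / 2 + ((1 : ℕ) : ℝ))) = -(7 / 2) by norm_num,
      show (-(5 / 2 + ((0 : ℕ) : ℝ))) = -(5 / 2) by norm_num,
      show (-(7 / 2) - 1 : ℝ) = -(9 / 2) by norm_num, e1, e2]
    have e3 : (1 - σ ^ 2) * (-(2 * σ) / (2 * √(1 - σ ^ 2))) = -σ * √(1 - σ ^ 2) := by
      nth_rw 1 [← hs2]; field_simp
    simp only [Pi.mul_apply, id]
    rw [e3]
    ring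
  have hI := intervalIntegral.integral_eq_sub_of_hasDerivAt_of_le zero_le_one hcont hd
    (((((hi 2 _).const_mul _).sub ((hi 1 _).const_mul _)).add ((hi 0 _).const_mul _)))
  rw [intervalIntegral.integral_add (((hi 2 _).const_mul _).sub ((hi 1 _).const_mul _))
    ((hi 0 _).const_mul _), intervalIntegral.integral_sub ((hi 2 _).const_mul _)
    ((hi 1 _).const_mul _)] at hI
  simp only [intervalIntegral.integral_const_mul] at hI
  simp only [eul]
  rw [hI]
  simp

lemma eul_zero_zero : eul 0 0 = π / 4 := by
  have e : eul 0 0 = ∫ σ in (0 : ℝ)..1, √(1 - σ ^ 2) := by simp [eul]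
  have h1 : (∫ σ in (-1 : ℝ)..0, √(1 - σ ^ 2)) = ∫ σ in (0 : ℝ)..1, √(1 - σ ^ 2) := by
    have := intervalIntegral.integral_comp_neg (fun σ : ℝ => √(1 - σ ^ 2)) (a := 0) (b := 1)
    simpa using this.symm
  have hc : Continuous fun σ : ℝ => √(1 - σ ^ 2) := by fun_prop
  have h2 := intervalIntegral.integral_add_adjacent_intervals (hc.intervalIntegrable (-1) 0)
    (hc.intervalIntegrable 0 1) (μ := volume)
  rw [integral_sqrt_one_sub_sq, h1] at h2
  rw [e]; linarith

/-- The profile of the Riemann function of the four-dimensional radial wave equation. -/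
def Phi (Y : ℝ) : ℝ := 3 / (2 * π) * eul 0 Y

/-- Its first derivative. -/
def Phi1 (Y : ℝ) : ℝ := 3 / (2 * π) * (-(5 / 2) * eul 1 Y)

/-- Its second derivative. -/
def Phi2 (Y : ℝ) : ℝ := 3 / (2 * π) * (35 / 4 * eul 2 Y)

lemma Phi_hasDerivAt {Y : ℝ} (hY : -1 < Y) : HasDerivAt Phi (Phi1 Y) Y := by
  have := (eul_hasDerivAt 0 hY).const_mul (3 / (2 * π))
  refine this.congr_deriv ?_
  simp only [Phi1]; push_cast; ring

lemma Phi1_hasDerivAt {Y : ℝ} (hY : -1 < Y) : HasDerivAt Phi1 (Phi2 Y) Y := by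
  have := ((eul_hasDerivAt 1 hY).const_mul (-(5 / 2))).const_mul (3 / (2 * π))
  refine this.congr_deriv ?_
  simp only [Phi2]; push_cast; ring

lemma Phi2_continuousAt {Y : ℝ} (hY : -1 < Y) : ContinuousAt Phi2 Y :=
  (((eul_hasDerivAt 2 hY).const_mul (35 / 4)).const_mul (3 / (2 * π))).continuousAt

lemma Phi_ode {Y : ℝ} (hY : -1 < Y) :
    Y * (1 + Y) * Phi2 Y + (2 + 4 * Y) * Phi1 Y + 5 / 4 * Phi Y = 0 := by
  have := eul_ode hY
  simp only [Phi, Phi1, Phi2]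
  linear_combination (3 / (2 * π)) * this

lemma Phi_zero : Phi 0 = 3 / 8 := by
  rw [Phi, eul_zero_zero]; field_simp; norm_num

lemma kappa_le : 3 / (2 * π) ≤ 1 / 2 := by
  rw [div_le_div_iff₀ (by positivity) (by norm_num)]; linarith [Real.pi_gt_three]

lemma abs_Phi_le {Y : ℝ} (hY : 0 ≤ Y) : |Phi Y| ≤ 1 / 2 * (1 + Y) ^ (-(1 / 2) : ℝ) := by
  have h0 := eul_nonneg 0 (by linarith : -1 < Y)
  rw [Phi, abs_of_nonneg (by positivity)]
  exact mul_le_mul kappa_le (eul_zero_le hY) h0 (by norm_num)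

lemma abs_Phi1_le {Y : ℝ} (hY : 0 ≤ Y) : |Phi1 Y| ≤ 1 / 2 * (1 + Y) ^ (-(3 / 2) : ℝ) := by
  have h0 := eul_nonneg 1 (by linarith : -1 < Y)
  have h1 := eul_one_le hY
  have hx : 0 ≤ (1 + Y) ^ (-(3 / 2) : ℝ) := by positivity
  rw [Phi1, abs_mul, abs_mul, abs_of_nonneg h0, abs_of_nonneg (by positivity : 0 ≤ 3 / (2 * π))]
  refine mul_le_mul kappa_le ?_ (by positivity) (by norm_num)
  rw [abs_of_neg (by norm_num : (-(5 / 2) : ℝ) < 0)]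
  linarith

/-- The domain of the Riemann kernel in the characteristic coordinates `(t, a = r - t)`. -/
def Dm (t a s : ℝ) : Prop := 0 < s ∧ 0 < a ∧ 0 < a + t ∧ 0 < a + s + 2 * t

def kY (t a s : ℝ) : ℝ := (a - s) * (a - s + 2 * t) / (4 * (a + t) * s)
def kYt (t a s : ℝ) : ℝ := (a ^ 2 - s ^ 2) / (4 * s * (a + t) ^ 2)
def kYa (t a s : ℝ) : ℝ := ((a + t) ^ 2 - s ^ 2 + t ^ 2) / (4 * (a + t) ^ 2 * s)

/-- The Riemann kernel of the four-dimensional radial wave equation, and its derivatives. -/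
def kM (t a s : ℝ) : ℝ := t / ((a + t) * s) * Phi (kY t a s)
def kMt (t a s : ℝ) : ℝ := a / ((a + t) ^ 2 * s) * Phi (kY t a s) +
  t / ((a + t) * s) * (kYt t a s * Phi1 (kY t a s))
def kMa (t a s : ℝ) : ℝ := -t / ((a + t) ^ 2 * s) * Phi (kY t a s) +
  t / ((a + t) * s) * (kYa t a s * Phi1 (kY t a s))
def kMtt (t a s : ℝ) : ℝ := -2 * a / ((a + t) ^ 3 * s) * Phi (kY t a s) +
  2 * a / ((a + t) ^ 2 * s) * (kYt t a s * Phi1 (kY t a s)) +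
  t / ((a + t) * s) * (-(a ^ 2 - s ^ 2) / (2 * s * (a + t) ^ 3) * Phi1 (kY t a s) +
    kYt t a s ^ 2 * Phi2 (kY t a s))
def kMta (t a s : ℝ) : ℝ := (t - a) / ((a + t) ^ 3 * s) * Phi (kY t a s) +
  a / ((a + t) ^ 2 * s) * (kYa t a s * Phi1 (kY t a s)) +
  -t / ((a + t) ^ 2 * s) * (kYt t a s * Phi1 (kY t a s)) +
  t / ((a + t) * s) * ((a / (2 * s * (a + t) ^ 2) - (a ^ 2 - s ^ 2) / (2 * s * (a + t) ^ 3)) *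
    Phi1 (kY t a s) + kYt t a s * kYa t a s * Phi2 (kY t a s))

lemma kY_add_one {t a s : ℝ} (h : Dm t a s) :
    1 + kY t a s = (a + s) * (a + s + 2 * t) / (4 * (a + t) * s) := by
  obtain ⟨h1, h2, h3, h4⟩ := h
  rw [kY]; field_simp; ring

lemma kY_gt {t a s : ℝ} (h : Dm t a s) : -1 < kY t a s := by
  have e := kY_add_one h
  obtain ⟨h1, h2, h3, h4⟩ := h
  have : 0 < 1 + kY t a s := by rw [e]; positivity
  linarith

lemma kY_hasDerivAt_t {t a s : ℝ} (h : Dm t a s) :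
    HasDerivAt (fun t => kY t a s) (kYt t a s) t := by
  obtain ⟨h1, h2, h3, h4⟩ := h
  have hi := hasDerivAt_id t
  have := (((hi.const_mul 2).const_add (a - s)).const_mul (a - s)).div
    (((hi.const_add a).const_mul 4).mul_const s) (by simp only [id]; positivity)
  refine this.congr_deriv ?_
  simp only [kYt, id]; field_simp; ring

lemma kY_hasDerivAt_a {t a s : ℝ} (h : Dm t a s) :
    HasDerivAt (fun a => kY t a s) (kYa t a s) a := by
  obtain ⟨h1, h2, h3, h4⟩ := h
  have hi := hasDerivAt_id a
  have := ((hi.sub_const s).mul ((hi.sub_const s).add_const (2 * t))).div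
    (((hi.add_const t).const_mul 4).mul_const s) (by simp only [id]; positivity)
  refine this.congr_deriv ?_
  simp only [kYa, id, Pi.mul_apply]; field_simp; ring

lemma kYt_hasDerivAt_t {t a s : ℝ} (h : Dm t a s) :
    HasDerivAt (fun t => kYt t a s) (-(a ^ 2 - s ^ 2) / (2 * s * (a + t) ^ 3)) t := by
  obtain ⟨h1, h2, h3, h4⟩ := h
  have hi := hasDerivAt_id t
  have := (hasDerivAt_const t (a ^ 2 - s ^ 2)).div (((hi.const_add a).pow 2).const_mul (4 * s))
    (by simp only [id, Pi.pow_apply]; positivity)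
  refine this.congr_deriv ?_
  simp only [id, Pi.pow_apply]; push_cast; field_simp; ring

lemma kYt_hasDerivAt_a {t a s : ℝ} (h : Dm t a s) :
    HasDerivAt (fun a => kYt t a s)
      (a / (2 * s * (a + t) ^ 2) - (a ^ 2 - s ^ 2) / (2 * s * (a + t) ^ 3)) a := by
  obtain ⟨h1, h2, h3, h4⟩ := h
  have hi := hasDerivAt_id a
  have := ((hi.pow 2).sub_const (s ^ 2)).div (((hi.add_const t).pow 2).const_mul (4 * s))
    (by simp only [id, Pi.pow_apply]; positivity)
  refine this.congr_deriv ?_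
  simp only [id, Pi.pow_apply]; push_cast; field_simp; ring

lemma kYa_hasDerivAt_t {t a s : ℝ} (h : Dm t a s) :
    HasDerivAt (fun t => kYa t a s)
      (a / (2 * s * (a + t) ^ 2) - (a ^ 2 - s ^ 2) / (2 * s * (a + t) ^ 3)) t := by
  obtain ⟨h1, h2, h3, h4⟩ := h
  have hi := hasDerivAt_id t
  have := ((((hi.const_add a).pow 2).sub_const (s ^ 2)).add (hi.pow 2)).div
    ((((hi.const_add a).pow 2).const_mul 4).mul_const s)
    (by simp only [id, Pi.pow_apply]; positivity)
  refine this.congr_deriv ?_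
  simp only [id, Pi.pow_apply, Pi.add_apply]; push_cast; field_simp; ring

lemma kM_hasDerivAt_t {t a s : ℝ} (h : Dm t a s) :
    HasDerivAt (fun t => kM t a s) (kMt t a s) t := by
  have hP := (Phi_hasDerivAt (kY_gt h)).comp t (kY_hasDerivAt_t h)
  obtain ⟨h1, h2, h3, h4⟩ := h
  have hi := hasDerivAt_id t
  have := (hi.div ((hi.const_add a).mul_const s) (by simp only [id]; positivity)).mul hP
  refine this.congr_deriv ?_
  simp only [kMt, id, Pi.div_apply, Function.comp]; field_simp; ring

lemma kM_hasDerivAt_a {t a s : ℝ} (h : Dm t a s) :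
    HasDerivAt (fun a => kM t a s) (kMa t a s) a := by
  have hP := (Phi_hasDerivAt (kY_gt h)).comp a (kY_hasDerivAt_a h)
  obtain ⟨h1, h2, h3, h4⟩ := h
  have hi := hasDerivAt_id a
  have := ((hasDerivAt_const a t).div ((hi.add_const t).mul_const s)
    (by simp only [id]; positivity)).mul hP
  refine this.congr_deriv ?_
  simp only [kMa, id, Pi.div_apply, Function.comp]; field_simp; ring

lemma kMt_hasDerivAt_t {t a s : ℝ} (h : Dm t a s) :
    HasDerivAt (fun t => kMt t a s) (kMtt t a s) t := by
  have hP := (Phi_hasDerivAt (kY_gt h)).comp t (kY_hasDerivAt_t h)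
  have hP1 := (Phi1_hasDerivAt (kY_gt h)).comp t (kY_hasDerivAt_t h)
  have hYt := kYt_hasDerivAt_t h
  obtain ⟨h1, h2, h3, h4⟩ := h
  have hi := hasDerivAt_id t
  have := (((hasDerivAt_const t a).div (((hi.const_add a).pow 2).mul_const s)
    (by simp only [id, Pi.pow_apply]; positivity)).mul hP).add
    ((hi.div ((hi.const_add a).mul_const s) (by simp only [id]; positivity)).mul (hYt.mul hP1))
  refine this.congr_deriv ?_
  simp only [kMtt, id, Pi.div_apply, Pi.pow_apply, Pi.mul_apply, Function.comp]
  push_cast; field_simp; ring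

lemma kMt_hasDerivAt_a {t a s : ℝ} (h : Dm t a s) :
    HasDerivAt (fun a => kMt t a s) (kMta t a s) a := by
  have hP := (Phi_hasDerivAt (kY_gt h)).comp a (kY_hasDerivAt_a h)
  have hP1 := (Phi1_hasDerivAt (kY_gt h)).comp a (kY_hasDerivAt_a h)
  have hYt := kYt_hasDerivAt_a h
  obtain ⟨h1, h2, h3, h4⟩ := h
  have hi := hasDerivAt_id a
  have := ((hi.div (((hi.add_const t).pow 2).mul_const s)
    (by simp only [id, Pi.pow_apply]; positivity)).mul hP).add
    (((hasDerivAt_const a t).div ((hi.add_const t).mul_const s)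
      (by simp only [id]; positivity)).mul (hYt.mul hP1))
  refine this.congr_deriv ?_
  simp only [kMta, id, Pi.div_apply, Pi.pow_apply, Pi.mul_apply, Function.comp]
  push_cast; field_simp; ring

lemma kMa_hasDerivAt_t {t a s : ℝ} (h : Dm t a s) :
    HasDerivAt (fun t => kMa t a s) (kMta t a s) t := by
  have hP := (Phi_hasDerivAt (kY_gt h)).comp t (kY_hasDerivAt_t h)
  have hP1 := (Phi1_hasDerivAt (kY_gt h)).comp t (kY_hasDerivAt_t h)
  have hYa := kYa_hasDerivAt_t h
  obtain ⟨h1, h2, h3, h4⟩ := h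
  have hi := hasDerivAt_id t
  have := ((hi.neg.div (((hi.const_add a).pow 2).mul_const s)
    (by simp only [id, Pi.pow_apply]; positivity)).mul hP).add
    ((hi.div ((hi.const_add a).mul_const s) (by simp only [id]; positivity)).mul (hYa.mul hP1))
  refine this.congr_deriv ?_
  simp only [kMta, id, Pi.div_apply, Pi.pow_apply, Pi.mul_apply, Pi.neg_apply, Function.comp]
  push_cast; field_simp; ring

lemma kM_pde {t a s : ℝ} (h : Dm t a s) :
    kMtt t a s - 2 * kMta t a s + 3 / 4 * kM t a s / (a + t) ^ 2 = 0 := by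
  have hode := Phi_ode (kY_gt h)
  have e : kMtt t a s - 2 * kMta t a s + 3 / 4 * kM t a s / (a + t) ^ 2 =
      -(t / ((a + t) ^ 3 * s)) * (kY t a s * (1 + kY t a s) * Phi2 (kY t a s) +
        (2 + 4 * kY t a s) * Phi1 (kY t a s) + 5 / 4 * Phi (kY t a s)) := by
    obtain ⟨h1, h2, h3, h4⟩ := h
    rw [kMtt, kMta, kM]
    generalize hF : Phi (kY t a s) = F
    generalize hF1 : Phi1 (kY t a s) = F1
    generalize hF2 : Phi2 (kY t a s) = F2
    rw [kY, kYt, kYa]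
    field_simp
    ring
  rw [e, hode, mul_zero]

lemma Dm_isOpen : IsOpen {w : (ℝ × ℝ) × ℝ | Dm w.1.1 w.1.2 w.2} := by
  simp only [Dm, ofPred_and]
  refine ((isOpen_lt ?_ ?_).inter ((isOpen_lt ?_ ?_).inter ((isOpen_lt ?_ ?_).inter
    (isOpen_lt ?_ ?_)))) <;> fun_prop

lemma kernel_continuousOn {F : ℝ → ℝ → ℝ → ℝ} (hF : F = kM ∨ F = kMt ∨ F = kMa ∨ F = kMtt ∨ F = kMta) :
    ContinuousOn (fun w : (ℝ × ℝ) × ℝ => F w.1.1 w.1.2 w.2) {w | Dm w.1.1 w.1.2 w.2} := by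
  intro w hw
  refine ContinuousAt.continuousWithinAt ?_
  have hw' : Dm w.1.1 w.1.2 w.2 := hw
  have hr : w.1.2 + w.1.1 ≠ 0 := hw'.2.2.1.ne'
  have hs : w.2 ≠ 0 := hw'.1.ne'
  have hY : ContinuousAt (fun w : (ℝ × ℝ) × ℝ => kY w.1.1 w.1.2 w.2) w := by
    unfold kY; fun_prop (disch := positivity)
  have hYt : ContinuousAt (fun w : (ℝ × ℝ) × ℝ => kYt w.1.1 w.1.2 w.2) w := by
    unfold kYt; fun_prop (disch := positivity)
  have hYa : ContinuousAt (fun w : (ℝ × ℝ) × ℝ => kYa w.1.1 w.1.2 w.2) w := by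
    unfold kYa; fun_prop (disch := positivity)
  have h0 : ContinuousAt (fun w : (ℝ × ℝ) × ℝ => Phi (kY w.1.1 w.1.2 w.2)) w :=
    ContinuousAt.comp (f := fun w : (ℝ × ℝ) × ℝ => kY w.1.1 w.1.2 w.2) (g := Phi)
      (Phi_hasDerivAt (kY_gt hw')).continuousAt hY
  have h1 : ContinuousAt (fun w : (ℝ × ℝ) × ℝ => Phi1 (kY w.1.1 w.1.2 w.2)) w :=
    ContinuousAt.comp (f := fun w : (ℝ × ℝ) × ℝ => kY w.1.1 w.1.2 w.2) (g := Phi1)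
      (Phi1_hasDerivAt (kY_gt hw')).continuousAt hY
  have h2 : ContinuousAt (fun w : (ℝ × ℝ) × ℝ => Phi2 (kY w.1.1 w.1.2 w.2)) w :=
    ContinuousAt.comp (f := fun w : (ℝ × ℝ) × ℝ => kY w.1.1 w.1.2 w.2) (g := Phi2)
      (Phi2_continuousAt (kY_gt hw')) hY
  rcases hF with rfl | rfl | rfl | rfl | rfl
  · unfold kM; fun_prop (disch := positivity)
  · unfold kMt; fun_prop (disch := positivity)
  · unfold kMa; fun_prop (disch := positivity)
  · unfold kMtt; fun_prop (disch := positivity)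
  · unfold kMta; fun_prop (disch := positivity)

section

/-- The region `a > R`, `a + 2t > R` in characteristic coordinates. -/
def Dy (R : ℝ) : Set (ℝ × ℝ) := {z | R < z.2 ∧ 0 < z.2 - R + 2 * z.1}

lemma Dy_isOpen (R : ℝ) : IsOpen (Dy R) := by
  exact (isOpen_lt (f := fun _ : ℝ × ℝ => R) (g := fun z => z.2) (by fun_prop) (by fun_prop)).inter
    (isOpen_lt (f := fun _ : ℝ × ℝ => (0 : ℝ)) (g := fun z => z.2 - R + 2 * z.1) (by fun_prop)
      (by fun_prop))

lemma Dy_Dm {R t a s : ℝ} (hR : 0 < R) (h : (t, a) ∈ Dy R) (hs : s ∈ Icc R a) : Dm t a s := by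
  obtain ⟨h1, h2⟩ := h
  simp only at h1 h2
  refine ⟨by linarith [hs.1], by linarith, by linarith, by linarith [hs.1]⟩

/-- The outgoing solution with profile `g` and its derivatives in the coordinates `(t, a)`. -/
def yv (R : ℝ) (g : ℝ → ℝ) (t a : ℝ) : ℝ := g a + ∫ s in R..a, g s * kM t a s
def yt (R : ℝ) (g : ℝ → ℝ) (t a : ℝ) : ℝ := ∫ s in R..a, g s * kMt t a s
def ya (R : ℝ) (g g' : ℝ → ℝ) (t a : ℝ) : ℝ :=
  g' a + g a * (3 / 8 * t / ((a + t) * a)) + ∫ s in R..a, g s * kMa t a s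
def ytt (R : ℝ) (g : ℝ → ℝ) (t a : ℝ) : ℝ := ∫ s in R..a, g s * kMtt t a s
def yta (R : ℝ) (g : ℝ → ℝ) (t a : ℝ) : ℝ :=
  g a * (3 / 8 / (a + t) ^ 2) + ∫ s in R..a, g s * kMta t a s

variable {R : ℝ} {g g' : ℝ → ℝ}

lemma kY_diag (t a : ℝ) : kY t a a = 0 := by simp [kY]

lemma kernel_integral_continuousOn (hR : 0 < R) (hg : Continuous g) {F : ℝ → ℝ → ℝ → ℝ}
    (hF : F = kM ∨ F = kMt ∨ F = kMa ∨ F = kMtt ∨ F = kMta) :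
    ContinuousOn (fun z : ℝ × ℝ => ∫ s in R..z.2, g s * F z.1 z.2 s) (Dy R) := by
  refine continuousOn_integral_moving (F := fun z s => g s * F z.1 z.2 s) (fun z hz => hz.1) ?_
    (Dy_isOpen R)
  refine ContinuousOn.mul (by fun_prop) ((kernel_continuousOn hF).mono ?_)
  rintro ⟨⟨t, a⟩, s⟩ ⟨h1, h2⟩
  exact Dy_Dm hR h1 h2

lemma kernel_deriv_t (hR : 0 < R) (hg : Continuous g) {F F' : ℝ → ℝ → ℝ → ℝ}
    (hF : F = kM ∨ F = kMt ∨ F = kMa ∨ F = kMtt ∨ F = kMta)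
    (hF' : F' = kM ∨ F' = kMt ∨ F' = kMa ∨ F' = kMtt ∨ F' = kMta)
    (hd : ∀ t a s, Dm t a s → HasDerivAt (fun t => F t a s) (F' t a s) t)
    {t a : ℝ} (h : (t, a) ∈ Dy R) :
    HasDerivAt (fun t => ∫ s in R..a, g s * F t a s) (∫ s in R..a, g s * F' t a s) t := by
  refine hasDerivAt_integral_fixed (D := {z | Dm z.1 a z.2}) (f := fun t s => g s * F t a s)
    (f' := fun t s => g s * F' t a s) ?_ h.1.le (fun s hs => Dy_Dm hR h hs) ?_ ?_ ?_
  · exact Dm_isOpen.preimage (f := fun z : ℝ × ℝ => ((z.1, a), z.2)) (by fun_prop)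
  · exact ContinuousOn.mul (by fun_prop) ((kernel_continuousOn hF).comp
      (f := fun z : ℝ × ℝ => ((z.1, a), z.2)) (by fun_prop) fun z hz => hz)
  · exact ContinuousOn.mul (by fun_prop) ((kernel_continuousOn hF').comp
      (f := fun z : ℝ × ℝ => ((z.1, a), z.2)) (by fun_prop) fun z hz => hz)
  · exact fun t s hz => (hd t a s hz).const_mul (g s)

lemma kernel_deriv_a (hR : 0 < R) (hg : Continuous g) {F F' : ℝ → ℝ → ℝ → ℝ}
    (hF : F = kM ∨ F = kMt ∨ F = kMa ∨ F = kMtt ∨ F = kMta)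
    (hF' : F' = kM ∨ F' = kMt ∨ F' = kMa ∨ F' = kMtt ∨ F' = kMta)
    (hd : ∀ t a s, Dm t a s → HasDerivAt (fun a => F t a s) (F' t a s) a)
    {t a : ℝ} (h : (t, a) ∈ Dy R) :
    HasDerivAt (fun a => ∫ s in R..a, g s * F t a s)
      (g a * F t a a + ∫ s in R..a, g s * F' t a s) a := by
  have := hasDerivAt_integral_moving (D := {z | Dm t z.1 z.2}) (f := fun a s => g s * F t a s)
    (f' := fun a s => g s * F' t a s) (b := fun a => a) (t0 := a) (b' := 1) (α := R) ?_ h.1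
    (hasDerivAt_id a) (fun s hs => Dy_Dm hR h hs) ?_ ?_ ?_
  · simpa using this
  · exact Dm_isOpen.preimage (f := fun z : ℝ × ℝ => ((t, z.1), z.2)) (by fun_prop)
  · exact ContinuousOn.mul (by fun_prop) ((kernel_continuousOn hF).comp
      (f := fun z : ℝ × ℝ => ((t, z.1), z.2)) (by fun_prop) fun z hz => hz)
  · exact ContinuousOn.mul (by fun_prop) ((kernel_continuousOn hF').comp
      (f := fun z : ℝ × ℝ => ((t, z.1), z.2)) (by fun_prop) fun z hz => hz)
  · exact fun a s hz => (hd t a s hz).const_mul (g s)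

lemma Dy_pos (hR : 0 < R) {z : ℝ × ℝ} (h : z ∈ Dy R) : 0 < z.2 ∧ 0 < z.2 + z.1 := by
  obtain ⟨h1, h2⟩ := h
  constructor <;> linarith

lemma yv_deriv_t (hR : 0 < R) (hg : Continuous g) {t a : ℝ} (h : (t, a) ∈ Dy R) :
    HasDerivAt (fun t => yv R g t a) (yt R g t a) t :=
  (kernel_deriv_t hR hg (by simp) (by simp) (fun _ _ _ => kM_hasDerivAt_t) h).const_add (g a)

lemma yt_deriv_t (hR : 0 < R) (hg : Continuous g) {t a : ℝ} (h : (t, a) ∈ Dy R) :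
    HasDerivAt (fun t => yt R g t a) (ytt R g t a) t :=
  kernel_deriv_t hR hg (by simp) (by simp) (fun _ _ _ => kMt_hasDerivAt_t) h

lemma ya_deriv_t (hR : 0 < R) (hg : Continuous g) {t a : ℝ} (h : (t, a) ∈ Dy R) :
    HasDerivAt (fun t => ya R g g' t a) (yta R g t a) t := by
  have h1 := kernel_deriv_t hR hg (F := kMa) (F' := kMta) (by simp) (by simp)
    (fun _ _ _ => kMa_hasDerivAt_t) h
  obtain ⟨p1, p2⟩ := Dy_pos hR h
  simp only at p1 p2
  have hi := hasDerivAt_id t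
  have h2 := ((((hi.const_mul (3 / 8)).div ((hi.const_add a).mul_const a)
    (by simp only [id]; positivity)).const_mul (g a)).const_add (g' a)).add h1
  refine h2.congr_deriv ?_
  simp only [yta, id]
  congr 1
  field_simp
  ring

lemma yv_deriv_a (hR : 0 < R) (hg : Continuous g) {t a : ℝ} (h : (t, a) ∈ Dy R)
    (hd : HasDerivAt g (g' a) a) :
    HasDerivAt (fun a => yv R g t a) (ya R g g' t a) a := by
  have h1 := hd.add (kernel_deriv_a hR hg (F := kM) (F' := kMa) (by simp) (by simp)
    (fun _ _ _ => kM_hasDerivAt_a) h)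
  obtain ⟨p1, p2⟩ := Dy_pos hR h
  simp only at p1 p2
  refine h1.congr_deriv ?_
  rw [ya, kM, kY_diag, Phi_zero]
  ring

lemma yt_deriv_a (hR : 0 < R) (hg : Continuous g) {t a : ℝ} (h : (t, a) ∈ Dy R) :
    HasDerivAt (fun a => yt R g t a) (yta R g t a) a := by
  have h1 := kernel_deriv_a hR hg (F := kMt) (F' := kMta) (by simp) (by simp)
    (fun _ _ _ => kMt_hasDerivAt_a) h
  obtain ⟨p1, p2⟩ := Dy_pos hR h
  simp only at p1 p2
  refine h1.congr_deriv ?_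
  rw [yta, kMt, kY_diag, Phi_zero, kYt]
  field_simp
  ring

lemma y_pde (hR : 0 < R) (hg : Continuous g) {t a : ℝ} (h : (t, a) ∈ Dy R) :
    ytt R g t a - 2 * yta R g t a + 3 / 4 * yv R g t a / (a + t) ^ 2 = 0 := by
  have hc : ∀ F : ℝ → ℝ → ℝ → ℝ, (F = kM ∨ F = kMt ∨ F = kMa ∨ F = kMtt ∨ F = kMta) →
      IntervalIntegrable (fun s => g s * F t a s) volume R a := fun F hF =>
    (ContinuousOn.mul (by fun_prop) ((kernel_continuousOn hF).comp
      (f := fun s : ℝ => ((t, a), s)) (by fun_prop)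
      fun s hs => Dy_Dm hR h hs)).intervalIntegrable_of_Icc h.1.le
  have e : (∫ s in R..a, (g s * kMtt t a s - 2 * (g s * kMta t a s) +
      3 / 4 / (a + t) ^ 2 * (g s * kM t a s))) = 0 := by
    rw [← intervalIntegral.integral_zero (a := R) (b := a) (μ := volume) (E := ℝ)]
    refine intervalIntegral.integral_congr fun s hs => ?_
    rw [uIcc_of_le h.1.le] at hs
    have := kM_pde (Dy_Dm hR h hs)
    linear_combination (g s) * this
  rw [intervalIntegral.integral_add ((hc kMtt (by simp)).sub ((hc kMta (by simp)).const_mul 2))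
    ((hc kM (by simp)).const_mul _), intervalIntegral.integral_sub (hc kMtt (by simp))
    ((hc kMta (by simp)).const_mul 2), intervalIntegral.integral_const_mul,
    intervalIntegral.integral_const_mul] at e
  obtain ⟨p1, p2⟩ := Dy_pos hR h
  simp only at p1 p2
  rw [ytt, yta, yv]
  linear_combination e

lemma y_continuousOn (hR : 0 < R) (hg : Continuous g) (hg' : ContinuousOn g' (Ioi R)) :
    ContinuousOn (fun z : ℝ × ℝ => yv R g z.1 z.2) (Dy R) ∧
    ContinuousOn (fun z : ℝ × ℝ => yt R g z.1 z.2) (Dy R) ∧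
    ContinuousOn (fun z : ℝ × ℝ => ya R g g' z.1 z.2) (Dy R) ∧
    ContinuousOn (fun z : ℝ × ℝ => ytt R g z.1 z.2) (Dy R) ∧
    ContinuousOn (fun z : ℝ × ℝ => yta R g z.1 z.2) (Dy R) := by
  have hp : ∀ z ∈ Dy R, z.2 ≠ 0 ∧ z.2 + z.1 ≠ 0 := fun z hz =>
    ⟨(Dy_pos hR hz).1.ne', (Dy_pos hR hz).2.ne'⟩
  have h2 : ContinuousOn (fun z : ℝ × ℝ => g' z.2) (Dy R) :=
    hg'.comp (f := fun z : ℝ × ℝ => z.2) (by fun_prop) fun z hz => hz.1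
  have h3 : ContinuousOn (fun z : ℝ × ℝ => 3 / 8 * z.1 / ((z.2 + z.1) * z.2)) (Dy R) :=
    ContinuousOn.div (by fun_prop) (by fun_prop) fun z hz => mul_ne_zero (hp z hz).2 (hp z hz).1
  have h4 : ContinuousOn (fun z : ℝ × ℝ => 3 / 8 / (z.2 + z.1) ^ 2) (Dy R) :=
    ContinuousOn.div (by fun_prop) (by fun_prop) fun z hz => pow_ne_zero 2 (hp z hz).2
  have h5 : ContinuousOn (fun z : ℝ × ℝ => g z.2) (Dy R) := by fun_prop
  exact ⟨h5.add (kernel_integral_continuousOn hR hg (by simp)),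
    kernel_integral_continuousOn hR hg (by simp),
    (h2.add (h5.mul h3)).add (kernel_integral_continuousOn hR hg (by simp)),
    kernel_integral_continuousOn hR hg (by simp),
    (h5.mul h4).add (kernel_integral_continuousOn hR hg (by simp))⟩

set_option maxHeartbeats 2000000 in
lemma kernel_bounds {t a s : ℝ} (ht : 0 ≤ t) (hs : 0 < s) (hsa : s ≤ a) :
    |kM t a s| / (a + t) ≤ (a * √a * √s)⁻¹ ∧ |kMt t a s| ≤ 3 * (a * √a * √s)⁻¹ ∧
      |kMa t a s| ≤ 3 * (a * √a * √s)⁻¹ := by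
  have ha : 0 < a := hs.trans_le hsa
  have hr : 0 < a + t := by linarith
  have hD : Dm t a s := ⟨hs, ha, hr, by linarith⟩
  have hY0 : 0 ≤ kY t a s := by
    have h1 : 0 ≤ a - s := by linarith
    rw [kY]; positivity
  have hY1 : a / (4 * s) ≤ 1 + kY t a s := by
    rw [kY_add_one hD, div_le_div_iff₀ (by positivity) (by positivity)]
    have h1 : a * (a + t) ≤ (a + s) * (a + s + 2 * t) := by
      nlinarith [mul_pos ha hs, mul_nonneg ha.le ht, mul_nonneg hs.le ht, sq_nonneg s]
    nlinarith
  obtain ⟨α, hα⟩ : ∃ α, α = √a := ⟨_, rfl⟩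
  obtain ⟨ς, hς⟩ : ∃ ς, ς = √s := ⟨_, rfl⟩
  have hα0 : 0 < α := hα ▸ Real.sqrt_pos.2 ha
  have hς0 : 0 < ς := hς ▸ Real.sqrt_pos.2 hs
  have hαa : a = α ^ 2 := by rw [hα, Real.sq_sqrt ha.le]
  have hςs : s = ς ^ 2 := by rw [hς, Real.sq_sqrt hs.le]
  have hsq : a / (4 * s) = (α / (2 * ς)) ^ 2 := by rw [hαa, hςs]; ring
  have hq : 0 < α / (2 * ς) := by positivity
  have e1 : (a / (4 * s)) ^ (-(1 / 2) : ℝ) = 2 * ς / α := by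
    rw [hsq, ← Real.rpow_natCast, ← Real.rpow_mul hq.le,
      show (((2 : ℕ) : ℝ) * -(1 / 2)) = -1 by norm_num, Real.rpow_neg_one, inv_div]
  have e3 : (a / (4 * s)) ^ (-(3 / 2) : ℝ) = (2 * ς / α) ^ 3 := by
    rw [hsq, ← Real.rpow_natCast, ← Real.rpow_mul hq.le,
      show (((2 : ℕ) : ℝ) * -(3 / 2)) = -((3 : ℕ) : ℝ) by norm_num, Real.rpow_neg hq.le,
      Real.rpow_natCast, ← inv_pow, inv_div]
  have hq' : 0 < a / (4 * s) := by positivity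
  have hP : |Phi (kY t a s)| ≤ ς / α := by
    refine (abs_Phi_le hY0).trans ?_
    have := Real.rpow_le_rpow_of_nonpos hq' hY1 (by norm_num : (-(1 / 2) : ℝ) ≤ 0)
    rw [e1] at this
    calc _ ≤ 1 / 2 * (2 * ς / α) := by gcongr
      _ = _ := by ring
  have hP1 : |Phi1 (kY t a s)| ≤ 4 * (ς / α) ^ 3 := by
    refine (abs_Phi1_le hY0).trans ?_
    have := Real.rpow_le_rpow_of_nonpos hq' hY1 (by norm_num : (-(3 / 2) : ℝ) ≤ 0)
    rw [e3] at this
    calc _ ≤ 1 / 2 * (2 * ς / α) ^ 3 := by gcongr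
      _ = _ := by ring
  have hts : |t / ((a + t) * s)| ≤ 1 / s := by
    rw [abs_of_nonneg (by positivity), div_le_div_iff₀ (by positivity) hs]
    nlinarith [mul_pos ha hs]
  have hYt : |kYt t a s| ≤ 1 / (4 * s) := by
    have h1 : 0 ≤ a ^ 2 - s ^ 2 := by nlinarith
    rw [kYt, abs_of_nonneg (by positivity), div_le_div_iff₀ (by positivity) (by positivity)]
    have h2 : a ^ 2 - s ^ 2 ≤ (a + t) ^ 2 := by nlinarith [mul_nonneg ha.le ht]
    nlinarith
  have hYa : |kYa t a s| ≤ 1 / (2 * s) := by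
    have h1 : s ^ 2 ≤ (a + t) ^ 2 := by nlinarith [mul_nonneg ha.le ht]
    have h1' : 0 ≤ (a + t) ^ 2 - s ^ 2 + t ^ 2 := by nlinarith [sq_nonneg t]
    rw [kYa, abs_of_nonneg (by positivity), div_le_div_iff₀ (by positivity) (by positivity)]
    have h2 : (a + t) ^ 2 - s ^ 2 + t ^ 2 ≤ 2 * (a + t) ^ 2 := by
      nlinarith [mul_nonneg ha.le ht, sq_nonneg a, sq_nonneg s]
    nlinarith
  have hβ : (a * √a * √s)⁻¹ = 1 / (a * s) * (ς / α) := by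
    rw [← hα, ← hς, hαa, hςs]; field_simp
  have hβ3 : 1 / s * (1 / s * (ς / α) ^ 3) = 1 / (a * s) * (ς / α) := by
    rw [hαa, hςs]; field_simp
  have hqq : 0 < ς / α := by positivity
  rw [hβ]
  have hfirst : ∀ x : ℝ, |x| ≤ a + t → |x / ((a + t) ^ 2 * s) * Phi (kY t a s)| ≤
      1 / (a * s) * (ς / α) := fun x hx => by
    rw [abs_mul]
    refine mul_le_mul ?_ hP (abs_nonneg _) (by positivity)
    rw [abs_div, abs_of_pos (by positivity : 0 < (a + t) ^ 2 * s),
      div_le_div_iff₀ (by positivity) (by positivity)]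
    have h1 : |x| * a ≤ (a + t) * (a + t) := mul_le_mul hx (by linarith) ha.le hr.le
    nlinarith
  refine ⟨?_, ?_, ?_⟩
  · rw [div_le_iff₀ hr, kM, abs_mul]
    calc _ ≤ 1 / s * (ς / α) := mul_le_mul hts hP (abs_nonneg _) (by positivity)
      _ = 1 / (a * s) * (ς / α) * a := by field_simp
      _ ≤ _ := by gcongr; linarith
  · rw [kMt]
    refine (abs_add_le _ _).trans ?_
    have h1 := hfirst a (by rw [abs_of_pos ha]; linarith)
    have h2 : |t / ((a + t) * s) * (kYt t a s * Phi1 (kY t a s))| ≤ 1 / (a * s) * (ς / α) := by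
      rw [abs_mul, abs_mul, ← hβ3]
      refine mul_le_mul hts ?_ (by positivity) (by positivity)
      calc _ ≤ 1 / (4 * s) * (4 * (ς / α) ^ 3) := by gcongr
        _ = _ := by field_simp
    have : 0 ≤ 1 / (a * s) * (ς / α) := by positivity
    linarith
  · rw [kMa]
    refine (abs_add_le _ _).trans ?_
    have h1 := hfirst (-t) (by rw [abs_neg, abs_of_nonneg ht]; linarith)
    have h2 : |t / ((a + t) * s) * (kYa t a s * Phi1 (kY t a s))| ≤
        2 * (1 / (a * s) * (ς / α)) := by
      rw [abs_mul, abs_mul, ← hβ3]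
      calc _ ≤ 1 / s * (1 / (2 * s) * (4 * (ς / α) ^ 3)) := by gcongr
        _ = _ := by field_simp; ring
    linarith

end

/-- Admissible test profiles: continuous, supported in `[p, q]`, of mean zero. -/
structure IsProfile (p q : ℝ) (γ : ℝ → ℝ) : Prop where
  cont : Continuous γ
  pos : 0 < p
  le : p ≤ q
  left : ∀ s, s ≤ p → γ s = 0
  right : ∀ s, q ≤ s → γ s = 0
  mean : ∫ s in p..q, γ s = 0

def prG (p : ℝ) (γ : ℝ → ℝ) (a : ℝ) : ℝ := ∫ s in p..a, γ s
def prg (p : ℝ) (γ : ℝ → ℝ) (a : ℝ) : ℝ := a * √a * prG p γ a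
def prg' (p : ℝ) (γ : ℝ → ℝ) (a : ℝ) : ℝ := a * √a * γ a + 3 / 2 * √a * prG p γ a

/-- The majorant of the derivatives of the outgoing solution with profile `γ`. -/
def prk (R p : ℝ) (γ : ℝ → ℝ) (a : ℝ) : ℝ :=
  |prg' p γ a| + |prg p γ a| / a + 3 * ((a * √a)⁻¹ * ∫ s in R..a, |prg p γ s| / √s)

namespace IsProfile
variable {p q : ℝ} {γ : ℝ → ℝ} (h : IsProfile p q γ)
include h

lemma G_deriv (a : ℝ) : HasDerivAt (prG p γ) (γ a) a :=
  intervalIntegral.integral_hasDerivAt_right (h.cont.intervalIntegrable _ _)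
    (h.cont.stronglyMeasurableAtFilter _ _) h.cont.continuousAt

lemma G_cont : Continuous (prG p γ) :=
  continuous_iff_continuousAt.2 fun a => (h.G_deriv a).continuousAt

lemma G_left {a : ℝ} (ha : a ≤ p) : prG p γ a = 0 := by
  rw [prG, ← intervalIntegral.integral_zero (a := p) (b := a) (μ := volume) (E := ℝ)]
  refine intervalIntegral.integral_congr fun s hs => h.left s ?_
  rw [uIcc_of_ge ha] at hs
  exact hs.2

lemma G_right {a : ℝ} (ha : q ≤ a) : prG p γ a = 0 := by
  rw [prG, ← intervalIntegral.integral_add_adjacent_intervals (b := q)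
    (h.cont.intervalIntegrable _ _) (h.cont.intervalIntegrable _ _), h.mean, zero_add,
    ← intervalIntegral.integral_zero (a := q) (b := a) (μ := volume) (E := ℝ)]
  refine intervalIntegral.integral_congr fun s hs => h.right s ?_
  rw [uIcc_of_le ha] at hs
  exact hs.1

lemma g_cont : Continuous (prg p γ) := by
  have := h.G_cont
  unfold prg; fun_prop

lemma g_left {a : ℝ} (ha : a ≤ p) : prg p γ a = 0 := by rw [prg, h.G_left ha, mul_zero]

lemma g'_cont : Continuous (prg' p γ) := by
  have := h.G_cont
  have := h.cont
  unfold prg'; fun_prop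

lemma g_deriv {a : ℝ} (ha : 0 < a) : HasDerivAt (prg p γ) (prg' p γ a) a := by
  have h1 := ((hasDerivAt_id a).mul (Real.hasDerivAt_sqrt ha.ne')).mul (h.G_deriv a)
  refine h1.congr_deriv ?_
  have hs : 0 < √a := Real.sqrt_pos.2 ha
  have e : a = √a * √a := (Real.mul_self_sqrt ha.le).symm
  simp only [prg', id, Pi.mul_apply]
  have : a * (1 / (2 * √a)) = √a / 2 := by
    rw [mul_one_div, div_eq_div_iff (by positivity) (by norm_num)]; linarith
  rw [this]; ring

omit h in
lemma sub_eq {a : ℝ} (ha : 0 < a) :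
    prg' p γ a - 3 * prg p γ a / (2 * a) = a * √a * γ a := by
  rw [prg', prg]; field_simp; ring

lemma G_sq_le {n : ℝ} (hn : q ≤ n) :
    (∫ s in p..n, s * prG p γ s ^ 2) ≤ ∫ s in p..n, s ^ 3 * γ s ^ 2 := by
  have hc := h.cont
  have hG := h.G_cont
  have hd : ∀ s, HasDerivAt (fun s => s ^ 2 * prG p γ s ^ 2)
      (2 * s * prG p γ s ^ 2 + 2 * s ^ 2 * prG p γ s * γ s) s := fun s => by
    refine (((hasDerivAt_id s).pow 2).mul ((h.G_deriv s).pow 2)).congr_deriv ?_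
    simp only [id, Pi.pow_apply]; push_cast; ring
  have e := intervalIntegral.integral_eq_sub_of_hasDerivAt (a := p) (b := n)
    (fun s _ => hd s) (Continuous.intervalIntegrable (by fun_prop) _ _)
  rw [h.G_right hn, h.G_left le_rfl] at e
  have hle : (∫ s in p..n, (s * prG p γ s ^ 2 - s ^ 3 * γ s ^ 2)) ≤
      ∫ s in p..n, (2 * s * prG p γ s ^ 2 + 2 * s ^ 2 * prG p γ s * γ s) := by
    refine intervalIntegral.integral_mono_on (h.le.trans hn)
      (Continuous.intervalIntegrable (by fun_prop) _ _)
      (Continuous.intervalIntegrable (by fun_prop) _ _) fun s hs => ?_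
    have hs0 : 0 < s := h.pos.trans_le hs.1
    nlinarith [mul_nonneg hs0.le (sq_nonneg (prG p γ s + s * γ s))]
  rw [intervalIntegral.integral_sub (Continuous.intervalIntegrable (by fun_prop) _ _)
    (Continuous.intervalIntegrable (by fun_prop) _ _)] at hle
  linarith

lemma weighted_integral_left {R : ℝ} (hRp : R ≤ p) {a : ℝ} :
    (∫ s in R..a, |prg p γ s| / √s) = ∫ s in p..a, s * |prG p γ s| := by
  have hG := h.G_cont
  have hcong : ∀ s, 0 ≤ s → |prg p γ s| / √s = s * |prG p γ s| := fun s hs => by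
    rcases hs.eq_or_lt with rfl | hs
    · simp [prg]
    · have : 0 < √s := Real.sqrt_pos.2 hs
      rw [prg, abs_mul, abs_of_pos (by positivity : 0 < s * √s)]
      field_simp
  have hcong' : ∀ s, s ≤ p → |prg p γ s| / √s = s * |prG p γ s| := fun s hs => by
    rw [h.g_left hs, h.G_left hs]; simp
  have e1 : (∫ s in R..a, |prg p γ s| / √s) = ∫ s in R..a, s * |prG p γ s| :=
    intervalIntegral.integral_congr fun s _ => by
      rcases le_total s p with h1 | h1
      · exact hcong' s h1
      · exact hcong s (h.pos.le.trans h1)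
  rw [e1, ← intervalIntegral.integral_add_adjacent_intervals (b := p)
    (Continuous.intervalIntegrable (by fun_prop) _ _)
    (Continuous.intervalIntegrable (by fun_prop) _ _)]
  have : (∫ s in R..p, s * |prG p γ s|) = 0 := by
    rw [← intervalIntegral.integral_zero (a := R) (b := p) (μ := volume) (E := ℝ)]
    refine intervalIntegral.integral_congr fun s hs => ?_
    rw [uIcc_of_le hRp] at hs
    simp only [h.G_left hs.2, abs_zero, mul_zero]
  rw [this, zero_add]

lemma hardy {n : ℝ} (hn : p ≤ n) :
    (∫ a in p..n, (∫ s in p..a, s * |prG p γ s|) ^ 2 / a ^ 3) ≤ ∫ s in p..n, s * prG p γ s ^ 2 := by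
  have hG := h.G_cont
  have hcc : Continuous fun s => s * |prG p γ s| := by fun_prop
  obtain ⟨η, hη⟩ : ∃ η : ℝ → ℝ, η = fun a => ∫ s in p..a, s * |prG p γ s| := ⟨_, rfl⟩
  have hd : ∀ a, HasDerivAt η (a * |prG p γ a|) a := fun a => by
    rw [hη]
    exact intervalIntegral.integral_hasDerivAt_right (hcc.intervalIntegrable _ _)
      (hcc.stronglyMeasurableAtFilter _ _) hcc.continuousAt
  have hηc : Continuous η := continuous_iff_continuousAt.2 fun a => (hd a).continuousAt
  have hη0 : η p = 0 := by simp [hη]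
  have hpos : ∀ a ∈ uIcc p n, 0 < a := fun a ha => by
    rw [uIcc_of_le hn] at ha; exact h.pos.trans_le ha.1
  have hd2 : ∀ a ∈ uIcc p n, HasDerivAt (fun a => -(η a ^ 2) / (2 * a ^ 2))
      (η a ^ 2 / a ^ 3 - η a * |prG p γ a| / a) a := fun a ha => by
    have ha0 := hpos a ha
    refine ((((hd a).pow 2).neg).div (((hasDerivAt_id a).pow 2).const_mul 2)
      (by simp only [id, Pi.pow_apply]; positivity)).congr_deriv ?_
    simp only [id, Pi.pow_apply, Pi.neg_apply]
    field_simp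
    ring
  have c1 : ContinuousOn (fun a => η a ^ 2 / a ^ 3) (uIcc p n) :=
    ContinuousOn.div (by fun_prop) (by fun_prop) fun a ha => (pow_pos (hpos a ha) 3).ne'
  have c2 : ContinuousOn (fun a => η a * |prG p γ a| / a) (uIcc p n) :=
    ContinuousOn.div (by fun_prop) (by fun_prop) fun a ha => (hpos a ha).ne'
  have e := intervalIntegral.integral_eq_sub_of_hasDerivAt hd2 (c1.sub c2).intervalIntegrable
  have hle : (∫ a in p..n, (1 / 2 * (η a ^ 2 / a ^ 3) - 1 / 2 * (a * prG p γ a ^ 2))) ≤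
      ∫ a in p..n, (η a ^ 2 / a ^ 3 - η a * |prG p γ a| / a) := by
    refine intervalIntegral.integral_mono_on hn ?_ (c1.sub c2).intervalIntegrable fun a ha => ?_
    · exact ((continuousOn_const.mul c1).sub (by fun_prop)).intervalIntegrable
    · have ha0 : 0 < a := h.pos.trans_le ha.1
      have e1 : η a ^ 2 / a ^ 3 - η a * |prG p γ a| / a -
          (1 / 2 * (η a ^ 2 / a ^ 3) - 1 / 2 * (a * |prG p γ a| ^ 2)) =
          1 / 2 * ((η a - a ^ 2 * |prG p γ a|) ^ 2 / a ^ 3) := by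
        field_simp; ring
      rw [sq_abs] at e1
      have : 0 ≤ (η a - a ^ 2 * |prG p γ a|) ^ 2 / a ^ 3 := by positivity
      linarith
  rw [intervalIntegral.integral_sub (c1.intervalIntegrable.const_mul _)
    (Continuous.intervalIntegrable (by fun_prop) _ _), intervalIntegral.integral_const_mul,
    intervalIntegral.integral_const_mul] at hle
  have hb : -(η n ^ 2) / (2 * n ^ 2) ≤ 0 :=
    div_nonpos_of_nonpos_of_nonneg (by nlinarith [sq_nonneg (η n)]) (by positivity)
  have hb0 : -(η p ^ 2) / (2 * p ^ 2) = 0 := by rw [hη0]; simp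
  simp only [hη] at *
  linarith

lemma k_continuousOn {R : ℝ} (hRp : R ≤ p) : ContinuousOn (prk R p γ) (Ioi 0) := by
  have hG := h.G_cont
  have hg := h.g_cont
  have hg' := h.g'_cont
  have hcc : Continuous fun s => s * |prG p γ s| := by fun_prop
  have hi : Continuous fun a => ∫ s in p..a, s * |prG p γ s| :=
    intervalIntegral.continuous_primitive (fun _ _ => hcc.intervalIntegrable _ _) _
  have e : prk R p γ = fun a => |prg' p γ a| + |prg p γ a| / a +
      3 * ((a * √a)⁻¹ * ∫ s in p..a, s * |prG p γ s|) := by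
    funext a; rw [prk, h.weighted_integral_left hRp]
  rw [e]
  refine ContinuousOn.add (ContinuousOn.add (by fun_prop)
    (ContinuousOn.div (by fun_prop) (by fun_prop) fun a ha => (mem_Ioi.1 ha).ne')) ?_
  refine continuousOn_const.mul (ContinuousOn.mul (ContinuousOn.inv₀ (by fun_prop) fun a ha => ?_)
    (by fun_prop))
  have : 0 < a := ha
  positivity

lemma k_sq_le {R n : ℝ} (hRp : R ≤ p) (hn : q ≤ n) :
    (∫ a in p..n, prk R p γ a ^ 2) ≤ 50 * ∫ s in p..n, s ^ 3 * γ s ^ 2 := by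
  have hG := h.G_cont
  have hc := h.cont
  have hpn : p ≤ n := h.le.trans hn
  have hcc : Continuous fun s => s * |prG p γ s| := by fun_prop
  have hi : Continuous fun a => ∫ s in p..a, s * |prG p γ s| :=
    intervalIntegral.continuous_primitive (fun _ _ => hcc.intervalIntegrable _ _) _
  have hpos : ∀ a ∈ uIcc p n, 0 < a := fun a ha => by
    rw [uIcc_of_le hpn] at ha; exact h.pos.trans_le ha.1
  have hk : ContinuousOn (fun a => prk R p γ a ^ 2) (uIcc p n) :=
    ((h.k_continuousOn hRp).mono fun a ha => hpos a ha).pow 2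
  have c1 : ContinuousOn (fun a => (∫ s in p..a, s * |prG p γ s|) ^ 2 / a ^ 3) (uIcc p n) :=
    ContinuousOn.div (by fun_prop) (by fun_prop) fun a ha => (pow_pos (hpos a ha) 3).ne'
  have hle : (∫ a in p..n, prk R p γ a ^ 2) ≤ ∫ a in p..n, (33 / 2 * (a * prG p γ a ^ 2) +
      6 * (a ^ 3 * γ a ^ 2) + 27 * ((∫ s in p..a, s * |prG p γ s|) ^ 2 / a ^ 3)) := by
    refine intervalIntegral.integral_mono_on hpn hk.intervalIntegrable
      (ContinuousOn.add (by fun_prop) (continuousOn_const.mul c1)).intervalIntegrable fun a ha => ?_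
    have ha0 : 0 < a := h.pos.trans_le ha.1
    rw [prk, h.weighted_integral_left hRp]
    obtain ⟨X, hX⟩ : ∃ X, X = ∫ s in p..a, s * |prG p γ s| := ⟨_, rfl⟩
    rw [← hX]
    obtain ⟨σ, hσ⟩ : ∃ σ, σ = √a := ⟨_, rfl⟩
    have hσ0 : 0 < σ := hσ ▸ Real.sqrt_pos.2 ha0
    have hσa : a = σ ^ 2 := by rw [hσ, Real.sq_sqrt ha0.le]
    have e1 : (|prg p γ a| / a) ^ 2 = a * prG p γ a ^ 2 := by
      rw [div_pow, sq_abs, prg, ← hσ, hσa]; field_simp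
    have e2 : ((a * √a)⁻¹ * X) ^ 2 = X ^ 2 / a ^ 3 := by
      rw [← hσ, hσa]; field_simp
    have e3 : |prg' p γ a| ^ 2 ≤ 2 * (a ^ 3 * γ a ^ 2) + 9 / 2 * (a * prG p γ a ^ 2) := by
      have : 2 * (a ^ 3 * γ a ^ 2) + 9 / 2 * (a * prG p γ a ^ 2) - |prg' p γ a| ^ 2 =
        (a * √a * γ a - 3 / 2 * √a * prG p γ a) ^ 2 := by
        rw [sq_abs, prg', ← hσ, hσa]; ring
      nlinarith [sq_nonneg (a * √a * γ a - 3 / 2 * √a * prG p γ a)]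
    rw [← e2]
    nlinarith [sq_nonneg (|prg' p γ a| - |prg p γ a| / a),
      sq_nonneg (|prg' p γ a| - 3 * ((a * √a)⁻¹ * X)),
      sq_nonneg (|prg p γ a| / a - 3 * ((a * √a)⁻¹ * X))]
  have i1 : IntervalIntegrable (fun a => 33 / 2 * (a * prG p γ a ^ 2)) volume p n :=
    Continuous.intervalIntegrable (by fun_prop) _ _
  have i2 : IntervalIntegrable (fun a => 6 * (a ^ 3 * γ a ^ 2)) volume p n :=
    Continuous.intervalIntegrable (by fun_prop) _ _
  have i12 : IntervalIntegrable (fun a => 33 / 2 * (a * prG p γ a ^ 2) + 6 * (a ^ 3 * γ a ^ 2))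
    volume p n := i1.add i2
  rw [intervalIntegral.integral_add i12 (c1.intervalIntegrable.const_mul _),
    intervalIntegral.integral_add i1 i2, intervalIntegral.integral_const_mul,
    intervalIntegral.integral_const_mul, intervalIntegral.integral_const_mul] at hle
  have := h.hardy hpn
  have := h.G_sq_le hn
  have : 0 ≤ ∫ s in p..n, s ^ 3 * γ s ^ 2 :=
    intervalIntegral.integral_nonneg hpn fun s hs => by
      have : 0 < s := h.pos.trans_le hs.1
      positivity
  linarith

end IsProfile

lemma kernel_integral_le {p q : ℝ} {γ : ℝ → ℝ} (h : IsProfile p q γ) {R : ℝ} (hR : 0 < R)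
    {F : ℝ → ℝ} {a c : ℝ} (ha : R < a)
    (hF : ∀ s ∈ Icc R a, |F s| ≤ c * (a * √a * √s)⁻¹) :
    |∫ s in R..a, prg p γ s * F s| ≤ c * ((a * √a)⁻¹ * ∫ s in R..a, |prg p γ s| / √s) := by
  have ha0 : 0 < a := hR.trans ha
  have hg := h.g_cont
  have hcont : ContinuousOn (fun s => |prg p γ s| / √s) (uIcc R a) := by
    rw [uIcc_of_le ha.le]
    refine ContinuousOn.div (by fun_prop) (by fun_prop) fun s hs => ?_
    exact (Real.sqrt_pos.2 (hR.trans_le hs.1)).ne'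
  rw [← Real.norm_eq_abs, ← mul_assoc, ← intervalIntegral.integral_const_mul]
  refine intervalIntegral.norm_integral_le_of_norm_le ha.le ?_
    (hcont.intervalIntegrable.const_mul _)
  refine Eventually.of_forall fun s hs => ?_
  have hs' : s ∈ Icc R a := ⟨hs.1.le, hs.2⟩
  rw [Real.norm_eq_abs, abs_mul]
  have h1 : 0 < √s := Real.sqrt_pos.2 (hR.trans_le hs'.1)
  have h2 : 0 < √a := Real.sqrt_pos.2 ha0
  calc _ ≤ |prg p γ s| * (c * (a * √a * √s)⁻¹) := by gcongr; exact hF s hs'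
    _ = _ := by field_simp

lemma y_bounds {p q : ℝ} {γ : ℝ → ℝ} (h : IsProfile p q γ) {R : ℝ} (hR : 0 < R)
    {t a : ℝ} (ht : 0 ≤ t) (ha : R < a) :
    |yt R (prg p γ) t a| ≤ prk R p γ a ∧ |ya R (prg p γ) (prg' p γ) t a| ≤ prk R p γ a ∧
      |yv R (prg p γ) t a| / (a + t) ≤ prk R p γ a := by
  have ha0 : 0 < a := hR.trans ha
  have hat : 0 < a + t := by linarith
  have hk := fun s (hs : s ∈ Icc R a) => kernel_bounds ht (hR.trans_le hs.1) hs.2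
  have e1 := kernel_integral_le h hR ha (F := kMt t a)
    fun s hs => (hk s hs).2.1
  have e2 := kernel_integral_le h hR ha (F := kMa t a)
    fun s hs => (hk s hs).2.2
  have e3 := kernel_integral_le h hR ha (F := fun s => kM t a s / (a + t))
    fun s hs => by
      rw [abs_div, abs_of_pos hat, one_mul]; exact (hk s hs).1
  have hX : 0 ≤ (a * √a)⁻¹ * ∫ s in R..a, |prg p γ s| / √s :=
    mul_nonneg (by positivity) (intervalIntegral.integral_nonneg ha.le fun s _ => by positivity)
  have hg1 : 0 ≤ |prg p γ a| / a := by positivity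
  have hg2 : 0 ≤ |prg' p γ a| := abs_nonneg _
  rw [prk, yt, ya, yv]
  refine ⟨by linarith, ?_, ?_⟩
  · have e4 : |prg p γ a * (3 / 8 * t / ((a + t) * a))| ≤ |prg p γ a| / a := by
      rw [abs_mul, abs_of_nonneg (by positivity : 0 ≤ 3 / 8 * t / ((a + t) * a)),
        div_eq_mul_inv |prg p γ a|]
      refine mul_le_mul_of_nonneg_left ?_ (abs_nonneg _)
      rw [← one_div, div_le_div_iff₀ (by positivity) ha0]
      nlinarith [mul_nonneg ht ha0.le]
    refine (abs_add_le _ _).trans ((add_le_add_left (abs_add_le _ _) _).trans ?_)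
    linarith
  · have e4 : |prg p γ a| / (a + t) ≤ |prg p γ a| / a := by gcongr; linarith
    have e5 : |prg p γ a + ∫ s in R..a, prg p γ s * kM t a s| / (a + t) ≤
        |prg p γ a| / (a + t) + |∫ s in R..a, prg p γ s * (kM t a s / (a + t))| := by
      have : (∫ s in R..a, prg p γ s * (kM t a s / (a + t))) =
          (∫ s in R..a, prg p γ s * kM t a s) / (a + t) := by
        rw [← intervalIntegral.integral_div]
        simp only [mul_div_assoc]
      rw [this, abs_div, abs_of_pos hat, ← add_div]
      gcongr
      exact abs_add_le _ _
    linarith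

lemma y_left {p q : ℝ} {γ : ℝ → ℝ} (h : IsProfile p q γ) {R : ℝ} {t a : ℝ} (hR : R ≤ a)
    (ha : a ≤ p) : yv R (prg p γ) t a = 0 ∧ yt R (prg p γ) t a = 0 := by
  have : ∀ F : ℝ → ℝ, (∫ s in R..a, prg p γ s * F s) = 0 := fun F => by
    rw [← intervalIntegral.integral_zero (a := R) (b := a) (μ := volume) (E := ℝ)]
    refine intervalIntegral.integral_congr fun s hs => ?_
    rw [uIcc_of_le hR] at hs
    simp only [h.g_left (hs.2.trans ha), zero_mul]
  rw [yv, yt, this, this, h.g_left ha]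
  simp

lemma prk_nonneg {p : ℝ} {γ : ℝ → ℝ} {R a : ℝ} (hR : 0 < R) (ha : R < a) : 0 ≤ prk R p γ a := by
  have ha0 : 0 < a := hR.trans ha
  have hX : 0 ≤ (a * √a)⁻¹ * ∫ s in R..a, |prg p γ s| / √s :=
    mul_nonneg (by positivity) (intervalIntegral.integral_nonneg ha.le fun s _ => by positivity)
  rw [prk]; positivity

lemma y_zero_time {R : ℝ} {g g' : ℝ → ℝ} (a : ℝ) :
    yv R g 0 a = g a ∧ ya R g g' 0 a = g' a := by
  simp [yv, ya, kM, kMa]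

/-- `f` is differentiable at `(t, r)` with partial derivatives `A` and `B`. -/
def HD (f : ℝ → ℝ → ℝ) (A B t r : ℝ) : Prop :=
  HasFDerivAt (fun z : ℝ × ℝ => f z.1 z.2)
    (A • ContinuousLinearMap.fst ℝ ℝ ℝ + B • ContinuousLinearMap.snd ℝ ℝ ℝ) (t, r)

namespace HD
variable {f h : ℝ → ℝ → ℝ} {A B A' B' t r : ℝ}

lemma curve (H : HD f A B t r) {p q : ℝ → ℝ} {x p' q' : ℝ} (hp : HasDerivAt p p' x)
    (hq : HasDerivAt q q' x) (ep : p x = t) (eq : q x = r) :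
    HasDerivAt (fun x => f (p x) (q x)) (A * p' + B * q') x := by
  subst ep eq
  have := HasFDerivAt.comp_hasDerivAt x (f := fun x => (p x, q x)) H (hp.prodMk hq)
  refine this.congr_deriv ?_
  simp

lemma dt (H : HD f A B t r) : HasDerivAt (fun s => f s r) A t :=
  (H.curve (hasDerivAt_id t) (hasDerivAt_const t r) rfl rfl).congr_deriv (by ring)

lemma dr (H : HD f A B t r) : HasDerivAt (fun s => f t s) B r :=
  (H.curve (hasDerivAt_const r t) (hasDerivAt_id r) rfl rfl).congr_deriv (by ring)

lemma char_t {a : ℝ} (H : HD f A B t (a + t)) :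
    HasDerivAt (fun s => f s (a + s)) (A + B) t :=
  (H.curve (hasDerivAt_id t) ((hasDerivAt_id t).const_add a) rfl rfl).congr_deriv (by ring)

lemma char_a {a : ℝ} (H : HD f A B t (a + t)) :
    HasDerivAt (fun x => f t (x + t)) B a :=
  (H.curve (hasDerivAt_const a t) ((hasDerivAt_id a).add_const t) rfl rfl).congr_deriv (by ring)

lemma add (H : HD f A B t r) (H' : HD h A' B' t r) :
    HD (fun t r => f t r + h t r) (A + A') (B + B') t r := by
  refine (HasFDerivAt.add H H').congr_fderiv ?_
  ext <;> simp

lemma const_mul (c : ℝ) (H : HD f A B t r) :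
    HD (fun t r => c * f t r) (c * A) (c * B) t r := by
  refine (HasFDerivAt.const_mul H c).congr_fderiv ?_
  ext <;> simp

lemma of_r {φ : ℝ → ℝ} {φ' : ℝ} (H : HasDerivAt φ φ' r) (t : ℝ) : HD (fun _ r => φ r) 0 φ' t r := by
  have h1 : HasFDerivAt (fun z : ℝ × ℝ => z.2) (ContinuousLinearMap.snd ℝ ℝ ℝ) (t, r) :=
    hasFDerivAt_snd
  have := HasDerivAt.comp_hasFDerivAt (t, r) (f := fun z : ℝ × ℝ => z.2) H h1
  refine this.congr_fderiv ?_
  ext <;> simp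

lemma time_mul {φ : ℝ → ℝ} {φ' : ℝ} (H : HasDerivAt φ φ' r) (t : ℝ) :
    HD (fun t r => t * φ r) (φ r) (t * φ') t r := by
  have h1 : HasFDerivAt (fun z : ℝ × ℝ => z.1) (ContinuousLinearMap.fst ℝ ℝ ℝ) (t, r) :=
    hasFDerivAt_fst
  have h2 := HD.of_r H t
  refine (h1.mul h2).congr_fderiv ?_
  ext <;> simp

end HD

/-- The exterior of a light cone. -/
def Cone (R : ℝ) : Set (ℝ × ℝ) := {z | R + |z.1| < z.2}

/-- A `C²` function of `(t, r)` on the exterior cone, with its derivatives. -/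
structure Wv (R : ℝ) where
  (u ut ur utt utr urr : ℝ → ℝ → ℝ)
  hu : ∀ t r, R + |t| < r → HD u (ut t r) (ur t r) t r
  hut : ∀ t r, R + |t| < r → HD ut (utt t r) (utr t r) t r
  hur : ∀ t r, R + |t| < r → HD ur (utr t r) (urr t r) t r
  ctt : ContinuousOn (fun z : ℝ × ℝ => utt z.1 z.2) (Cone R)
  ctr : ContinuousOn (fun z : ℝ × ℝ => utr z.1 z.2) (Cone R)
  crr : ContinuousOn (fun z : ℝ × ℝ => urr z.1 z.2) (Cone R)

namespace Wv
variable {R : ℝ}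

/-- The radial wave operator of `ℝ^{1+6}` applied to `w`. -/
def P (w : Wv R) (t r : ℝ) : ℝ := w.utt t r - w.urr t r - 5 * w.ur t r / r

/-- Restriction to a smaller exterior cone. -/
def restrict (w : Wv R) {ρ : ℝ} (h : R ≤ ρ) : Wv ρ where
  u := w.u
  ut := w.ut
  ur := w.ur
  utt := w.utt
  utr := w.utr
  urr := w.urr
  hu t r hr := w.hu t r (by linarith)
  hut t r hr := w.hut t r (by linarith)
  hur t r hr := w.hur t r (by linarith)
  ctt := w.ctt.mono fun z (hz : ρ + |z.1| < z.2) => show R + |z.1| < z.2 by linarith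
  ctr := w.ctr.mono fun z (hz : ρ + |z.1| < z.2) => show R + |z.1| < z.2 by linarith
  crr := w.crr.mono fun z (hz : ρ + |z.1| < z.2) => show R + |z.1| < z.2 by linarith

/-- `w + c t φ(r)`. -/
def addTime (w : Wv R) (c : ℝ) (φ φ' φ'' : ℝ → ℝ) (h1 : ∀ r, R < r → HasDerivAt φ (φ' r) r)
    (h2 : ∀ r, R < r → HasDerivAt φ' (φ'' r) r) (h3 : ContinuousOn φ'' (Ioi R)) : Wv R where
  u t r := w.u t r + c * (t * φ r)
  ut t r := w.ut t r + c * φ r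
  ur t r := w.ur t r + c * (t * φ' r)
  utt t r := w.utt t r
  utr t r := w.utr t r + c * φ' r
  urr t r := w.urr t r + c * (t * φ'' r)
  hu t r hr := by
    have hr' : R < r := by linarith [abs_nonneg t]
    simpa using (w.hu t r hr).add ((HD.time_mul (h1 r hr') t).const_mul c)
  hut t r hr := by
    have hr' : R < r := by linarith [abs_nonneg t]
    simpa using (w.hut t r hr).add ((HD.of_r (h1 r hr') t).const_mul c)
  hur t r hr := by
    have hr' : R < r := by linarith [abs_nonneg t]
    simpa using (w.hur t r hr).add ((HD.time_mul (h2 r hr') t).const_mul c)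
  ctt := w.ctt
  ctr := by
    have h4 : ContinuousOn φ' (Ioi R) := fun r hr => (h2 r hr).continuousAt.continuousWithinAt
    refine w.ctr.add (continuousOn_const.mul (h4.comp continuousOn_snd fun z hz => ?_))
    have : R + |z.1| < z.2 := hz
    exact mem_Ioi.2 (by linarith [abs_nonneg z.1])
  crr := by
    refine w.crr.add (continuousOn_const.mul (continuousOn_fst.mul
      (h3.comp continuousOn_snd fun z hz => ?_)))
    have : R + |z.1| < z.2 := hz
    exact mem_Ioi.2 (by linarith [abs_nonneg z.1])

variable (w : Wv R)

lemma cu : ContinuousOn (fun z : ℝ × ℝ => w.u z.1 z.2) (Cone R) := fun z hz =>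
  (w.hu z.1 z.2 hz).continuousAt.continuousWithinAt

lemma cut : ContinuousOn (fun z : ℝ × ℝ => w.ut z.1 z.2) (Cone R) := fun z hz =>
  (w.hut z.1 z.2 hz).continuousAt.continuousWithinAt

lemma cur : ContinuousOn (fun z : ℝ × ℝ => w.ur z.1 z.2) (Cone R) := fun z hz =>
  (w.hur z.1 z.2 hz).continuousAt.continuousWithinAt

lemma Dy_cone {t a : ℝ} (h : (t, a) ∈ Dy R) : R + |t| < a + t := by
  obtain ⟨h1, h2⟩ := h
  simp only at h1 h2
  rcases abs_cases t with ⟨h, _⟩ | ⟨h, _⟩ <;> rw [h] <;> linarith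

lemma char_continuousOn {f : ℝ → ℝ → ℝ} (hf : ContinuousOn (fun z : ℝ × ℝ => f z.1 z.2) (Cone R)) :
    ContinuousOn (fun z : ℝ × ℝ => f z.1 (z.2 + z.1)) (Dy R) :=
  hf.comp (f := fun z : ℝ × ℝ => (z.1, z.2 + z.1)) (by fun_prop) fun _ hz => Dy_cone hz

lemma slice_continuousOn {f : ℝ → ℝ → ℝ} (hf : ContinuousOn (fun z : ℝ × ℝ => f z.1 z.2) (Cone R))
    (t : ℝ) : ContinuousOn (f t) (Ioi (R + |t|)) :=
  hf.comp (f := fun r : ℝ => (t, r)) (by fun_prop) fun _ hz => hz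

end Wv

/-- A continuous integrable function is frequently smaller than `η / n`. -/
lemma frequently_small {ρ : ℝ} {f : ℝ → ℝ} (hf : IntegrableOn f (Ioi ρ)) {η : ℝ}
    (hη : 0 < η) (M : ℝ) : ∃ n, M ≤ n ∧ ρ < n ∧ f n * n ≤ η := by
  by_contra! hcon
  obtain ⟨m, hm⟩ : ∃ m, m = max (max M (ρ + 1)) 1 := ⟨_, rfl⟩
  have h1 : M ≤ m := hm ▸ (le_max_left _ _).trans (le_max_left _ _)
  have h2 : ρ + 1 ≤ m := hm ▸ (le_max_right _ _).trans (le_max_left _ _)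
  have h3 : 1 ≤ m := hm ▸ le_max_right _ _
  have hi : IntegrableOn (fun r : ℝ => r⁻¹) (Ioi m) := by
    have := (hf.mono_set (Ioi_subset_Ioi (by linarith : ρ ≤ m))).const_mul (η⁻¹)
    refine Integrable.mono' this (by fun_prop) ?_
    refine (ae_restrict_iff' measurableSet_Ioi).2 (Eventually.of_forall fun r hr => ?_)
    have hr : m < r := hr
    have hr0 : 0 < r := by linarith
    have := hcon r (by linarith) (by linarith)
    rw [Real.norm_eq_abs, abs_of_pos (by positivity), ← div_eq_inv_mul, inv_eq_one_div,
      div_le_div_iff₀ hr0 hη]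
    linarith
  exact not_integrableOn_Ioi_inv hi

lemma hardy_exterior {ρ : ℝ} (hρ : 0 < ρ) {f f' : ℝ → ℝ} (hd : ∀ r, ρ < r → HasDerivAt f (f' r) r)
    (hc : ContinuousOn f' (Ioi ρ)) (hf : L2 ρ f) (hf' : L2 ρ f') :
    L2 ρ (fun r => f r / r) ∧ nrm ρ (fun r => f r / r) ≤ 1 / 2 * nrm ρ f' := by
  have hcf : ContinuousOn f (Ioi ρ) := fun r hr => (hd r hr).continuousAt.continuousWithinAt
  have hpos : ∀ r ∈ Ioi ρ, (0 : ℝ) < r := fun r hr => hρ.trans hr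
  have hcq : ContinuousOn (fun r => f r / r) (Ioi ρ) :=
    hcf.div continuousOn_id fun r hr => (hpos r hr).ne'
  have key := integrableOn_of_exhaustion (A := ρ) (C := (1 / 2 * nrm ρ f') ^ 2)
    (f := fun r => (f r / r) ^ 2 * r ^ 5) (by fun_prop)
    (fun r hr => by have := hpos r hr; positivity) fun x M hx hxM => ?_
  · refine ⟨⟨hcq.aestronglyMeasurable measurableSet_Ioi, key.1⟩, nrm_le_of_sq ?_ key.2⟩
    have := nrm_nonneg ρ f'; positivity
  refine le_of_forall_pos_le_add fun η hη => ?_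
  obtain ⟨n, hn1, hn2, hn⟩ := frequently_small hf.2 hη (max M 1)
  have hn1' : M ≤ n := (le_max_left _ _).trans hn1
  have hn1'' : 1 ≤ n := (le_max_right _ _).trans hn1
  have hxn : x ≤ n := hxM.trans hn1'
  have hsub : uIcc x n ⊆ Ioi ρ := fun r hr => by
    rw [uIcc_of_le hxn] at hr; exact lt_of_lt_of_le hx hr.1
  have c1 : ContinuousOn (fun r => f r ^ 2 * r ^ 3) (uIcc x n) := by
    have := hcf.mono hsub; fun_prop
  have c2 : ContinuousOn (fun r => f r * f' r * r ^ 4) (uIcc x n) := by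
    have := hcf.mono hsub; have := hc.mono hsub; fun_prop
  have c3 : ContinuousOn (fun r => f' r ^ 2 * r ^ 5) (uIcc x n) := by
    have := hc.mono hsub; fun_prop
  have hdd : ∀ r ∈ uIcc x n, HasDerivAt (fun r => f r ^ 2 * r ^ 4)
      (4 * (f r ^ 2 * r ^ 3) + 2 * (f r * f' r * r ^ 4)) r := fun r hr => by
    refine (((hd r (hsub hr)).pow 2).mul ((hasDerivAt_id r).pow 4)).congr_deriv ?_
    simp only [id, Pi.pow_apply]; push_cast; ring
  have i1 := c1.intervalIntegrable (μ := volume)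
  have i2 := c2.intervalIntegrable (μ := volume)
  have i3 := c3.intervalIntegrable (μ := volume)
  have e := intervalIntegral.integral_eq_sub_of_hasDerivAt hdd ((i1.const_mul 4).add (i2.const_mul 2))
  have hle : (∫ r in x..n, (2 * (f r ^ 2 * r ^ 3) - 1 / 2 * (f' r ^ 2 * r ^ 5))) ≤
      ∫ r in x..n, (4 * (f r ^ 2 * r ^ 3) + 2 * (f r * f' r * r ^ 4)) := by
    refine intervalIntegral.integral_mono_on hxn ((i1.const_mul 2).sub (i3.const_mul _))
      ((i1.const_mul 4).add (i2.const_mul 2)) fun r hr => ?_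
    have hr0 : 0 < r := by linarith [hr.1]
    have : 0 ≤ (2 * f r + f' r * r) ^ 2 * r ^ 3 := by positivity
    nlinarith
  rw [e, intervalIntegral.integral_sub (i1.const_mul 2) (i3.const_mul _),
    intervalIntegral.integral_const_mul, intervalIntegral.integral_const_mul] at hle
  have h5 := interval_le_Ioi hf'.2 (fun r hr => by have := hpos r hr; positivity) hx.le hxn
  have hs : (∫ r in x..M, (f r / r) ^ 2 * r ^ 5) ≤ ∫ r in x..n, f r ^ 2 * r ^ 3 := by
    have e2 : EqOn (fun r => (f r / r) ^ 2 * r ^ 5) (fun r => f r ^ 2 * r ^ 3) (uIcc x M) :=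
      fun r hr => by
        rw [uIcc_of_le hxM] at hr
        have hr0 : r ≠ 0 := by linarith [hr.1]
        simp only; field_simp
    rw [intervalIntegral.integral_congr e2]
    refine intervalIntegral.integral_mono_interval le_rfl hxM hn1' ?_ i1
    refine (ae_restrict_iff' measurableSet_Ioc).2 (Eventually.of_forall fun r hr => ?_)
    have hr0 : 0 < r := by linarith [hr.1]
    simp only [Pi.zero_apply]; positivity
  have hx4 : 0 ≤ f x ^ 2 * x ^ 4 := by positivity
  have hn4 : f n ^ 2 * n ^ 4 ≤ η := by
    have h0 : 0 ≤ f n ^ 2 * n ^ 4 := by positivity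
    calc f n ^ 2 * n ^ 4 ≤ f n ^ 2 * n ^ 4 * n ^ 2 := le_mul_of_one_le_right h0 (one_le_pow₀ hn1'')
      _ = f n ^ 2 * n ^ 5 * n := by ring
      _ ≤ η := hn
  have := nrm_sq hρ.le f'
  nlinarith

/-- Cauchy-Schwarz for a pairing along a forward characteristic slice. -/
lemma pairing_le {R t p n c K : ℝ} (hR : 0 < R) (ht : 0 ≤ t) (hp : R < p) (hpn : p ≤ n)
    (hc : 0 ≤ c) {f k F : ℝ → ℝ} (hf : L2 (R + t) f) (hcf : ContinuousOn f (Ioi (R + t)))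
    (hk : ContinuousOn k (Ioi 0))
    (hK : (∫ a in p..n, k a ^ 2) ≤ K ^ 2) (hK0 : 0 ≤ K)
    (hF : ∀ a ∈ Icc p n, |F a| ≤ (a + t) ^ 2 * √(a + t) * |f (a + t)| * (c * k a)) :
    |∫ a in p..n, F a| ≤ c * nrm (R + t) f * K := by
  have hsub : Icc p n ⊆ Ioi 0 := fun a ha => by
    have := ha.1; exact mem_Ioi.2 (by linarith)
  have hcf' : ContinuousOn (fun a => f (a + t)) (Icc p n) :=
    hcf.comp (by fun_prop) fun a ha => by have := ha.1; exact mem_Ioi.2 (by linarith)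
  have hk' := hk.mono hsub
  have cσ : ContinuousOn (fun a => (a + t) ^ 2 * √(a + t) * |f (a + t)|) (Icc p n) :=
    ContinuousOn.mul (by fun_prop) hcf'.abs
  have h1 : |∫ a in p..n, F a| ≤ c * ∫ a in p..n, (a + t) ^ 2 * √(a + t) * |f (a + t)| * k a := by
    rw [← Real.norm_eq_abs, ← intervalIntegral.integral_const_mul]
    refine intervalIntegral.norm_integral_le_of_norm_le hpn ?_
      (ContinuousOn.intervalIntegrable_of_Icc hpn (continuousOn_const.mul (cσ.mul hk')))
    refine Eventually.of_forall fun a ha => ?_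
    rw [Real.norm_eq_abs]
    exact (hF a ⟨ha.1.le, ha.2⟩).trans (le_of_eq (by ring))
  have h2 := (le_abs_self _).trans (cs_interval hpn cσ hk')
  have h3 : √(∫ a in p..n, ((a + t) ^ 2 * √(a + t) * |f (a + t)|) ^ 2) ≤ nrm (R + t) f := by
    refine Real.sqrt_le_sqrt ?_
    have e : EqOn (fun a => ((a + t) ^ 2 * √(a + t) * |f (a + t)|) ^ 2)
        (fun a => (fun r => f r ^ 2 * r ^ 5) (a + t)) (uIcc p n) := fun a ha => by
      rw [uIcc_of_le hpn] at ha
      have : 0 ≤ a + t := by linarith [ha.1]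
      simp only [mul_pow, sq_abs, Real.sq_sqrt this]
      ring
    rw [intervalIntegral.integral_congr e,
      intervalIntegral.integral_comp_add_right (f := fun r => f r ^ 2 * r ^ 5)]
    refine interval_le_Ioi hf.2 (fun r hr => ?_) (by linarith) (by linarith)
    have : R + t < r := hr
    have : 0 < r := by linarith
    positivity
  have h4 : √(∫ a in p..n, k a ^ 2) ≤ K := (Real.sqrt_le_sqrt hK).trans (Real.sqrt_sq hK0).le
  calc _ ≤ c * (nrm (R + t) f * K) := by
        refine h1.trans (mul_le_mul_of_nonneg_left (h2.trans ?_) hc)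
        exact mul_le_mul h3 h4 (Real.sqrt_nonneg _) (nrm_nonneg _ _)
    _ = _ := by ring

/-- The bilinear momentum density in characteristic coordinates. -/
def cI (σ ρ U Ut Ur y yt ya : ℝ) : ℝ :=
  σ * (Ut * (ya - 3 / 2 * y * ρ) + (Ur + 4 * U * ρ) * (yt - ya))

/-- The bilinear flux. -/
def cQ (σ ρ U Ut Ur y yt : ℝ) : ℝ := σ * ((Ut + Ur + 4 * U * ρ) * (yt - 3 / 2 * y * ρ))

/-- The derivative of the flux. -/
def cQa (σ ρ U Ut Ur Utr Urr y yt ya yta : ℝ) : ℝ :=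
  5 / 2 * (σ * ρ) * ((Ut + Ur + 4 * U * ρ) * (yt - 3 / 2 * y * ρ)) +
    σ * ((Utr + Urr + 4 * Ur * ρ - 4 * U * ρ ^ 2) * (yt - 3 / 2 * y * ρ) +
      (Ut + Ur + 4 * U * ρ) * (yta - 3 / 2 * ya * ρ + 3 / 2 * y * ρ ^ 2))

/-- The source term. -/
def cS (σ ρ P y ya : ℝ) : ℝ := σ * (P * (ya - 3 / 2 * y * ρ))

def sg (r : ℝ) : ℝ := r ^ 2 * √r

lemma sg_deriv {r : ℝ} (hr : 0 < r) : HasDerivAt sg (5 / 2 * (sg r * r⁻¹)) r := by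
  refine (((hasDerivAt_id r).pow 2).mul (Real.hasDerivAt_sqrt hr.ne')).congr_deriv ?_
  have hs : 0 < √r := Real.sqrt_pos.2 hr
  have e := Real.mul_self_sqrt hr.le
  simp only [sg, id, Pi.pow_apply]
  field_simp
  push_cast
  nlinarith

lemma sg_continuous : Continuous sg := by unfold sg; fun_prop

namespace Wv
variable {R : ℝ} (w : Wv R) (g g' : ℝ → ℝ)

def I (t a : ℝ) : ℝ := cI (sg (a + t)) (a + t)⁻¹ (w.u t (a + t)) (w.ut t (a + t)) (w.ur t (a + t))
  (yv R g t a) (yt R g t a) (ya R g g' t a)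
def Q (t a : ℝ) : ℝ := cQ (sg (a + t)) (a + t)⁻¹ (w.u t (a + t)) (w.ut t (a + t)) (w.ur t (a + t))
  (yv R g t a) (yt R g t a)
def Qa (t a : ℝ) : ℝ := cQa (sg (a + t)) (a + t)⁻¹ (w.u t (a + t)) (w.ut t (a + t))
  (w.ur t (a + t)) (w.utr t (a + t)) (w.urr t (a + t))
  (yv R g t a) (yt R g t a) (ya R g g' t a) (yta R g t a)
def S (t a : ℝ) : ℝ := cS (sg (a + t)) (a + t)⁻¹ (w.P t (a + t)) (yv R g t a) (ya R g g' t a)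

variable {g g'} (hR : 0 < R) (hg : Continuous g) (hd : ∀ a, R < a → HasDerivAt g (g' a) a)
  (hg' : ContinuousOn g' (Ioi R))
include hR hg

include hd in
lemma Q_deriv {t a : ℝ} (h : (t, a) ∈ Dy R) :
    HasDerivAt (fun a => w.Q g t a) (w.Qa g g' t a) a := by
  have hr := (Dy_pos hR h).2
  simp only at hr
  have hc := Dy_cone h
  have h1 : HasDerivAt (fun a => sg (a + t)) (5 / 2 * (sg (a + t) * (a + t)⁻¹)) a :=
    (sg_deriv hr).comp_add_const a t
  have h2 : HasDerivAt (fun a => (a + t)⁻¹) (-((a + t)⁻¹ ^ 2)) a :=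
    (((hasDerivAt_id a).add_const t).inv hr.ne').congr_deriv (by simp only [id]; field_simp)
  have hU := (w.hu t (a + t) hc).char_a
  have hUt := (w.hut t (a + t) hc).char_a
  have hUr := (w.hur t (a + t) hc).char_a
  have hy := yv_deriv_a (g' := g') hR hg h (hd a h.1)
  have hyt := yt_deriv_a hR hg h
  refine (h1.mul (((hUt.add hUr).add ((hU.const_mul 4).mul h2)).mul
    (hyt.sub ((hy.const_mul (3 / 2)).mul h2)))).congr_deriv ?_
  simp only [Qa, cQa, Pi.add_apply, Pi.sub_apply, Pi.mul_apply]
  ring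

lemma I_deriv {t a : ℝ} (h : (t, a) ∈ Dy R) :
    HasDerivAt (fun t => w.I g g' t a) (w.Qa g g' t a + w.S g g' t a) t := by
  have hr := (Dy_pos hR h).2
  simp only at hr
  have hc := Dy_cone h
  have h1 : HasDerivAt (fun t => sg (a + t)) (5 / 2 * (sg (a + t) * (a + t)⁻¹)) t :=
    (sg_deriv hr).comp_const_add a t
  have h2 : HasDerivAt (fun t => (a + t)⁻¹) (-((a + t)⁻¹ ^ 2)) t :=
    (((hasDerivAt_id t).const_add a).inv hr.ne').congr_deriv (by simp only [id]; field_simp)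
  have hU := (w.hu t (a + t) hc).char_t
  have hUt := (w.hut t (a + t) hc).char_t
  have hUr := (w.hur t (a + t) hc).char_t
  have hy := yv_deriv_t hR hg h
  have hyt := yt_deriv_t hR hg h
  have hya := ya_deriv_t (g' := g') hR hg h
  refine (h1.mul ((hUt.mul (hya.sub ((hy.const_mul (3 / 2)).mul h2))).add
    ((hUr.add ((hU.const_mul 4).mul h2)).mul (hyt.sub hya)))).congr_deriv ?_
  have hp := y_pde hR hg h
  have e : ytt R g t a = 2 * yta R g t a - 3 / 4 * yv R g t a * (a + t)⁻¹ ^ 2 := by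
    rw [inv_pow, ← div_eq_mul_inv]; linarith
  simp only [Qa, cQa, S, cS, P, Pi.add_apply, Pi.sub_apply, Pi.mul_apply]
  rw [e]
  ring

include hg' in
lemma density_continuousOn :
    ContinuousOn (fun z : ℝ × ℝ => w.I g g' z.1 z.2) (Dy R) ∧
    ContinuousOn (fun z : ℝ × ℝ => w.Q g z.1 z.2) (Dy R) ∧
    ContinuousOn (fun z : ℝ × ℝ => w.Qa g g' z.1 z.2) (Dy R) ∧
    ContinuousOn (fun z : ℝ × ℝ => w.S g g' z.1 z.2) (Dy R) := by
  obtain ⟨c1, c2, c3, -, c5⟩ := y_continuousOn hR hg hg'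
  have d1 := char_continuousOn w.cu
  have d2 := char_continuousOn w.cut
  have d3 := char_continuousOn w.cur
  have d4 := char_continuousOn w.ctt
  have d5 := char_continuousOn w.ctr
  have d6 := char_continuousOn w.crr
  have s1 : ContinuousOn (fun z : ℝ × ℝ => sg (z.2 + z.1)) (Dy R) :=
    (sg_continuous.comp (by fun_prop : Continuous fun z : ℝ × ℝ => z.2 + z.1)).continuousOn
  have s2 : ContinuousOn (fun z : ℝ × ℝ => (z.2 + z.1)⁻¹) (Dy R) :=
    ContinuousOn.inv₀ (by fun_prop) fun z hz => (Dy_pos hR hz).2.ne'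
  refine ⟨?_, ?_, ?_, ?_⟩
  · exact s1.mul ((d2.mul (c3.sub ((continuousOn_const.mul c1).mul s2))).add
      ((d3.add ((continuousOn_const.mul d1).mul s2)).mul (c2.sub c3)))
  · exact s1.mul (((d2.add d3).add ((continuousOn_const.mul d1).mul s2)).mul
      (c2.sub ((continuousOn_const.mul c1).mul s2)))
  · have hA := c2.sub ((continuousOn_const (c := 3 / 2).mul c1).mul s2)
    have hB := (d2.add d3).add ((continuousOn_const (c := 4).mul d1).mul s2)
    have hC := ((d5.add d6).add ((continuousOn_const (c := 4).mul d3).mul s2)).sub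
      ((continuousOn_const (c := 4).mul d1).mul (s2.pow 2))
    have hD := (c5.sub ((continuousOn_const (c := 3 / 2).mul c3).mul s2)).add
      ((continuousOn_const (c := 3 / 2).mul c1).mul (s2.pow 2))
    exact ((continuousOn_const.mul (s1.mul s2)).mul (hB.mul hA)).add
      (s1.mul ((hC.mul hA).add (hB.mul hD)))
  · have hP : ContinuousOn (fun z : ℝ × ℝ => w.P z.1 (z.2 + z.1)) (Dy R) := by
      refine ((d4.sub d6).sub ((continuousOn_const (c := 5).mul d3).mul s2)).congr fun z _ => ?_
      simp only [P, div_eq_mul_inv, Pi.sub_apply, Pi.mul_apply]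
    exact s1.mul (hP.mul (c3.sub ((continuousOn_const.mul c1).mul s2)))

end Wv

lemma sub_le_of_deriv_le {T : ℝ} (hT : 0 ≤ T) {Z Z' G G' : ℝ → ℝ}
    (hZ : ∀ t ∈ Icc 0 T, HasDerivAt Z (Z' t) t) (hG : ∀ t ∈ Icc 0 T, HasDerivAt G (G' t) t)
    (h : ∀ t ∈ Icc 0 T, Z' t ≤ G' t) : Z T - Z 0 ≤ G T - G 0 := by
  have hd : ∀ t ∈ Icc 0 T, HasDerivAt (fun t => G t - Z t) (G' t - Z' t) t := fun t ht =>
    (hG t ht).sub (hZ t ht)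
  have hm : MonotoneOn (fun t => G t - Z t) (Icc 0 T) := by
    refine monotoneOn_of_deriv_nonneg (convex_Icc 0 T)
      (fun t ht => (hd t ht).continuousAt.continuousWithinAt)
      (fun t ht => (hd t (interior_subset ht)).differentiableAt.differentiableWithinAt)
      fun t ht => ?_
    rw [(hd t (interior_subset ht)).deriv]
    linarith [h t (interior_subset ht)]
  have := hm (left_mem_Icc.2 hT) (right_mem_Icc.2 hT) hT
  simp only at this
  linarith

lemma abs_sub_le_of_deriv {T : ℝ} (hT : 0 ≤ T) {Z Z' G G' : ℝ → ℝ}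
    (hZ : ∀ t ∈ Icc 0 T, HasDerivAt Z (Z' t) t) (hG : ∀ t ∈ Icc 0 T, HasDerivAt G (G' t) t)
    (h : ∀ t ∈ Icc 0 T, |Z' t| ≤ G' t) : |Z T - Z 0| ≤ G T - G 0 := by
  have h1 := sub_le_of_deriv_le hT hZ hG fun t ht => (le_abs_self _).trans (h t ht)
  have h2 := sub_le_of_deriv_le hT (fun t ht => (hZ t ht).neg) hG
    fun t ht => (neg_le_abs _).trans (h t ht)
  simp only [Pi.neg_apply] at h2
  exact abs_le.2 ⟨by linarith, h1⟩

namespace Wv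
variable {R : ℝ} (w : Wv R)

lemma slice_L2 (hR : 0 < R) {t M : ℝ} (ht : 0 ≤ t) (h1 : L2 (R + t) (w.u t))
    (h2 : L2 (R + t) (w.ut t)) (h3 : L2 (R + t) (w.ur t)) (h2' : nrm (R + t) (w.ut t) ≤ M)
    (h3' : nrm (R + t) (w.ur t) ≤ M) :
    L2 (R + t) (fun r => |w.ut t r| + |w.ur t r| + 4 * |w.u t r / r|) ∧
    nrm (R + t) (fun r => |w.ut t r| + |w.ur t r| + 4 * |w.u t r / r|) ≤ 4 * M := by
  have hρ : 0 < R + t := by linarith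
  have hc : ContinuousOn (w.ur t) (Ioi (R + t)) := by
    have := slice_continuousOn w.cur t
    rwa [abs_of_nonneg ht] at this
  obtain ⟨k1, k2⟩ := hardy_exterior hρ
    (fun r hr => (w.hu t r (by rwa [abs_of_nonneg ht])).dr) hc h1 h3
  have habs : ∀ {f : ℝ → ℝ}, L2 (R + t) f → L2 (R + t) (fun r => |f r|) := fun hf =>
    ⟨by simpa only [Real.norm_eq_abs] using hf.1.norm, by simpa only [sq_abs] using hf.2⟩
  have nabs : ∀ f : ℝ → ℝ, nrm (R + t) (fun r => |f r|) = nrm (R + t) f := fun f => by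
    simp only [nrm, sq_abs]
  have a1 := habs h2
  have a2 := habs h3
  have a3 := (habs k1).const_mul 4
  have a12 := a1.add hρ.le a2
  refine ⟨a12.add hρ.le a3, (nrm_add_le hρ.le a12 a3).trans ?_⟩
  have e1 := nrm_add_le hρ.le a1 a2
  rw [nabs, nabs] at e1
  rw [nrm_const_mul, nabs, abs_of_pos (by norm_num : (0 : ℝ) < 4)]
  linarith

/-- Duality between the momentum at time `0` and the exterior energy at time `T`. -/
theorem duality (hR : 0 < R) (h0 : ∀ r, R < r → w.u 0 r = 0) {p q : ℝ} {γ : ℝ → ℝ}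
    (h : IsProfile p q γ) (hp : R < p) {T M B : ℝ} (hT : 0 ≤ T)
    (hL : ∀ t ∈ Icc 0 T, L2 (R + t) (w.u t) ∧ L2 (R + t) (w.ut t) ∧ L2 (R + t) (w.ur t))
    (hM : ∀ t ∈ Icc 0 T, nrm (R + t) (w.ut t) ≤ M ∧ nrm (R + t) (w.ur t) ≤ M)
    {b H : ℝ → ℝ} (hH : ∀ t ∈ Icc 0 T, HasDerivAt H (b t) t)
    (hP : ∀ t ∈ Icc 0 T, L2 (R + t) (w.P t) ∧ nrm (R + t) (w.P t) ≤ b t)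
    (hB : nrm (R + T) (w.ut T) ≤ B ∧ nrm (R + T) (w.ur T) ≤ B) :
    |∫ s in p..q, s ^ 4 * w.ut 0 s * γ s| ≤
      80 * (B + (H T - H 0)) * √(∫ s in p..q, s ^ 3 * γ s ^ 2) := by
  obtain ⟨X, hX⟩ : ∃ X, X = ∫ s in p..q, s ^ 3 * γ s ^ 2 := ⟨_, rfl⟩
  have hX0 : 0 ≤ X := hX ▸ intervalIntegral.integral_nonneg h.le fun s hs => by
    have := h.pos.trans_le hs.1; positivity
  obtain ⟨K, hK⟩ : ∃ K, K = √(50 * X) := ⟨_, rfl⟩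
  have hK0 : 0 ≤ K := hK ▸ Real.sqrt_nonneg _
  have hKsq : K ^ 2 = 50 * X := by rw [hK, Real.sq_sqrt (by positivity)]
  have hγ := h.cont
  have hRp := hp.le
  have hext : ∀ (φ : ℝ → ℝ) n, q ≤ n → ContinuousOn φ (Ioi R) → (∀ s, q ≤ s → φ s = 0) →
      (∫ s in p..n, φ s) = ∫ s in p..q, φ s := fun φ n hn hφ hφ0 => by
    have hpn := h.le.trans hn
    rw [← intervalIntegral.integral_add_adjacent_intervals (b := q) (c := n)]
    · rw [intervalIntegral.integral_congr (a := q) (b := n) (g := fun _ => (0 : ℝ))]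
      · simp
      · intro s hs
        rw [uIcc_of_le hn] at hs
        exact hφ0 s hs.1
    · exact (hφ.mono fun s hs => hp.trans_le hs.1).intervalIntegrable_of_Icc h.le
    · exact (hφ.mono fun s hs => (hp.trans_le h.le).trans_le hs.1).intervalIntegrable_of_Icc hn
  have hkK : ∀ n, q ≤ n → (∫ a in p..n, prk R p γ a ^ 2) ≤ K ^ 2 := fun n hn => by
    rw [hKsq, hX, ← hext _ n hn (by fun_prop) fun s hs => by simp [h.right s hs]]
    exact h.k_sq_le hRp hn
  have hkc := h.k_continuousOn hRp
  have hg := h.g_cont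
  have hg' := h.g'_cont.continuousOn (s := Ioi R)
  have hd : ∀ a, R < a → HasDerivAt (prg p γ) (prg' p γ a) a := fun a ha => h.g_deriv (hR.trans ha)
  obtain ⟨dI, dQ, dQa, dS⟩ := w.density_continuousOn hR hg hg'
  have hDy : ∀ {t a}, 0 ≤ t → R < a → (t, a) ∈ Dy R := fun ht ha =>
    ⟨ha, by simp only; linarith⟩
  have hpt : ∀ {x y k r : ℝ}, |x| ≤ k → |y| / r ≤ k → 0 < r →
      |x - 3 / 2 * y * r⁻¹| ≤ 5 / 2 * k := fun {x y k r} h1 h2 h3 => by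
    refine (abs_sub _ _).trans ?_
    rw [abs_mul, abs_mul, abs_inv, abs_of_pos h3, abs_of_pos (by norm_num : (0 : ℝ) < 3 / 2),
      mul_assoc, ← div_eq_mul_inv]
    linarith
  have hS : ∀ {t a}, 0 ≤ t → R < a → |w.S (prg p γ) (prg' p γ) t a| ≤
      (a + t) ^ 2 * √(a + t) * |w.P t (a + t)| * (5 / 2 * prk R p γ a) := fun {t a} ht ha => by
    obtain ⟨b1, b2, b3⟩ := y_bounds h hR ht ha
    have hat : 0 < a + t := by linarith
    have hk := prk_nonneg (p := p) (γ := γ) hR ha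
    have hs : 0 ≤ (a + t) ^ 2 * √(a + t) := by positivity
    have e := hpt b2 b3 hat
    simp only [S, cS, sg, abs_mul, abs_of_nonneg hs]
    rw [mul_assoc ((a + t) ^ 2 * √(a + t))]
    exact mul_le_mul_of_nonneg_left (mul_le_mul_of_nonneg_left e (abs_nonneg _)) hs
  have hF0 : ∀ t r : ℝ, |(fun r => |w.ut t r| + |w.ur t r| + 4 * |w.u t r / r|) r| =
      |w.ut t r| + |w.ur t r| + 4 * |w.u t r / r| := fun t r => abs_of_nonneg (by positivity)
  have hUr : ∀ t r : ℝ, |w.ur t r + 4 * w.u t r * r⁻¹| ≤ |w.ur t r| + 4 * |w.u t r / r| :=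
    fun t r => by
      refine (abs_add_le _ _).trans (le_of_eq ?_)
      rw [mul_assoc, abs_mul 4, abs_of_pos (by norm_num : (0 : ℝ) < 4), div_eq_mul_inv]
  have hQ : ∀ {t a}, 0 ≤ t → R < a → |w.Q (prg p γ) t a| ≤
      (a + t) ^ 2 * √(a + t) * |(fun r => |w.ut t r| + |w.ur t r| + 4 * |w.u t r / r|) (a + t)| *
        (5 / 2 * prk R p γ a) := fun {t a} ht ha => by
    obtain ⟨b1, b2, b3⟩ := y_bounds h hR ht ha
    have hat : 0 < a + t := by linarith
    have hs : 0 ≤ (a + t) ^ 2 * √(a + t) := by positivity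
    have e := hpt b1 b3 hat
    have e2 := hUr t (a + t)
    have e3 : |w.ut t (a + t) + w.ur t (a + t) + 4 * w.u t (a + t) * (a + t)⁻¹| ≤
        |w.ut t (a + t)| + |w.ur t (a + t)| + 4 * |w.u t (a + t) / (a + t)| := by
      rw [add_assoc]
      exact (abs_add_le _ _).trans (by linarith)
    rw [hF0]
    simp only [Q, cQ, sg, abs_mul, abs_of_nonneg hs]
    rw [mul_assoc ((a + t) ^ 2 * √(a + t))]
    exact mul_le_mul_of_nonneg_left (mul_le_mul e3 e (abs_nonneg _) (by positivity)) hs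
  have hI : ∀ {t a}, 0 ≤ t → R < a → |w.I (prg p γ) (prg' p γ) t a| ≤
      (a + t) ^ 2 * √(a + t) * |(fun r => |w.ut t r| + |w.ur t r| + 4 * |w.u t r / r|) (a + t)| *
        (5 / 2 * prk R p γ a) := fun {t a} ht ha => by
    obtain ⟨b1, b2, b3⟩ := y_bounds h hR ht ha
    have hk := prk_nonneg (p := p) (γ := γ) hR ha
    have hat : 0 < a + t := by linarith
    have hs : 0 ≤ (a + t) ^ 2 * √(a + t) := by positivity
    have e := hpt b2 b3 hat
    have e2 := hUr t (a + t)
    have e4 : |yt R (prg p γ) t a - ya R (prg p γ) (prg' p γ) t a| ≤ 5 / 2 * prk R p γ a :=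
      (abs_sub _ _).trans (by linarith)
    rw [hF0]
    simp only [I, cI, sg]
    rw [abs_mul, abs_of_nonneg hs, mul_assoc ((a + t) ^ 2 * √(a + t))]
    refine mul_le_mul_of_nonneg_left ((abs_add_le _ _).trans ?_) hs
    rw [abs_mul, abs_mul, add_assoc, add_mul]
    exact add_le_add (mul_le_mul_of_nonneg_left e (abs_nonneg _))
      (mul_le_mul e2 e4 (abs_nonneg _) (by positivity))
  have hfc : ∀ t, 0 ≤ t → ContinuousOn (fun r => |w.ut t r| + |w.ur t r| + 4 * |w.u t r / r|)
      (Ioi (R + t)) := fun t ht => by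
    have e1 := slice_continuousOn w.cu t
    have e2 := slice_continuousOn w.cut t
    have e3 := slice_continuousOn w.cur t
    rw [abs_of_nonneg ht] at e1 e2 e3
    have e4 : ContinuousOn (fun r => w.u t r / r) (Ioi (R + t)) :=
      e1.div continuousOn_id fun r hr => by
        have : R + t < r := hr
        exact (by linarith : (0 : ℝ) < r).ne'
    exact (e2.abs.add e3.abs).add (continuousOn_const.mul e4.abs)
  have hPc : ∀ t, 0 ≤ t → ContinuousOn (w.P t) (Ioi (R + t)) := fun t ht => by
    have e1 := slice_continuousOn w.ctt t
    have e2 := slice_continuousOn w.crr t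
    have e3 := slice_continuousOn w.cur t
    rw [abs_of_nonneg ht] at e1 e2 e3
    exact (e1.sub e2).sub ((continuousOn_const.mul e3).div continuousOn_id fun r hr => by
        have : R + t < r := hr
        exact (by linarith : (0 : ℝ) < r).ne')
  obtain ⟨J, hJ⟩ : ∃ J, J = ∫ s in p..q, s ^ 4 * w.ut 0 s * γ s := ⟨_, rfl⟩
  obtain ⟨J', hJ'⟩ : ∃ J', J' = ∫ s in p..q, s ^ 5 * w.ut 0 s * γ s := ⟨_, rfl⟩
  have hB0 : 0 ≤ B := (nrm_nonneg _ _).trans hB.1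
  have hHm : 0 ≤ H T - H 0 := by
    have := sub_le_of_deriv_le hT (Z := fun _ => 0) (Z' := fun _ => 0)
      (fun t _ => hasDerivAt_const t 0) hH fun t ht => (nrm_nonneg _ _).trans (hP t ht).2
    simpa using this
  have key : ∀ n, q ≤ n → |J| ≤ (10 * B * K + 5 / 2 * K * (H T - H 0)) +
      (|J'| + 10 * M * K * T) / n := fun n hn => by
    have hpn := h.le.trans hn
    have hn0 : 0 < n := h.pos.trans_le hpn
    have hwt : ∀ a ∈ Icc p n, |1 - a / n| ≤ 1 := fun a ha => by
      have h1 : 0 ≤ a / n := div_nonneg (h.pos.le.trans ha.1) hn0.le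
      have h2 : a / n ≤ 1 := (div_le_one hn0).2 ha.2
      rw [abs_of_nonneg (by linarith)]; linarith
    have hsl : ∀ {f : ℝ → ℝ → ℝ}, ContinuousOn (fun z : ℝ × ℝ => f z.1 z.2) (Dy R) → ∀ t, 0 ≤ t →
        ContinuousOn (f t) (Icc p n) := fun hf t ht =>
      hf.comp (f := fun a => (t, a)) (by fun_prop) fun a ha => hDy ht (hp.trans_le ha.1)
    have cwt : Continuous fun a : ℝ => 1 - a / n := by fun_prop
    have cwt2 : ContinuousOn (fun z : ℝ × ℝ => 1 - z.2 / n) (Dy R) := by fun_prop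
    have hZ : ∀ t ∈ Icc 0 T, HasDerivAt
        (fun t => ∫ a in p..n, (1 - a / n) * w.I (prg p γ) (prg' p γ) t a)
        (∫ a in p..n, (1 - a / n) *
          (w.Qa (prg p γ) (prg' p γ) t a + w.S (prg p γ) (prg' p γ) t a)) t := fun t ht =>
      hasDerivAt_integral_fixed (Dy_isOpen R) hpn (fun a ha => hDy ht.1 (hp.trans_le ha.1))
        (f := fun t a => (1 - a / n) * w.I (prg p γ) (prg' p γ) t a)
        (f' := fun t a => (1 - a / n) *
          (w.Qa (prg p γ) (prg' p γ) t a + w.S (prg p γ) (prg' p γ) t a))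
        (cwt2.mul dI) (cwt2.mul (dQa.add dS))
        fun t a hz => (w.I_deriv hR hg hz).const_mul _
    have hZb : ∀ t ∈ Icc 0 T, |∫ a in p..n, (1 - a / n) *
          (w.Qa (prg p γ) (prg' p γ) t a + w.S (prg p γ) (prg' p γ) t a)| ≤
        10 * M * K / n + 5 / 2 * K * b t := fun t ht => by
      obtain ⟨L1, L2', L3⟩ := hL t ht
      obtain ⟨f1, f2⟩ := w.slice_L2 hR ht.1 L1 L2' L3 (hM t ht).1 (hM t ht).2
      have c1 := hsl dQa t ht.1
      have c2 := hsl dS t ht.1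
      have c3 := hsl dQ t ht.1
      have i1 : IntervalIntegrable (fun a => (1 - a / n) * w.Qa (prg p γ) (prg' p γ) t a)
        volume p n := (cwt.continuousOn.mul c1).intervalIntegrable_of_Icc hpn
      have i2 : IntervalIntegrable (fun a => (1 - a / n) * w.S (prg p γ) (prg' p γ) t a)
        volume p n := (cwt.continuousOn.mul c2).intervalIntegrable_of_Icc hpn
      have i3 : IntervalIntegrable (fun a => w.Q (prg p γ) t a) volume p n :=
        c3.intervalIntegrable_of_Icc hpn
      have ftc : (∫ a in p..n, ((1 - a / n) * w.Qa (prg p γ) (prg' p γ) t a -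
          (1 / n) * w.Q (prg p γ) t a)) = 0 := by
        rw [intervalIntegral.integral_eq_sub_of_hasDerivAt
          (f := fun a => (1 - a / n) * w.Q (prg p γ) t a)]
        · have e1 : w.Q (prg p γ) t p = 0 := by
            obtain ⟨y1, y2⟩ := y_left (t := t) h hRp le_rfl
            rw [Q, y1, y2, cQ]; ring
          rw [e1, div_self hn0.ne']; ring
        · intro a ha
          rw [uIcc_of_le hpn] at ha
          have hQd := w.Q_deriv hR hg hd (hDy ht.1 (hp.trans_le ha.1))
          refine ((((hasDerivAt_id a).div_const n).const_sub 1).mul hQd).congr_deriv ?_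
          simp only [id]; ring
        · exact i1.sub (i3.const_mul _)
      rw [intervalIntegral.integral_sub i1 (i3.const_mul _),
        intervalIntegral.integral_const_mul] at ftc
      simp only [mul_add]
      rw [intervalIntegral.integral_add i1 i2, sub_eq_zero.1 ftc]
      have q1 := pairing_le hR ht.1 hp hpn (by norm_num : (0 : ℝ) ≤ 5 / 2) f1 (hfc t ht.1) hkc
        (hkK n hn) hK0 (F := fun a => w.Q (prg p γ) t a) fun a ha => hQ ht.1 (hp.trans_le ha.1)
      have q2 := pairing_le hR ht.1 hp hpn (by norm_num : (0 : ℝ) ≤ 5 / 2) (hP t ht).1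
        (hPc t ht.1) hkc (hkK n hn) hK0
        (F := fun a => (1 - a / n) * w.S (prg p γ) (prg' p γ) t a) fun a ha => by
          rw [abs_mul]
          refine (mul_le_mul (hwt a ha) (hS ht.1 (hp.trans_le ha.1)) (abs_nonneg _)
            zero_le_one).trans (by rw [one_mul])
      refine (abs_add_le _ _).trans (add_le_add ?_ (q2.trans ?_))
      · rw [abs_mul, abs_of_pos (by positivity), div_eq_mul_one_div (10 * M * K), mul_comm]
        refine mul_le_mul_of_nonneg_right (q1.trans ?_) (by positivity)
        have := mul_le_mul_of_nonneg_right f2 hK0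
        linarith
      · have := mul_le_mul_of_nonneg_right (hP t ht).2 hK0
        linarith
    have hG : ∀ t ∈ Icc 0 T, HasDerivAt (fun t => 10 * M * K / n * t + 5 / 2 * K * H t)
        (10 * M * K / n + 5 / 2 * K * b t) t := fun t ht =>
      ((((hasDerivAt_id t).const_mul _).congr_deriv (by simp)).add ((hH t ht).const_mul _))
    have hZ0 := abs_sub_le_of_deriv hT hZ hG hZb
    have hZT : |∫ a in p..n, (1 - a / n) * w.I (prg p γ) (prg' p γ) T a| ≤ 10 * B * K := by
      obtain ⟨L1, L2', L3⟩ := hL T ⟨hT, le_rfl⟩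
      obtain ⟨f1, f2⟩ := w.slice_L2 hR hT L1 L2' L3 hB.1 hB.2
      have q1 := pairing_le hR hT hp hpn (by norm_num : (0 : ℝ) ≤ 5 / 2) f1
        (hfc T hT) hkc (hkK n hn) hK0
        (F := fun a => (1 - a / n) * w.I (prg p γ) (prg' p γ) T a) fun a ha => by
          rw [abs_mul]
          refine (mul_le_mul (hwt a ha) (hI hT (hp.trans_le ha.1)) (abs_nonneg _)
            zero_le_one).trans (by rw [one_mul])
      have := mul_le_mul_of_nonneg_right f2 hK0
      linarith
    have cut0 : ContinuousOn (w.ut 0) (Ioi R) := by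
      have := slice_continuousOn w.cut 0
      rwa [abs_zero, add_zero] at this
    have hZz : (∫ a in p..n, (1 - a / n) * w.I (prg p γ) (prg' p γ) 0 a) = J - 1 / n * J' := by
      have c4 : ContinuousOn (fun s => s ^ 4 * w.ut 0 s * γ s) (Ioi R) :=
        ((continuous_pow 4).continuousOn.mul cut0).mul hγ.continuousOn
      have c5 : ContinuousOn (fun s => s ^ 5 * w.ut 0 s * γ s) (Ioi R) :=
        ((continuous_pow 5).continuousOn.mul cut0).mul hγ.continuousOn
      have hsub : Icc p n ⊆ Ioi R := fun a ha => hp.trans_le ha.1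
      rw [hJ, hJ', ← hext _ n hn c4 fun s hs => by simp [h.right s hs],
        ← hext _ n hn c5 fun s hs => by simp [h.right s hs],
        ← intervalIntegral.integral_const_mul, ← intervalIntegral.integral_sub
          ((c4.mono hsub).intervalIntegrable_of_Icc hpn)
          (((c5.mono hsub).intervalIntegrable_of_Icc hpn).const_mul _)]
      refine intervalIntegral.integral_congr fun a ha => ?_
      rw [uIcc_of_le hpn] at ha
      have hRa : R < a := hp.trans_le ha.1
      have ha0 : 0 < a := hR.trans hRa
      have hur0 : w.ur 0 a = 0 := by
        have h1 := (w.hu 0 a (by rw [abs_zero]; linarith)).dr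
        have h2 : HasDerivAt (fun s => w.u 0 s) 0 a :=
          (hasDerivAt_const a (0 : ℝ)).congr_of_eventuallyEq
            (by filter_upwards [Ioi_mem_nhds hRa] with s hs using h0 s hs)
        exact h1.unique h2
      obtain ⟨y1, y2⟩ := y_zero_time (R := R) (g := prg p γ) (g' := prg' p γ) a
      have e1 := IsProfile.sub_eq (p := p) (γ := γ) ha0
      have e2 : prg' p γ a - 3 / 2 * prg p γ a * a⁻¹ = a * √a * γ a := by
        rw [← e1]; field_simp
      have e3 := Real.mul_self_sqrt ha0.le
      simp only [I, cI, sg, add_zero, y1, y2, hur0, h0 a hRa, e2, mul_zero, zero_mul]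
      have e4 : a ^ 2 * √a * (w.ut 0 a * (a * √a * γ a)) = (√a * √a) * (a ^ 3 * w.ut 0 a * γ a) := by
        ring
      rw [e4, e3]
      field_simp
    rw [hZz] at hZ0
    have t1 : |J| ≤ |J - 1 / n * J'| + |J'| / n := by
      have : J = (J - 1 / n * J') + 1 / n * J' := by ring
      calc |J| = |(J - 1 / n * J') + 1 / n * J'| := by rw [← this]
        _ ≤ _ := abs_add_le _ _
        _ = _ := by rw [abs_mul, abs_of_pos (by positivity : 0 < 1 / n)]; ring
    have t2 : |J - 1 / n * J'| ≤ |∫ a in p..n, (1 - a / n) * w.I (prg p γ) (prg' p γ) T a| +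
        |(∫ a in p..n, (1 - a / n) * w.I (prg p γ) (prg' p γ) T a) - (J - 1 / n * J')| := by
      have := abs_sub (∫ a in p..n, (1 - a / n) * w.I (prg p γ) (prg' p γ) T a)
        ((∫ a in p..n, (1 - a / n) * w.I (prg p γ) (prg' p γ) T a) - (J - 1 / n * J'))
      rwa [_root_.sub_sub_cancel] at this
    have t3 : (|J'| + 10 * M * K * T) / n = |J'| / n + 10 * M * K / n * T := by ring
    rw [t3]
    simp only [mul_zero, zero_add] at hZ0
    linarith
  have hlim : Tendsto (fun n : ℝ => (10 * B * K + 5 / 2 * K * (H T - H 0)) +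
      (|J'| + 10 * M * K * T) / n) atTop (𝓝 ((10 * B * K + 5 / 2 * K * (H T - H 0)) + 0)) :=
    tendsto_const_nhds.add (tendsto_const_nhds.div_atTop tendsto_id)
  have hfin : |J| ≤ (10 * B * K + 5 / 2 * K * (H T - H 0)) + 0 :=
    ge_of_tendsto hlim ((eventually_ge_atTop q).mono key)
  have hK8 : K ≤ 8 * √X := by
    rw [hK]
    refine Real.sqrt_le_iff.2 ⟨by positivity, ?_⟩
    rw [mul_pow, Real.sq_sqrt hX0]; linarith
  rw [← hJ, ← hX]
  have e1 := mul_le_mul_of_nonneg_left hK8 hB0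
  have e2 := mul_le_mul_of_nonneg_left hK8 hHm
  have e3 : 0 ≤ (H T - H 0) * √X := mul_nonneg hHm (Real.sqrt_nonneg _)
  nlinarith

end Wv

/-- The fundamental solution of the Laplacian of `ℝ⁶`, up to a constant. -/
def iv (r : ℝ) : ℝ := (r ^ 4)⁻¹

lemma iv_contAt {r : ℝ} (hr : 0 < r) : ContinuousAt iv r :=
  (continuousAt_id.pow 4).inv₀ (by simpa using hr.ne')

lemma iv_continuousOn {R : ℝ} (hR : 0 ≤ R) : ContinuousOn iv (Ioi R) := fun _ hr =>
  (iv_contAt (lt_of_le_of_lt hR hr)).continuousWithinAt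

lemma iv_sq {r : ℝ} (hr : 0 < r) : iv r ^ 2 * r ^ 5 = (r ^ 3)⁻¹ := by
  rw [iv]; field_simp

lemma iv_L2 {R : ℝ} (hR : 0 < R) : L2 R iv ∧ (∫ r in Ioi R, iv r ^ 2 * r ^ 5) = 1 / (2 * R ^ 2) := by
  have hd : ∀ r ∈ Ici R, HasDerivAt (fun r : ℝ => -(1 / (2 * r ^ 2))) (iv r ^ 2 * r ^ 5) r :=
    fun r hr => by
      have hr0 : 0 < r := hR.trans_le hr
      rw [iv_sq hr0]
      have := (((hasDerivAt_id r).pow 2).const_mul 2).inv (c := fun r : ℝ => 2 * (id ^ 2) r)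
        (by simp; exact hr0.ne')
      refine (this.neg.congr_of_eventuallyEq (Eventually.of_forall fun s => by
        simp [one_div])).congr_deriv ?_
      simp only [id, Pi.pow_apply]
      field_simp
      norm_num
  have hn : ∀ r ∈ Ioi R, 0 ≤ iv r ^ 2 * r ^ 5 := fun r hr => by
    have : 0 < r := hR.trans hr
    positivity
  have ht : Tendsto (fun r : ℝ => -(1 / (2 * r ^ 2))) atTop (𝓝 0) := by
    have : Tendsto (fun r : ℝ => 1 / (2 * r ^ 2)) atTop (𝓝 0) :=
      tendsto_const_nhds.div_atTop ((tendsto_pow_atTop two_ne_zero).const_mul_atTop two_pos)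
    simpa using this.neg
  refine ⟨⟨(iv_continuousOn hR.le).aestronglyMeasurable measurableSet_Ioi,
    integrableOn_Ioi_deriv_of_nonneg' hd hn ht⟩, ?_⟩
  rw [integral_Ioi_of_hasDerivAt_of_nonneg' hd hn ht]
  ring

lemma iv_nrm {R : ℝ} (hR : 0 < R) : nrm R iv ≤ 1 / R := by
  refine nrm_le_of_sq (by positivity) ?_
  rw [(iv_L2 hR).2, div_pow, one_pow]
  gcongr
  nlinarith [sq_nonneg R]

/-- Continuous cutoffs exhausting `(R, ∞)`. -/
def ctf (R n r : ℝ) : ℝ := max 0 (min 1 (min (n * (r - R) - 1) (n - r)))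

lemma ctf_continuous (R n : ℝ) : Continuous (ctf R n) := by unfold ctf; fun_prop

lemma ctf_mem (R n r : ℝ) : 0 ≤ ctf R n r ∧ ctf R n r ≤ 1 :=
  ⟨le_max_left _ _, max_le zero_le_one (min_le_left _ _)⟩

lemma ctf_left {R n r : ℝ} (hn : 0 < n) (h : r ≤ R + 1 / n) : ctf R n r = 0 := by
  refine max_eq_left ((min_le_right _ _).trans ((min_le_left _ _).trans ?_))
  have : n * (r - R) ≤ n * (1 / n) := by gcongr; linarith
  rw [mul_one_div_cancel hn.ne'] at this
  linarith

lemma ctf_right {R n r : ℝ} (h : n ≤ r) : ctf R n r = 0 :=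
  max_eq_left ((min_le_right _ _).trans ((min_le_right _ _).trans (by linarith)))

lemma ctf_tendsto {R r : ℝ} (h : R < r) : Tendsto (fun n : ℕ => ctf R n r) atTop (𝓝 1) := by
  refine tendsto_const_nhds.congr' ?_
  have h1 : Tendsto (fun n : ℕ => (n : ℝ) * (r - R)) atTop atTop :=
    tendsto_natCast_atTop_atTop.atTop_mul_const (by linarith)
  filter_upwards [h1.eventually_ge_atTop 2,
    tendsto_natCast_atTop_atTop.eventually_ge_atTop (r + 1)] with n hn1 hn2
  rw [ctf, min_eq_left, max_eq_right zero_le_one]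
  exact le_min (by linarith) (by linarith)

lemma ctf_integral {R : ℝ} {h : ℝ → ℝ} (hh : IntegrableOn h (Ioi R)) :
    (∀ n, IntegrableOn (fun r => ctf R n r * h r) (Ioi R)) ∧
    Tendsto (fun n : ℕ => ∫ r in Ioi R, ctf R n r * h r) atTop (𝓝 (∫ r in Ioi R, h r)) := by
  have hb : ∀ n r, ‖ctf R n r * h r‖ ≤ ‖h r‖ := fun n r => by
    rw [norm_mul, Real.norm_eq_abs, abs_of_nonneg (ctf_mem R n r).1]
    exact mul_le_of_le_one_left (norm_nonneg _) (ctf_mem R n r).2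
  have hm : ∀ n, AEStronglyMeasurable (fun r => ctf R n r * h r) (volume.restrict (Ioi R)) :=
    fun n => (ctf_continuous R n).aestronglyMeasurable.mul hh.1
  refine ⟨fun n => Integrable.mono hh (hm n) (Eventually.of_forall (hb n)), ?_⟩
  refine tendsto_integral_of_dominated_convergence (fun r => ‖h r‖) (fun n => hm n) hh.norm
    (fun n => Eventually.of_forall (hb n)) ?_
  refine (ae_restrict_iff' measurableSet_Ioi).2 (Eventually.of_forall fun r hr => ?_)
  simpa using (ctf_tendsto hr).mul_const (h r)

/-- A bound on the orthogonal projection from its pairings with mean-zero profiles. -/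
lemma dual_le {R K c : ℝ} (hR : 0 < R) (hK : 0 ≤ K) {f m : ℝ → ℝ} (hf : L2 R f)
    (hfc : ContinuousOn f (Ioi R)) (h0 : (∫ r in Ioi R, f r * iv r * r ^ 5) = 0)
    (hm : ∀ r, R < r → m r = f r + c * iv r)
    (H : ∀ p q γ, IsProfile p q γ → R < p →
      |∫ s in p..q, s ^ 4 * m s * γ s| ≤ K * √(∫ s in p..q, s ^ 3 * γ s ^ 2)) :
    nrm R f ≤ K := by
  have hg := (iv_L2 hR).1
  have hfg := hf.integrable_mul hR.le hg
  obtain ⟨A, hA⟩ : ∃ A : ℕ → ℝ, ∀ n, A n = ∫ r in Ioi R, ctf R n r * (f r ^ 2 * r ^ 5) :=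
    ⟨_, fun _ => rfl⟩
  obtain ⟨B, hB⟩ : ∃ B : ℕ → ℝ, ∀ n, B n = ∫ r in Ioi R, ctf R n r * (f r * iv r * r ^ 5) :=
    ⟨_, fun _ => rfl⟩
  obtain ⟨D, hD⟩ : ∃ D : ℕ → ℝ, ∀ n, D n = ∫ r in Ioi R, ctf R n r * (iv r ^ 2 * r ^ 5) :=
    ⟨_, fun _ => rfl⟩
  have tA : Tendsto A atTop (𝓝 (nrm R f ^ 2)) := by
    rw [nrm_sq hR.le, funext hA]; exact (ctf_integral hf.2).2
  have tB : Tendsto B atTop (𝓝 0) := by rw [← h0, funext hB]; exact (ctf_integral hfg).2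
  have tD : Tendsto D atTop (𝓝 (1 / (2 * R ^ 2))) := by
    rw [← (iv_L2 hR).2, funext hD]; exact (ctf_integral hg.2).2
  have hDpos : 0 < 1 / (2 * R ^ 2) := by positivity
  have tE : Tendsto (fun n => A n - B n ^ 2 / D n) atTop (𝓝 (nrm R f ^ 2 - 0 ^ 2 / (1 / (2 * R ^ 2)))) :=
    tA.sub ((tB.pow 2).div tD hDpos.ne')
  have key : ∀ᶠ n in atTop, A n - B n ^ 2 / D n ≤ K ^ 2 := by
    filter_upwards [tD.eventually (lt_mem_nhds hDpos),
      tendsto_natCast_atTop_atTop.eventually_ge_atTop (R + 1),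
      tendsto_natCast_atTop_atTop.eventually_ge_atTop (1 : ℝ)] with n hDn hn1 hn2
    have hn0 : (0 : ℝ) < n := by linarith
    obtain ⟨b, hb⟩ : ∃ b, b = B n / D n := ⟨_, rfl⟩
    have hbD : b * D n = B n := by rw [hb]; field_simp
    have e0 : A n - B n ^ 2 / D n = A n - b * B n := by rw [hb]; ring
    have hp : R < R + 1 / (n : ℝ) := by have : 0 < 1 / (n : ℝ) := by positivity
                                        linarith
    have hpq : R + 1 / (n : ℝ) ≤ n := by
      have : 1 / (n : ℝ) ≤ 1 := by rw [div_le_one hn0]; exact hn2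
      linarith
    let γ : ℝ → ℝ := fun r => ctf R n r * (r * (f r - b * iv r))
    have hl : ∀ s, s ≤ R + 1 / (n : ℝ) → γ s = 0 := fun s hs => by
      simp only [γ, ctf_left hn0 hs, zero_mul]
    have hr : ∀ s, (n : ℝ) ≤ s → γ s = 0 := fun s hs => by
      simp only [γ, ctf_right hs, zero_mul]
    have hcont : Continuous γ := continuous_iff_continuousAt.2 fun r => by
      rcases lt_or_ge R r with h | h
      · exact (ctf_continuous R n).continuousAt.mul (continuousAt_id.mul
          ((hfc.continuousAt (Ioi_mem_nhds h)).sub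
            (continuousAt_const.mul (iv_contAt (hR.trans h)))))
      · have : γ =ᶠ[𝓝 r] fun _ => 0 := by
          filter_upwards [Iio_mem_nhds (h.trans_lt hp)] with s hs using hl s hs.le
        exact continuousAt_const.congr this.symm
    have hgam : ∀ φ : ℝ → ℝ, (∀ s, γ s = 0 → φ s = 0) →
        (∫ s in (R + 1 / (n : ℝ))..n, φ s) = ∫ s in Ioi R, φ s := fun φ hφ => by
      rw [intervalIntegral.integral_of_le hpq]
      refine (setIntegral_eq_of_subset_of_forall_sdiff_eq_zero measurableSet_Ioi
        (fun s hs => hp.trans hs.1) fun s hs => hφ s ?_).symm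
      rcases le_or_gt s (R + 1 / (n : ℝ)) with h | h
      · exact hl s h
      · exact hr s (not_lt.1 fun h' => hs.2 ⟨h, h'.le⟩)
    have iA := (ctf_integral hf.2).1 n
    have iB := (ctf_integral hfg).1 n
    have iD := (ctf_integral hg.2).1 n
    have hmean : (∫ s in (R + 1 / (n : ℝ))..n, γ s) = 0 := by
      rw [hgam γ fun s h => h]
      have e : EqOn γ (fun r => ctf R n r * (f r * iv r * r ^ 5) -
          b * (ctf R n r * (iv r ^ 2 * r ^ 5))) (Ioi R) := fun r hr => by
        have : 0 < r := hR.trans hr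
        simp only [γ, iv]; field_simp
      rw [setIntegral_congr_fun measurableSet_Ioi e, integral_sub iB (iD.const_mul b),
        integral_const_mul, ← hB, ← hD, hbD, sub_self]
    have hprof : IsProfile (R + 1 / (n : ℝ)) n γ :=
      ⟨hcont, hR.trans hp, hpq, hl, hr, hmean⟩
    have h1 := H _ _ γ hprof hp
    have e1 : (∫ s in (R + 1 / (n : ℝ))..n, s ^ 4 * m s * γ s) = A n - b * B n := by
      rw [hgam _ fun s h => by rw [h, mul_zero]]
      have e : EqOn (fun s => s ^ 4 * m s * γ s) (fun r => ctf R n r * (f r ^ 2 * r ^ 5) +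
          (c - b) * (ctf R n r * (f r * iv r * r ^ 5)) -
          c * b * (ctf R n r * (iv r ^ 2 * r ^ 5))) (Ioi R) := fun r hr => by
        simp only [γ, hm r hr]; ring
      have i12 : IntegrableOn (fun r => ctf R n r * (f r ^ 2 * r ^ 5) +
          (c - b) * (ctf R n r * (f r * iv r * r ^ 5))) (Ioi R) := iA.add (iB.const_mul _)
      rw [setIntegral_congr_fun measurableSet_Ioi e, integral_sub i12 (iD.const_mul _),
        integral_add iA (iB.const_mul _),
        integral_const_mul, integral_const_mul, ← hB, ← hD, ← hA, ← hbD]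
      ring
    have e2 : (∫ s in (R + 1 / (n : ℝ))..n, s ^ 3 * γ s ^ 2) ≤ A n - b * B n := by
      rw [hgam _ fun s h => by rw [h]; ring]
      have i12 : IntegrableOn (fun r => ctf R n r * (f r ^ 2 * r ^ 5) -
          2 * b * (ctf R n r * (f r * iv r * r ^ 5))) (Ioi R) := iA.sub (iB.const_mul _)
      have i123 : IntegrableOn (fun r => ctf R n r * (f r ^ 2 * r ^ 5) -
          2 * b * (ctf R n r * (f r * iv r * r ^ 5)) +
          b ^ 2 * (ctf R n r * (iv r ^ 2 * r ^ 5))) (Ioi R) := i12.add (iD.const_mul _)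
      have e3 : (∫ r in Ioi R, ctf R n r * (f r ^ 2 * r ^ 5) -
          2 * b * (ctf R n r * (f r * iv r * r ^ 5)) +
          b ^ 2 * (ctf R n r * (iv r ^ 2 * r ^ 5))) = A n - b * B n := by
        rw [integral_add i12 (iD.const_mul _), integral_sub iA (iB.const_mul _),
          integral_const_mul, integral_const_mul, ← hB, ← hD, ← hA, ← hbD]
        ring
      rw [← e3]
      refine setIntegral_mono_on_ae₀ ?_ i123 measurableSet_Ioi.nullMeasurableSet
        (Eventually.of_forall fun r hr => ?_)
      · have hcs : HasCompactSupport fun s => s ^ 3 * γ s ^ 2 := by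
          refine HasCompactSupport.intro (K := Icc (R + 1 / (n : ℝ)) n) isCompact_Icc fun s hs => ?_
          have : γ s = 0 := by
            rcases le_or_gt s (R + 1 / (n : ℝ)) with h | h
            · exact hl s h
            · exact hr s (not_lt.1 fun h' => hs ⟨h.le, h'.le⟩)
          rw [this]; ring
        exact ((by fun_prop : Continuous fun s => s ^ 3 * γ s ^ 2).integrable_of_hasCompactSupport
          hcs).integrableOn
      · have h0' := ctf_mem R n r
        have hr0 : 0 < r := hR.trans hr
        have : 0 ≤ r ^ 5 * (f r - b * iv r) ^ 2 := by positivity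
        simp only [γ]
        nlinarith [mul_le_mul_of_nonneg_right h0'.2 (mul_nonneg h0'.1 this)]
    rw [e1] at h1
    rw [e0]
    have hE : 0 ≤ A n - b * B n := le_trans (by
      refine intervalIntegral.integral_nonneg hpq fun s hs => ?_
      have : 0 < s := (hR.trans hp).trans_le hs.1
      positivity) e2
    have h2 : A n - b * B n ≤ K * √(A n - b * B n) :=
      (le_abs_self _).trans (h1.trans (mul_le_mul_of_nonneg_left (Real.sqrt_le_sqrt e2) hK))
    have h3 := Real.sq_sqrt hE
    have h4 := Real.sqrt_nonneg (A n - b * B n)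
    have h5 : √(A n - b * B n) ≤ K := by
      rcases h4.eq_or_lt with h | h
      · rw [← h]; exact hK
      · refine le_of_mul_le_mul_right ?_ h
        nlinarith
    nlinarith
  have h2 := le_of_tendsto tE key
  have h3 : nrm R f ^ 2 ≤ K ^ 2 := by simpa using h2
  exact (abs_le_of_sq_le_sq' h3 hK).2

lemma pow8_integral {A B t : ℝ} (hA : 0 < A) (hAB : A ≤ B) (ht : 0 ≤ t) (htA : t ≤ A) :
    (∫ r in A..B, r ^ 5 * (t ^ 2 * (r ^ 8)⁻¹)) ≤ 1 / 2 := by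
  have hd : ∀ r ∈ uIcc A B, HasDerivAt (fun r : ℝ => -(t ^ 2 * (1 / 2 * (r ^ 2)⁻¹)))
      (r ^ 5 * (t ^ 2 * (r ^ 8)⁻¹)) r := fun r hr => by
    rw [uIcc_of_le hAB] at hr
    have hr0 : 0 < r := hA.trans_le hr.1
    have := ((hasDerivAt_pow 2 r).inv (by positivity)).const_mul (1 / 2 : ℝ)
    refine (this.const_mul (t ^ 2)).neg.congr_deriv ?_
    field_simp
    norm_num
  rw [intervalIntegral.integral_eq_sub_of_hasDerivAt hd]
  · have h1 : 0 ≤ t ^ 2 * (1 / 2 * (B ^ 2)⁻¹) := by positivity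
    have h2 : t ^ 2 * (1 / 2 * (A ^ 2)⁻¹) ≤ 1 / 2 := by
      have : t ^ 2 * (A ^ 2)⁻¹ ≤ 1 := by
        rw [← div_eq_mul_inv, div_le_one (by positivity)]
        exact pow_le_pow_left₀ ht htA 2
      linarith
    linarith
  · refine ContinuousOn.intervalIntegrable_of_Icc hAB ?_
    refine (by fun_prop : Continuous fun r : ℝ => r ^ 5).continuousOn.mul
      (continuousOn_const.mul (ContinuousOn.inv₀ (by fun_prop) fun r hr => ?_))
    have : 0 < r := hA.trans_le hr.1
    positivity

/-- A differential form of Gronwall's inequality. -/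
lemma gronwall_le {T C : ℝ} (hT : 0 ≤ T) {F F' κ H : ℝ → ℝ}
    (hF : ∀ t ∈ Icc 0 T, HasDerivAt F (F' t) t) (hH : ∀ t ∈ Icc 0 T, HasDerivAt H (κ t) t)
    (h : ∀ t ∈ Icc 0 T, F' t ≤ 4 * κ t * (F t + C)) :
    F T + C ≤ exp (4 * (H T - H 0)) * (F 0 + C) := by
  have h1 := sub_le_of_deriv_le hT (Z := fun t => exp (-(4 * H t)) * (F t + C))
    (Z' := fun t => exp (-(4 * H t)) * (-(4 * κ t)) * (F t + C) + exp (-(4 * H t)) * F' t)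
    (G := fun _ => 0) (G' := fun _ => 0)
    (fun t ht => (((hH t ht).const_mul 4).neg.exp).mul ((hF t ht).add_const C))
    (fun t _ => hasDerivAt_const t 0) fun t ht => by
      have := mul_le_mul_of_nonneg_left (h t ht) (exp_pos (-(4 * H t))).le
      linarith
  simp only [sub_self] at h1
  have h2 := mul_le_mul_of_nonneg_left h1 (exp_pos (4 * H T)).le
  rw [mul_zero, mul_sub, ← mul_assoc, ← mul_assoc, ← exp_add, ← exp_add] at h2
  have e1 : 4 * H T + -(4 * H T) = 0 := by ring
  have e2 : 4 * H T + -(4 * H 0) = 4 * (H T - H 0) := by ring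
  rw [e1, e2, exp_zero] at h2
  linarith

namespace Wv
variable {R : ℝ} (w : Wv R) (ω ω' : ℝ → ℝ)

/-- The energy density at time `t` with weight `ω`. -/
def en (t r : ℝ) : ℝ := w.ut t r ^ 2 + w.ur t r ^ 2 + ω r * w.u t r ^ 2

def eJ (t a : ℝ) : ℝ := (a + t) ^ 5 * w.en ω t (a + t)
def eF (t a : ℝ) : ℝ :=
  (a + t) ^ 5 * (w.en ω t (a + t) + 2 * (w.ut t (a + t) * w.ur t (a + t)))
def eFa (t a : ℝ) : ℝ :=
  5 * (a + t) ^ 4 * (w.en ω t (a + t) + 2 * (w.ut t (a + t) * w.ur t (a + t))) +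
  (a + t) ^ 5 * (2 * w.ut t (a + t) * w.utr t (a + t) + 2 * w.ur t (a + t) * w.urr t (a + t) +
    (ω' (a + t) * w.u t (a + t) ^ 2 + ω (a + t) * (2 * w.u t (a + t) * w.ur t (a + t))) +
    2 * (w.utr t (a + t) * w.ur t (a + t) + w.ut t (a + t) * w.urr t (a + t)))
def eS (t a : ℝ) : ℝ :=
  (a + t) ^ 5 * (2 * w.ut t (a + t) * w.P t (a + t) +
    2 * ω (a + t) * w.u t (a + t) * w.ut t (a + t))

variable {ω ω'} (hR : 0 < R) (hω : ∀ r, R < r → HasDerivAt ω (ω' r) r)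
  (hω' : ContinuousOn ω' (Ioi R))
include hR hω

lemma energy_deriv {t a : ℝ} (h : (t, a) ∈ Dy R) :
    HasDerivAt (fun a => w.eF ω t a) (w.eFa ω ω' t a) a ∧
    HasDerivAt (fun t => w.eJ ω t a) (w.eFa ω ω' t a + w.eS ω t a) t := by
  have hr := (Dy_pos hR h).2
  simp only at hr
  have hc := Dy_cone h
  have hRr : R < a + t := by linarith [abs_nonneg t]
  constructor
  · have hU := (w.hu t (a + t) hc).char_a
    have hUt := (w.hut t (a + t) hc).char_a
    have hUr := (w.hur t (a + t) hc).char_a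
    have ho := (hω _ hRr).comp_add_const a t
    have h5 := ((hasDerivAt_id a).add_const t).pow 5
    refine (h5.mul ((((hUt.pow 2).add (hUr.pow 2)).add (ho.mul (hU.pow 2))).add
      ((hUt.mul hUr).const_mul 2))).congr_deriv ?_
    simp only [eFa, en, Pi.add_apply, Pi.mul_apply, Pi.pow_apply, id]
    push_cast
    ring
  · have hU := (w.hu t (a + t) hc).char_t
    have hUt := (w.hut t (a + t) hc).char_t
    have hUr := (w.hur t (a + t) hc).char_t
    have ho := (hω _ hRr).comp_const_add a t
    have h5 := ((hasDerivAt_id t).const_add a).pow 5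
    refine (h5.mul (((hUt.pow 2).add (hUr.pow 2)).add (ho.mul (hU.pow 2)))).congr_deriv ?_
    simp only [eFa, eS, P, en, Pi.add_apply, Pi.mul_apply, Pi.pow_apply, id]
    field_simp
    push_cast
    ring

include hω' in
lemma energy_continuousOn :
    ContinuousOn (fun z : ℝ × ℝ => w.eJ ω z.1 z.2) (Dy R) ∧
    ContinuousOn (fun z : ℝ × ℝ => w.eFa ω ω' z.1 z.2) (Dy R) ∧
    ContinuousOn (fun z : ℝ × ℝ => w.eS ω z.1 z.2) (Dy R) := by
  have d1 := char_continuousOn w.cu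
  have d2 := char_continuousOn w.cut
  have d3 := char_continuousOn w.cur
  have d4 := char_continuousOn w.ctt
  have d5 := char_continuousOn w.ctr
  have d6 := char_continuousOn w.crr
  have hmap : MapsTo (fun z : ℝ × ℝ => z.2 + z.1) (Dy R) (Ioi R) := fun z hz => by
    have := Dy_cone (t := z.1) (a := z.2) hz
    exact mem_Ioi.2 (by linarith [abs_nonneg z.1])
  have hcω : ContinuousOn ω (Ioi R) := fun r hr => (hω r hr).continuousAt.continuousWithinAt
  have o1 : ContinuousOn (fun z : ℝ × ℝ => ω (z.2 + z.1)) (Dy R) :=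
    hcω.comp (f := fun z : ℝ × ℝ => z.2 + z.1) (by fun_prop) hmap
  have o2 : ContinuousOn (fun z : ℝ × ℝ => ω' (z.2 + z.1)) (Dy R) :=
    hω'.comp (f := fun z : ℝ × ℝ => z.2 + z.1) (by fun_prop) hmap
  have p5 : ContinuousOn (fun z : ℝ × ℝ => (z.2 + z.1) ^ 5) (Dy R) := by fun_prop
  have p4 : ContinuousOn (fun z : ℝ × ℝ => 5 * (z.2 + z.1) ^ 4) (Dy R) := by fun_prop
  have k2 : ∀ {f : ℝ × ℝ → ℝ}, ContinuousOn f (Dy R) → ContinuousOn (fun z => 2 * f z) (Dy R) :=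
    fun hf => continuousOn_const.mul hf
  have hen := ((d2.pow 2).add (d3.pow 2)).add (o1.mul (d1.pow 2))
  refine ⟨p5.mul hen, ?_, ?_⟩
  · exact (p4.mul (hen.add (k2 (d2.mul d3)))).add (p5.mul ((((((k2 d2).mul d5).add
      ((k2 d3).mul d6))).add ((o2.mul (d1.pow 2)).add (o1.mul ((k2 d1).mul d3)))).add
      (k2 ((d5.mul d3).add (d2.mul d6)))))
  · have hP : ContinuousOn (fun z : ℝ × ℝ => w.P z.1 (z.2 + z.1)) (Dy R) :=
      (d4.sub d6).sub ((continuousOn_const.mul d3).div (by fun_prop)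
        fun z hz => (Dy_pos hR hz).2.ne')
    exact p5.mul (((k2 d2).mul hP).add (((k2 o1).mul d1).mul d2))

include hω' in
/-- The exterior energy estimate. -/
theorem energy_estimate (h0 : ∀ r, R < r → 0 ≤ ω r) {T c E : ℝ} (hT : 0 ≤ T) {κ H : ℝ → ℝ}
    (hH : ∀ t ∈ Icc 0 T, HasDerivAt H (κ t) t) (hκ : ∀ t ∈ Icc 0 T, 0 ≤ κ t)
    (hS : ∀ t ∈ Icc 0 T, ∀ r, R + t < r →
      2 * w.ut t r * w.P t r + 2 * ω r * w.u t r * w.ut t r ≤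
        κ t * (4 * w.en ω t r + 2 * c ^ 2 * (t ^ 2 * (r ^ 8)⁻¹)))
    (hi : IntegrableOn (fun r => r ^ 5 * w.en ω 0 r) (Ioi R))
    (hE : (∫ r in Ioi R, r ^ 5 * w.en ω 0 r) ≤ E) :
    IntegrableOn (fun r => r ^ 5 * w.en ω T r) (Ioi (R + T)) ∧
    (∫ r in Ioi (R + T), r ^ 5 * w.en ω T r) ≤ exp (4 * (H T - H 0)) * (E + c ^ 2) := by
  obtain ⟨cJ, cFa, cS⟩ := w.energy_continuousOn hR hω hω'
  have hen : ∀ t r, R < r → 0 ≤ w.en ω t r := fun t r hr => by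
    have := h0 r hr
    unfold en; positivity
  have hcω : ContinuousOn ω (Ioi R) := fun r hr => (hω r hr).continuousAt.continuousWithinAt
  have hsl : ContinuousOn (fun r => r ^ 5 * w.en ω T r) (Ioi (R + T)) := by
    have e1 := slice_continuousOn w.cu T
    have e2 := slice_continuousOn w.cut T
    have e3 := slice_continuousOn w.cur T
    rw [abs_of_nonneg hT] at e1 e2 e3
    exact (continuous_pow 5).continuousOn.mul (((e2.pow 2).add (e3.pow 2)).add
      ((hcω.mono (Ioi_subset_Ioi (by linarith))).mul (e1.pow 2)))
  refine integrableOn_of_exhaustion hsl (fun r hr => ?_) fun x M hx hM => ?_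
  · have hr' : R + T < r := hr
    have := hen T r (by linarith)
    have : 0 < r := by linarith
    positivity
  rcases hM.eq_or_lt with rfl | hM
  · rw [intervalIntegral.integral_same]
    refine mul_nonneg (exp_pos _).le (add_nonneg (le_trans ?_ hE) (sq_nonneg c))
    refine setIntegral_nonneg measurableSet_Ioi fun r hr => ?_
    have := hen 0 r hr
    have : 0 < r := hR.trans hr
    positivity
  obtain ⟨α, rfl⟩ : ∃ α, x = α + T := ⟨x - T, by ring⟩
  obtain ⟨β, rfl⟩ : ∃ β, M = β + T := ⟨M - T, by ring⟩
  have hα : R < α := by linarith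
  have hαβ : α < β := by linarith
  have hDy : ∀ {t a}, 0 ≤ t → α ≤ a → (t, a) ∈ Dy R := fun ht ha =>
    ⟨by simp only; linarith, by simp only; linarith⟩
  have hend : ∀ t ∈ Icc 0 T, α < β + 2 * (T - t) := fun t ht => by linarith [ht.2]
  have hF : ∀ t ∈ Icc 0 T, HasDerivAt (fun t => ∫ a in α..β + 2 * (T - t), w.eJ ω t a)
      (-2 * w.eJ ω t (β + 2 * (T - t)) +
        ∫ a in α..β + 2 * (T - t), (w.eFa ω ω' t a + w.eS ω t a)) t := fun t ht =>
    hasDerivAt_integral_moving (Dy_isOpen R) (b := fun t => β + 2 * (T - t)) (b' := -2)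
      (hend t ht)
      (((((hasDerivAt_id t).const_sub T).const_mul 2).const_add β).congr_deriv (by norm_num))
      (fun a ha => hDy ht.1 ha.1) cJ (cFa.add cS) (fun t a hz => (w.energy_deriv hR hω hz).2)
  have hcont : ∀ {f : ℝ → ℝ → ℝ}, ContinuousOn (fun z : ℝ × ℝ => f z.1 z.2) (Dy R) → ∀ t ∈ Icc 0 T,
      IntervalIntegrable (f t) volume α (β + 2 * (T - t)) := fun hf t ht =>
    ContinuousOn.intervalIntegrable_of_Icc (hend t ht).le
      (hf.comp (f := fun a => (t, a)) (by fun_prop) fun a ha => hDy ht.1 ha.1)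
  have hbd : ∀ t ∈ Icc 0 T, -2 * w.eJ ω t (β + 2 * (T - t)) +
      (∫ a in α..β + 2 * (T - t), (w.eFa ω ω' t a + w.eS ω t a)) ≤
      4 * κ t * ((∫ a in α..β + 2 * (T - t), w.eJ ω t a) + c ^ 2) := fun t ht => by
    have i1 := hcont cFa t ht
    have i2 := hcont cS t ht
    have i3 := hcont cJ t ht
    rw [intervalIntegral.integral_add i1 i2, intervalIntegral.integral_eq_sub_of_hasDerivAt
      (f := fun a => w.eF ω t a) (fun a ha => (w.energy_deriv hR hω (hDy ht.1 (by
        rw [uIcc_of_le (hend t ht).le] at ha; exact ha.1))).1) i1]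
    have hb1 : w.eF ω t (β + 2 * (T - t)) ≤ 2 * w.eJ ω t (β + 2 * (T - t)) := by
      have hr : R < β + 2 * (T - t) + t := by linarith [hend t ht, ht.1]
      have := h0 _ hr
      have hr0 : 0 < β + 2 * (T - t) + t := hR.trans hr
      rw [eF, eJ, mul_left_comm 2 (_ ^ 5)]
      refine mul_le_mul_of_nonneg_left ?_ (by positivity)
      rw [en]
      have h3 : 0 ≤ ω (β + 2 * (T - t) + t) * w.u t (β + 2 * (T - t) + t) ^ 2 := by positivity
      nlinarith [sq_nonneg (w.ut t (β + 2 * (T - t) + t) - w.ur t (β + 2 * (T - t) + t))]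
    have hb2 : 0 ≤ w.eF ω t α := by
      have hr : R < α + t := by linarith [ht.1]
      have := h0 _ hr
      have hr0 : 0 < α + t := hR.trans hr
      rw [eF]
      refine mul_nonneg (by positivity) ?_
      rw [en]
      have h3 : 0 ≤ ω (α + t) * w.u t (α + t) ^ 2 := by positivity
      nlinarith [sq_nonneg (w.ut t (α + t) + w.ur t (α + t))]
    have c8 : ContinuousOn (fun a => (a + t) ^ 5 * (t ^ 2 * ((a + t) ^ 8)⁻¹))
        (Icc α (β + 2 * (T - t))) := by
      refine ContinuousOn.mul (by fun_prop)
        (continuousOn_const.mul (ContinuousOn.inv₀ (by fun_prop) fun r hr => ?_))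
      have : 0 < r + t := by linarith [hr.1, ht.1]
      positivity
    have i8 : IntervalIntegrable (fun a => (a + t) ^ 5 * (t ^ 2 * ((a + t) ^ 8)⁻¹)) volume α
        (β + 2 * (T - t)) := c8.intervalIntegrable_of_Icc (hend t ht).le
    have h8 : (∫ a in α..β + 2 * (T - t), (a + t) ^ 5 * (t ^ 2 * ((a + t) ^ 8)⁻¹)) ≤ 1 / 2 := by
      rw [intervalIntegral.integral_comp_add_right (f := fun r => r ^ 5 * (t ^ 2 * (r ^ 8)⁻¹))]
      exact pow8_integral (by linarith [ht.1]) (by linarith [hend t ht]) ht.1 (by linarith)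
    have hS' : (∫ a in α..β + 2 * (T - t), w.eS ω t a) ≤ ∫ a in α..β + 2 * (T - t),
        (4 * κ t * w.eJ ω t a + 2 * c ^ 2 * κ t * ((a + t) ^ 5 * (t ^ 2 * ((a + t) ^ 8)⁻¹))) := by
      refine intervalIntegral.integral_mono_on (hend t ht).le i2
        ((i3.const_mul _).add (i8.const_mul _)) fun a ha => ?_
      have hr : R + t < a + t := by linarith [ha.1]
      have hr0 : 0 < a + t := by linarith [ht.1]
      have := mul_le_mul_of_nonneg_left (hS t ht _ hr) (by positivity : 0 ≤ (a + t) ^ 5)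
      rw [eS, eJ]
      linarith
    rw [intervalIntegral.integral_add (i3.const_mul _) (i8.const_mul _),
      intervalIntegral.integral_const_mul, intervalIntegral.integral_const_mul] at hS'
    have hc := mul_le_mul_of_nonneg_left h8
      (mul_nonneg (by positivity : 0 ≤ 2 * c ^ 2) (hκ t ht))
    have hc2 := mul_nonneg (sq_nonneg c) (hκ t ht)
    linarith
  have hg := gronwall_le hT hF hH hbd
  simp only [sub_self, mul_zero, add_zero, sub_zero] at hg
  have e1 : (∫ r in (α + T)..(β + T), r ^ 5 * w.en ω T r) = ∫ a in α..β, w.eJ ω T a := by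
    rw [← intervalIntegral.integral_comp_add_right (f := fun r => r ^ 5 * w.en ω T r)]
    rfl
  have e2 : (∫ a in α..β + 2 * T, w.eJ ω 0 a) ≤ E := by
    refine le_trans ?_ hE
    simp only [eJ, add_zero]
    refine interval_le_Ioi hi (fun r hr => ?_) hα.le (by linarith)
    have := hen 0 r hr
    have : 0 < r := hR.trans hr
    positivity
  rw [e1]
  have := mul_le_mul_of_nonneg_left (add_le_add_left e2 (c ^ 2)) (exp_pos (4 * (H T - H 0))).le
  linarith [sq_nonneg c]

end Wv

/-- The decay profile `(1 + t²/24)⁻¹`. -/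
def kk (t : ℝ) : ℝ := (1 + t ^ 2 / 24)⁻¹

/-- The attractive potential `2W`. -/
def vv (r : ℝ) : ℝ := 2 * kk r ^ 2

/-- The primitive of the decay profile. -/
def kH (t : ℝ) : ℝ := √24 * arctan (t / √24)

lemma kk_pos (t : ℝ) : 0 < kk t := by unfold kk; positivity

lemma kk_le_one (t : ℝ) : kk t ≤ 1 := by
  unfold kk; exact inv_le_one_of_one_le₀ (by nlinarith [sq_nonneg t])

lemma kk_anti {s t : ℝ} (hs : 0 ≤ s) (h : s ≤ t) : kk t ≤ kk s := by
  unfold kk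
  gcongr

lemma vv_nonneg (r : ℝ) : 0 ≤ vv r := by unfold vv; positivity

lemma vv_mul_le (r : ℝ) : vv r * r ≤ 5 * kk r := by
  have h : r * kk r ≤ 5 / 2 := by
    rw [kk, ← div_eq_mul_inv, div_le_iff₀ (by positivity)]
    nlinarith [sq_nonneg (r - 5)]
  have := mul_le_mul_of_nonneg_right h (kk_pos r).le
  rw [vv]; nlinarith

lemma kk_deriv (t : ℝ) : HasDerivAt kk (-(t / 12) * kk t ^ 2) t := by
  have h : HasDerivAt (fun t : ℝ => 1 + t ^ 2 / 24) (t / 12) t := by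
    refine (((hasDerivAt_pow 2 t).div_const 24).const_add 1).congr_deriv ?_
    norm_num; ring
  refine (h.inv (by positivity)).congr_deriv ?_
  rw [kk]; field_simp

lemma vv_deriv (t : ℝ) : HasDerivAt vv (-(t / 3) * kk t ^ 3) t := by
  refine (((kk_deriv t).pow 2).const_mul 2).congr_deriv ?_
  push_cast; ring

lemma kk_continuous : Continuous kk :=
  continuous_iff_continuousAt.2 fun t => (kk_deriv t).continuousAt

lemma kH_deriv (t : ℝ) : HasDerivAt kH (kk t) t := by
  have h24 : (√24 : ℝ) ^ 2 = 24 := Real.sq_sqrt (by norm_num)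
  have h0 : 0 < √(24 : ℝ) := by positivity
  refine ((((hasDerivAt_id t).div_const √24).arctan).const_mul √24).congr_deriv ?_
  simp only [id, div_pow, h24, kk]
  field_simp

lemma kH_le {s t : ℝ} (hs : 0 ≤ s) : kH t - kH s ≤ 8 := by
  have h1 : √(24 : ℝ) ≤ 5 := Real.sqrt_le_iff.2 ⟨by norm_num, by norm_num⟩
  have h2 := (arctan_lt_pi_div_two (t / √24)).le
  have h3 := pi_lt_d2
  have h4 : 0 ≤ arctan (s / √24) := arctan_nonneg.2 (by positivity)
  have h5 : arctan (t / √24) - arctan (s / √24) ≤ 1.6 := by linarith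
  rw [kH, kH, ← mul_sub]
  nlinarith [Real.sqrt_nonneg 24]

lemma L2_of_density {ρ : ℝ} (hρ : 0 ≤ ρ) {f e : ℝ → ℝ} (hf : ContinuousOn f (Ioi ρ))
    (he : IntegrableOn (fun r => r ^ 5 * e r) (Ioi ρ)) (h : ∀ r, ρ < r → f r ^ 2 ≤ e r) {C : ℝ}
    (hC : (∫ r in Ioi ρ, r ^ 5 * e r) ≤ C ^ 2) (hC0 : 0 ≤ C) : L2 ρ f ∧ nrm ρ f ≤ C := by
  have hb : ∀ r ∈ Ioi ρ, f r ^ 2 * r ^ 5 ≤ r ^ 5 * e r := fun r hr => by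
    have : 0 < r := lt_of_le_of_lt hρ hr
    rw [mul_comm]
    exact mul_le_mul_of_nonneg_left (h r hr) (by positivity)
  have hi : IntegrableOn (fun r => f r ^ 2 * r ^ 5) (Ioi ρ) := by
    refine Integrable.mono' he (((hf.pow 2).mul
      (continuous_pow 5).continuousOn).aestronglyMeasurable measurableSet_Ioi) ?_
    refine (ae_restrict_iff' measurableSet_Ioi).2 (Eventually.of_forall fun r hr => ?_)
    have : 0 < r := lt_of_le_of_lt hρ hr
    rw [Real.norm_eq_abs, abs_of_nonneg (by positivity)]
    exact hb r hr
  exact ⟨⟨hf.aestronglyMeasurable measurableSet_Ioi, hi⟩, nrm_le_of_sq hC0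
    ((setIntegral_mono_on hi he measurableSet_Ioi hb).trans hC)⟩

/-- The constant in the exterior energy estimate. -/
def CE : ℝ := exp 32

lemma CE_pos : 0 < CE := exp_pos _

/-- Odd-in-time solutions with finite energy of the linearized equation with source `c t r⁻⁴`. -/
structure IsSol {R : ℝ} (w : Wv R) (c : ℝ) : Prop where
  odd : ∀ r, R < r → w.u 0 r = 0
  eq : ∀ t r, R + |t| < r → w.P t r = vv r * (w.u t r + c * (t * iv r))
  fin : L2 R (w.ut 0)

namespace IsSol
variable {R c : ℝ} {w : Wv R} (h : IsSol w c)
include h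

lemma ur_zero {r : ℝ} (hr : R < r) : w.ur 0 r = 0 := by
  have h1 := (w.hu 0 r (by rw [abs_zero]; linarith)).dr
  have h2 : HasDerivAt (fun s => w.u 0 s) 0 r :=
    (hasDerivAt_const r (0 : ℝ)).congr_of_eventuallyEq
      (by filter_upwards [Ioi_mem_nhds hr] with s hs using h.odd s hs)
  exact h1.unique h2

lemma en_zero (ω : ℝ → ℝ) {r : ℝ} (hr : R < r) : w.en ω 0 r = w.ut 0 r ^ 2 := by
  rw [Wv.en, h.ur_zero hr, h.odd r hr]; ring

lemma restrict {ρ : ℝ} (hρ : R ≤ ρ) : IsSol (w.restrict hρ) c :=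
  ⟨fun r hr => h.odd r (by linarith), fun t r hr => h.eq t r (by linarith), h.fin.mono hρ⟩

lemma initial (ω : ℝ → ℝ) (hR : 0 < R) : IntegrableOn (fun r => r ^ 5 * w.en ω 0 r) (Ioi R) ∧
    (∫ r in Ioi R, r ^ 5 * w.en ω 0 r) = nrm R (w.ut 0) ^ 2 := by
  have e : EqOn (fun r => w.ut 0 r ^ 2 * r ^ 5) (fun r => r ^ 5 * w.en ω 0 r) (Ioi R) :=
    fun r hr => by simp only [h.en_zero ω hr]; ring
  rw [nrm_sq hR.le, setIntegral_congr_fun measurableSet_Ioi e]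
  exact ⟨h.fin.2.congr_fun e measurableSet_Ioi, rfl⟩

lemma energy (hR : 0 < R) {T : ℝ} (hT : 0 ≤ T) :
    L2 (R + T) (w.u T) ∧ L2 (R + T) (w.ut T) ∧ L2 (R + T) (w.ur T) ∧
      nrm (R + T) (w.ut T) ≤ CE * (nrm R (w.ut 0) + |c|) ∧
      nrm (R + T) (w.ur T) ≤ CE * (nrm R (w.ut 0) + |c|) := by
  have hρ : 0 ≤ R + T := by linarith
  have e1 := Wv.slice_continuousOn w.cu T
  have e2 := Wv.slice_continuousOn w.cut T
  have e3 := Wv.slice_continuousOn w.cur T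
  rw [abs_of_nonneg hT] at e1 e2 e3
  have hN := nrm_nonneg R (w.ut 0)
  have hsq : ∀ {r : ℝ}, 0 < r → iv r ^ 2 = (r ^ 8)⁻¹ := fun hr => by
    rw [iv, inv_pow, ← pow_mul]
  -- square integrability of `u`
  have A : L2 (R + T) (w.u T) := by
    obtain ⟨i1, i2⟩ := h.initial (fun _ => 1) hR
    obtain ⟨j1, j2⟩ := w.energy_estimate (ω := fun _ => 1) (ω' := fun _ => 0) hR
      (fun r _ => hasDerivAt_const r 1) continuousOn_const (fun _ _ => zero_le_one) (c := c) hT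
      (H := fun t => 2 * t) (κ := fun _ => 2)
      (fun t _ => ((hasDerivAt_id t).const_mul 2).congr_deriv (by norm_num))
      (fun _ _ => by norm_num) (fun t ht r hr => by
        have hr0 : 0 < r := by linarith [ht.1]
        rw [h.eq t r (by rwa [abs_of_nonneg ht.1]), ← hsq hr0, Wv.en, vv]
        have k0 := kk_pos r
        have k1 := kk_le_one r
        have k2 : kk r ^ 2 ≤ 1 := pow_le_one₀ k0.le k1
        obtain ⟨x, hx⟩ : ∃ x, x = w.ut t r := ⟨_, rfl⟩
        obtain ⟨y, hy⟩ : ∃ y, y = w.u t r := ⟨_, rfl⟩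
        obtain ⟨z, hz⟩ : ∃ z, z = c * (t * iv r) := ⟨_, rfl⟩
        have ez : 2 * c ^ 2 * (t ^ 2 * iv r ^ 2) = 2 * z ^ 2 := by rw [hz]; ring
        rw [ez, ← hx, ← hy, ← hz]
        have s1 : 2 * x * (y + z) ≤ 2 * x ^ 2 + y ^ 2 + z ^ 2 := by
          nlinarith [sq_nonneg (x - y), sq_nonneg (x - z)]
        have s2 : 2 * kk r ^ 2 * (2 * x * (y + z)) ≤ 2 * (2 * x ^ 2 + y ^ 2 + z ^ 2) := by
          have := mul_le_mul_of_nonneg_left s1 (by positivity : 0 ≤ 2 * kk r ^ 2)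
          have := mul_le_mul_of_nonneg_right k2 (by positivity : 0 ≤ 2 * x ^ 2 + y ^ 2 + z ^ 2)
          linarith
        nlinarith [sq_nonneg (x - y), sq_nonneg (w.ur t r), sq_nonneg z, sq_nonneg x,
          sq_nonneg y]) i1 i2.le
    refine (L2_of_density hρ e1 j1 (fun r hr => ?_) (C := √(∫ r in Ioi (R + T),
      r ^ 5 * w.en (fun _ => 1) T r)) (Real.sq_sqrt ?_).ge (Real.sqrt_nonneg _)).1
    swap
    · refine setIntegral_nonneg measurableSet_Ioi fun r hr => ?_
      have : 0 < r := lt_of_le_of_lt hρ hr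
      unfold Wv.en; positivity
    rw [Wv.en]; nlinarith [sq_nonneg (w.ut T r), sq_nonneg (w.ur T r)]
  obtain ⟨i1, i2⟩ := h.initial vv hR
  obtain ⟨j1, j2⟩ := w.energy_estimate (ω := vv) (ω' := fun t => -(t / 3) * kk t ^ 3) hR
    (fun r _ => vv_deriv r)
    ((continuous_id.div_const 3).neg.mul (kk_continuous.pow 3)).continuousOn
    (fun r _ => vv_nonneg r) (c := c) hT (H := fun t => 2 * kH t) (κ := fun t => 2 * kk t)
    (fun t _ => (kH_deriv t).const_mul 2) (fun t _ => by have := kk_pos t; positivity)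
    (fun t ht r hr => by
      have hr0 : 0 < r := by linarith [ht.1]
      rw [h.eq t r (by rwa [abs_of_nonneg ht.1]), ← hsq hr0, Wv.en, vv]
      have k0 := kk_pos r
      have k1 := kk_le_one r
      have k2 : kk r ≤ kk t := kk_anti ht.1 (by linarith)
      obtain ⟨x, hx⟩ : ∃ x, x = w.ut t r := ⟨_, rfl⟩
      obtain ⟨y, hy⟩ : ∃ y, y = w.u t r := ⟨_, rfl⟩
      obtain ⟨z, hz⟩ : ∃ z, z = c * (t * iv r) := ⟨_, rfl⟩
      obtain ⟨k, hk⟩ : ∃ k, k = kk r := ⟨_, rfl⟩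
      have ez : 2 * c ^ 2 * (t ^ 2 * iv r ^ 2) = 2 * z ^ 2 := by rw [hz]; ring
      rw [ez, ← hx, ← hy, ← hz]
      rw [← hk] at k0 k1 k2 ⊢
      have s1 : 2 * x * (k * y) ≤ x ^ 2 + k ^ 2 * y ^ 2 := by nlinarith [sq_nonneg (x - k * y)]
      have s2 : k * (2 * x * z) ≤ x ^ 2 + z ^ 2 := by
        have : 2 * x * z ≤ x ^ 2 + z ^ 2 := by nlinarith [sq_nonneg (x - z)]
        have := mul_le_mul_of_nonneg_left this k0.le
        have := mul_le_mul_of_nonneg_right k1 (by positivity : 0 ≤ x ^ 2 + z ^ 2)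
        linarith
      have s3 : 2 * x * (2 * k ^ 2 * (y + z)) + 2 * (2 * k ^ 2) * y * x ≤
          2 * k * (4 * (x ^ 2 + w.ur t r ^ 2 + 2 * k ^ 2 * y ^ 2) + 2 * z ^ 2) := by
        have e : 2 * x * (2 * k ^ 2 * (y + z)) + 2 * (2 * k ^ 2) * y * x =
          2 * k * (2 * (2 * x * (k * y)) + k * (2 * x * z)) := by ring
        rw [e]
        refine mul_le_mul_of_nonneg_left ?_ (by positivity)
        nlinarith [sq_nonneg (w.ur t r), sq_nonneg z, sq_nonneg x, sq_nonneg (k * y)]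
      refine s3.trans (mul_le_mul_of_nonneg_right (by linarith) (by positivity))) i1 i2.le
  have hexp : exp (4 * (2 * kH T - 2 * kH 0)) ≤ CE ^ 2 := by
    rw [CE, ← exp_nat_mul]
    refine exp_le_exp.2 ?_
    have := kH_le (s := 0) (t := T) le_rfl
    push_cast; linarith
  have hfin : (∫ r in Ioi (R + T), r ^ 5 * w.en vv T r) ≤ (CE * (nrm R (w.ut 0) + |c|)) ^ 2 := by
    refine j2.trans ?_
    rw [mul_pow]
    refine mul_le_mul hexp ?_ (by positivity) (by positivity)
    nlinarith [abs_nonneg c, sq_abs c]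
  have hC0 : 0 ≤ CE * (nrm R (w.ut 0) + |c|) := mul_nonneg CE_pos.le (by positivity)
  obtain ⟨B1, B2⟩ := L2_of_density hρ e2 j1 (fun r hr => by
    rw [Wv.en]
    have := mul_nonneg (vv_nonneg r) (sq_nonneg (w.u T r))
    nlinarith [sq_nonneg (w.ur T r)]) hfin hC0
  obtain ⟨C1, C2⟩ := L2_of_density hρ e3 j1 (fun r hr => by
    rw [Wv.en]
    have := mul_nonneg (vv_nonneg r) (sq_nonneg (w.u T r))
    nlinarith [sq_nonneg (w.ut T r)]) hfin hC0
  exact ⟨A, B1, C1, B2, C2⟩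

end IsSol

lemma vv_anti {s t : ℝ} (hs : 0 ≤ s) (h : s ≤ t) : vv t ≤ vv s := by
  unfold vv
  have := pow_le_pow_left₀ (kk_pos t).le (kk_anti hs h) 2
  linarith

lemma vv_sq_mul_le {ρ t : ℝ} (hρ : 0 ≤ ρ) (ht : 0 ≤ t) :
    vv t ^ 2 * (ρ + t) ≤ 16 * (1 + ρ) * kk t ^ 2 := by
  have h0 := kk_pos t
  have h1 : kk t ^ 2 * (1 + t) ≤ 4 := by
    rw [kk, inv_pow, inv_mul_le_iff₀ (by positivity)]
    nlinarith [sq_nonneg (t - 1), sq_nonneg (t ^ 2), sq_nonneg (t - 3)]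
  have h2 : ρ + t ≤ (1 + ρ) * (1 + t) := by nlinarith [mul_nonneg hρ ht]
  have h3 : kk t ^ 2 * (ρ + t) ≤ 4 * (1 + ρ) := by
    calc kk t ^ 2 * (ρ + t) ≤ kk t ^ 2 * ((1 + ρ) * (1 + t)) := by gcongr
      _ = (1 + ρ) * (kk t ^ 2 * (1 + t)) := by ring
      _ ≤ (1 + ρ) * 4 := by gcongr
      _ = _ := by ring
  calc vv t ^ 2 * (ρ + t) = 4 * kk t ^ 2 * (kk t ^ 2 * (ρ + t)) := by rw [vv]; ring
    _ ≤ 4 * kk t ^ 2 * (4 * (1 + ρ)) := by gcongr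
    _ = _ := by ring

lemma vv_continuous : Continuous vv := (kk_continuous.pow 2).const_mul 2

lemma L2.of_abs_le {ρ : ℝ} (hρ : 0 ≤ ρ) {f g : ℝ → ℝ} (hg : L2 ρ g)
    (hf : ContinuousOn f (Ioi ρ)) {K : ℝ} (hK : 0 ≤ K) (h : ∀ r, ρ < r → |f r| ≤ K * |g r|) :
    L2 ρ f ∧ nrm ρ f ≤ K * nrm ρ g := by
  have hb : ∀ r ∈ Ioi ρ, f r ^ 2 * r ^ 5 ≤ K ^ 2 * (g r ^ 2 * r ^ 5) := fun r hr => by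
    have : 0 < r := lt_of_le_of_lt hρ hr
    have h1 := pow_le_pow_left₀ (abs_nonneg _) (h r hr) 2
    rw [mul_pow, sq_abs, sq_abs] at h1
    nlinarith [pow_pos this 5, mul_le_mul_of_nonneg_right h1 (pow_pos this 5).le]
  have hi : IntegrableOn (fun r => f r ^ 2 * r ^ 5) (Ioi ρ) := by
    refine Integrable.mono' (hg.2.const_mul (K ^ 2)) (((hf.pow 2).mul
      (continuous_pow 5).continuousOn).aestronglyMeasurable measurableSet_Ioi) ?_
    refine (ae_restrict_iff' measurableSet_Ioi).2 (Eventually.of_forall fun r hr => ?_)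
    have : 0 < r := lt_of_le_of_lt hρ hr
    rw [Real.norm_eq_abs, abs_of_nonneg (by positivity)]
    exact hb r hr
  refine ⟨⟨hf.aestronglyMeasurable measurableSet_Ioi, hi⟩,
    nrm_le_of_sq (mul_nonneg hK (nrm_nonneg _ _)) ?_⟩
  rw [mul_pow, nrm_sq hρ, ← integral_const_mul]
  exact setIntegral_mono_on hi (hg.2.const_mul _) measurableSet_Ioi hb

lemma vv_mul_tail {ρ : ℝ} (hρ : 0 < ρ) {f f' : ℝ → ℝ} (hd : ∀ r, ρ < r → HasDerivAt f (f' r) r)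
    (hc : ContinuousOn f' (Ioi ρ)) (hf : L2 ρ f) (hf' : L2 ρ f') :
    L2 ρ (fun r => vv r * f r) ∧ nrm ρ (fun r => vv r * f r) ≤ 5 / 2 * kk ρ * nrm ρ f' := by
  obtain ⟨h1, h2⟩ := hardy_exterior hρ hd hc hf hf'
  have hk := (kk_pos ρ).le
  obtain ⟨h3, h4⟩ := L2.of_abs_le hρ.le h1 (f := fun r => vv r * f r) (K := 5 * kk ρ)
    (vv_continuous.continuousOn.mul fun r hr => (hd r hr).continuousAt.continuousWithinAt)
    (by positivity) (fun r hr => by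
      have hr0 : 0 < r := hρ.trans hr
      have e : vv r * f r = vv r * r * (f r / r) := by field_simp
      rw [e, abs_mul, abs_of_nonneg (mul_nonneg (vv_nonneg r) hr0.le)]
      have := vv_mul_le r
      have := kk_anti hρ.le hr.le
      exact mul_le_mul_of_nonneg_right (by linarith) (abs_nonneg _))
  refine ⟨h3, h4.trans ?_⟩
  have := mul_le_mul_of_nonneg_left h2 (by positivity : 0 ≤ 5 * kk ρ)
  linarith

lemma radial_increment_le {ρ : ℝ} (hρ : 0 < ρ) {f f' : ℝ → ℝ}
    (hd : ∀ r, ρ < r → HasDerivAt f (f' r) r)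
    (hc : ContinuousOn f' (Ioi ρ)) (hf' : L2 ρ f') {r n : ℝ} (hr : ρ < r) (hn : r ≤ n) :
    (f n - f r) ^ 2 ≤ nrm ρ f' ^ 2 * (4 * r ^ 4)⁻¹ := by
  have hr0 : 0 < r := hρ.trans hr
  have hs : ∀ s ∈ Icc r n, 0 < s := fun s hs => hr0.trans_le hs.1
  have hcI : ContinuousOn f' (Icc r n) := hc.mono fun s hs => hr.trans_le hs.1
  have c2 : ContinuousOn (fun s : ℝ => s ^ 2 * √s) (Icc r n) := by fun_prop
  have c3 : ContinuousOn (fun s : ℝ => (s ^ 2 * √s)⁻¹) (Icc r n) :=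
    c2.inv₀ fun s h => by have := hs s h; positivity
  have e1 : f n - f r = ∫ s in r..n, f' s := by
    refine (intervalIntegral.integral_eq_sub_of_hasDerivAt (fun s h => ?_)
      (hcI.intervalIntegrable_of_Icc hn)).symm
    rw [uIcc_of_le hn] at h
    exact hd s (hr.trans_le h.1)
  have e2 : (∫ s in r..n, f' s) = ∫ s in r..n, (f' s * (s ^ 2 * √s)) * (s ^ 2 * √s)⁻¹ := by
    refine intervalIntegral.integral_congr fun s h => ?_
    rw [uIcc_of_le hn] at h
    have := hs s h
    field_simp
  have h1 := cs_interval hn (hcI.mul c2) c3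
  have h2 : (∫ s in r..n, (f' s * (s ^ 2 * √s)) ^ 2) ≤ nrm ρ f' ^ 2 := by
    have e : (∫ s in r..n, (f' s * (s ^ 2 * √s)) ^ 2) = ∫ s in r..n, f' s ^ 2 * s ^ 5 := by
      refine intervalIntegral.integral_congr fun s h => ?_
      rw [uIcc_of_le hn] at h
      have := Real.sq_sqrt (hs s h).le
      rw [mul_pow, mul_pow, this]; ring
    rw [e, nrm_sq hρ.le]
    exact interval_le_Ioi hf'.2 (fun s hs => by
      have : 0 < s := hρ.trans hs
      positivity) hr.le hn
  have h3 : (∫ s in r..n, ((s ^ 2 * √s)⁻¹) ^ 2) ≤ (4 * r ^ 4)⁻¹ := by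
    have e : (∫ s in r..n, ((s ^ 2 * √s)⁻¹) ^ 2) = ∫ s in r..n, (s ^ 5)⁻¹ := by
      refine intervalIntegral.integral_congr fun s h => ?_
      rw [uIcc_of_le hn] at h
      have := Real.sq_sqrt (hs s h).le
      rw [inv_pow, mul_pow, this]; congr 1; ring
    have e' : (∫ s in r..n, (s ^ 5)⁻¹) = -(4 * n ^ 4)⁻¹ - -(4 * r ^ 4)⁻¹ := by
      refine intervalIntegral.integral_eq_sub_of_hasDerivAt
        (f := fun s : ℝ => -(4 * s ^ 4)⁻¹) (fun s h => ?_) ?_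
      · rw [uIcc_of_le hn] at h
        have := hs s h
        refine ((((hasDerivAt_pow 4 s).const_mul 4).inv (by positivity)).neg).congr_deriv ?_
        push_cast
        field_simp
      · exact ((continuous_pow 5).continuousOn.inv₀ fun s h => by
          have := hs s h; positivity).intervalIntegrable_of_Icc hn
    rw [e, e']
    have : 0 ≤ (4 * n ^ 4)⁻¹ := by positivity
    linarith
  rw [e1, e2]
  have h4 : 0 ≤ ∫ s in r..n, (f' s * (s ^ 2 * √s)) ^ 2 :=
    intervalIntegral.integral_nonneg hn fun s _ => sq_nonneg _
  have h5 : 0 ≤ ∫ s in r..n, ((s ^ 2 * √s)⁻¹) ^ 2 :=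
    intervalIntegral.integral_nonneg hn fun s _ => sq_nonneg _
  rw [← sq_abs]
  calc _ ≤ (√(∫ s in r..n, (f' s * (s ^ 2 * √s)) ^ 2) *
        √(∫ s in r..n, ((s ^ 2 * √s)⁻¹) ^ 2)) ^ 2 := pow_le_pow_left₀ (abs_nonneg _) h1 2
    _ = (∫ s in r..n, (f' s * (s ^ 2 * √s)) ^ 2) * ∫ s in r..n, ((s ^ 2 * √s)⁻¹) ^ 2 := by
      rw [mul_pow, Real.sq_sqrt h4, Real.sq_sqrt h5]
    _ ≤ _ := mul_le_mul h2 h3 h5 (sq_nonneg _)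

lemma radial_pointwise {ρ : ℝ} (hρ : 0 < ρ) {f f' : ℝ → ℝ}
    (hd : ∀ r, ρ < r → HasDerivAt f (f' r) r)
    (hc : ContinuousOn f' (Ioi ρ)) (hf : L2 ρ f) (hf' : L2 ρ f') {r : ℝ} (hr : ρ < r) :
    4 * (r ^ 4 * f r ^ 2) ≤ nrm ρ f' ^ 2 := by
  have hr0 : 0 < r := hρ.trans hr
  have key : ∀ n, r ≤ n → (f n - f r) ^ 2 ≤ nrm ρ f' ^ 2 * (4 * r ^ 4)⁻¹ := fun n hn =>
    radial_increment_le hρ hd hc hf' hr hn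
  have hK : 0 ≤ nrm ρ f' ^ 2 * (4 * r ^ 4)⁻¹ := by positivity
  have hfin : |f r| ≤ √(nrm ρ f' ^ 2 * (4 * r ^ 4)⁻¹) := by
    refine le_of_forall_pos_le_add fun η hη => ?_
    obtain ⟨n, hn1, hn2, hn3⟩ := frequently_small hf.2 (η := η ^ 2) (by positivity) (max r 1)
    have a1 : 1 ≤ n := (le_max_right _ _).trans hn1
    have a2 : r ≤ n := (le_max_left _ _).trans hn1
    have a3 : |f n| ≤ η := by
      refine abs_le_of_sq_le_sq ?_ hη.le
      have : f n ^ 2 * 1 ≤ f n ^ 2 * (n ^ 5 * n) := by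
        refine mul_le_mul_of_nonneg_left ?_ (sq_nonneg _)
        rw [← pow_succ]; exact one_le_pow₀ a1
      nlinarith
    have a4 : |f n - f r| ≤ √(nrm ρ f' ^ 2 * (4 * r ^ 4)⁻¹) := Real.abs_le_sqrt (key n a2)
    have := abs_sub_abs_le_abs_sub (f r) (f n)
    rw [abs_sub_comm] at this
    linarith
  have h6 := pow_le_pow_left₀ (abs_nonneg _) hfin 2
  rw [sq_abs, Real.sq_sqrt hK] at h6
  have h7 := mul_le_mul_of_nonneg_left h6 (by positivity : 0 ≤ 4 * r ^ 4)
  calc 4 * (r ^ 4 * f r ^ 2) = 4 * r ^ 4 * f r ^ 2 := by ring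
    _ ≤ _ := h7
    _ = _ := by field_simp

lemma nrm_split {ρ ρ' A : ℝ} (hρ : 0 ≤ ρ') (h : ρ' ≤ ρ) {f : ℝ → ℝ} (hf : L2 ρ' f)
    (hA : 0 ≤ A) (hs : (∫ r in ρ'..ρ, f r ^ 2 * r ^ 5) ≤ A ^ 2) : nrm ρ' f ≤ nrm ρ f + A := by
  refine nrm_le_of_sq (add_nonneg (nrm_nonneg _ _) hA) ?_
  have h1 := intervalIntegral.integral_interval_add_Ioi
    (hf.2 : IntegrableOn (fun r => f r ^ 2 * r ^ 5) (Ioi ρ'))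
    (hf.mono h).2
  rw [← h1, ← nrm_sq (hρ.trans h)]
  nlinarith [nrm_nonneg ρ f, mul_nonneg (nrm_nonneg ρ f) hA]

/-- The harmonic function `r⁻⁴` and its derivatives. -/
lemma iv_derivs {r : ℝ} (hr : 0 < r) : HasDerivAt iv (-4 * (r ^ 5)⁻¹) r ∧
    HasDerivAt (fun r : ℝ => -4 * (r ^ 5)⁻¹) (20 * (r ^ 6)⁻¹) r := by
  constructor
  · refine ((hasDerivAt_pow 4 r).inv (by positivity)).congr_deriv ?_
    push_cast
    field_simp
  · refine (((hasDerivAt_pow 5 r).inv (by positivity)).const_mul (-4)).congr_deriv ?_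
    push_cast
    field_simp
    norm_num

/-- Subtracting `c t r⁻⁴` from a wave. -/
def Wv.subIv {R : ℝ} (hR : 0 ≤ R) (w : Wv R) (c : ℝ) : Wv R :=
  w.addTime (-c) iv (fun r => -4 * (r ^ 5)⁻¹) (fun r => 20 * (r ^ 6)⁻¹)
    (fun _ hr => (iv_derivs (lt_of_le_of_lt hR hr)).1)
    (fun _ hr => (iv_derivs (lt_of_le_of_lt hR hr)).2)
    (continuousOn_const.mul ((continuous_pow 6).continuousOn.inv₀ fun r hr => by
      have : 0 < r := lt_of_le_of_lt hR hr
      positivity))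

lemma IsSol.subIv {R : ℝ} (hR : 0 < R) {w : Wv R} (h : IsSol w 0) (c : ℝ) :
    IsSol (w.subIv hR.le c) c where
  odd r hr := by
    show w.u 0 r + -c * (0 * iv r) = 0
    rw [h.odd r hr]; ring
  eq t r hr := by
    have hr0 : 0 < r := by linarith [abs_nonneg t]
    have := h.eq t r hr
    rw [Wv.P] at this ⊢
    show w.utt t r - (w.urr t r + -c * (t * (20 * (r ^ 6)⁻¹))) -
      5 * (w.ur t r + -c * (t * (-4 * (r ^ 5)⁻¹))) / r =
      vv r * (w.u t r + -c * (t * iv r) + c * (t * iv r))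
    have e : w.utt t r - (w.urr t r + -c * (t * (20 * (r ^ 6)⁻¹))) -
      5 * (w.ur t r + -c * (t * (-4 * (r ^ 5)⁻¹))) / r =
      w.utt t r - w.urr t r - 5 * w.ur t r / r := by field_simp; ring
    rw [e, this]; ring
  fin := h.fin.add hR.le ((iv_L2 hR).1.const_mul (-c))

/-- The part of the source near the boundary of the cone is controlled by the width of the
boundary layer. -/
lemma IsSol.source_le {ρ' ρ : ℝ} (hρ' : 0 < ρ') (hρ : ρ' ≤ ρ) {w : Wv ρ'} (h : IsSol w 0) (c : ℝ)
    {t : ℝ} (ht : 0 ≤ t) : L2 (ρ' + t) (w.P t) ∧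
    nrm (ρ' + t) (w.P t) ≤ (5 / 2 * CE * nrm ρ (w.ut 0) + 3 * √((1 + ρ) * (ρ - ρ')) *
      (CE * (nrm ρ' (fun r => w.ut 0 r - c * iv r) + |c|)) + 2 * |c|) * kk t := by
  obtain ⟨a1, -, a3, -, -⟩ := h.energy hρ' ht
  obtain ⟨b1, -, b3, -, b5⟩ := (h.restrict hρ).energy (hρ'.trans_le hρ) ht
  obtain ⟨d1, -, d3, -, d5⟩ := (h.subIv hρ' c).energy hρ' ht
  have hx : ∀ r, ρ' + t < r → ρ' + |t| < r := fun r hr => by rwa [abs_of_nonneg ht]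
  have cur := Wv.slice_continuousOn w.cur t
  have cdr := Wv.slice_continuousOn (w.subIv hρ'.le c).cur t
  have cu := Wv.slice_continuousOn w.cu t
  rw [abs_of_nonneg ht] at cur cdr cu
  have hEq : EqOn (fun r => vv r * w.u t r) (w.P t) (Ioi (ρ' + t)) := fun r hr => by
    rw [h.eq t r (hx r hr)]; ring
  have t1 := (vv_mul_tail (by linarith) (fun r hr => (w.hu t r (hx r hr)).dr) cur a1 a3).1
  have t2 := (vv_mul_tail (ρ := ρ + t) (by linarith)
    (fun r hr => (w.hu t r (hx r (by linarith))).dr)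
    (cur.mono (Ioi_subset_Ioi (by linarith))) b1 b3).2
  refine ⟨t1.congr hEq, ?_⟩
  rw [← nrm_congr hEq]
  set X := CE * (nrm ρ' (fun r => w.ut 0 r - c * iv r) + |c|) with hX
  have hX0 : 0 ≤ X := mul_nonneg CE_pos.le (add_nonneg (nrm_nonneg _ _) (abs_nonneg _))
  have d5' : nrm (ρ' + t) ((w.subIv hρ'.le c).ur t) ≤ X := by
    refine d5.trans (le_of_eq ?_)
    rw [hX]
    congr 3
    funext r
    show w.ut 0 r + -c * iv r = _
    ring
  have hk := kk_pos t
  set S := √((1 + ρ) * (ρ - ρ')) with hS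
  have hS0 : 0 ≤ S := Real.sqrt_nonneg _
  have hS2 : S ^ 2 = (1 + ρ) * (ρ - ρ') :=
    Real.sq_sqrt (mul_nonneg (by linarith) (by linarith))
  have hc0 := abs_nonneg c
  have main := nrm_split (A := (3 * S * X + 2 * |c|) * kk t) (by linarith : 0 ≤ ρ' + t)
    (by linarith : ρ' + t ≤ ρ + t) t1 (by positivity) (by
      have hab : ρ' + t ≤ ρ + t := by linarith
      have pos : ∀ r ∈ Icc (ρ' + t) (ρ + t), 0 < r := fun r hr => by linarith [hr.1]
      have bd : ∀ r ∈ Ioo (ρ' + t) (ρ + t), (vv r * w.u t r) ^ 2 * r ^ 5 ≤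
          vv t ^ 2 * (X ^ 2 / 2 * (ρ + t) + 2 * c ^ 2 * (r ^ 5 * (t ^ 2 * (r ^ 8)⁻¹))) := by
        intro r hr
        have hr0 : 0 < r := pos r ⟨hr.1.le, hr.2.le⟩
        have p1 := radial_pointwise (by linarith)
          (fun r hr => ((w.subIv hρ'.le c).hu t r (hx r hr)).dr) cdr d1 d3 hr.1
        have p2 := p1.trans (pow_le_pow_left₀ (nrm_nonneg _ _) d5' 2)
        obtain ⟨y, hy⟩ : ∃ y, y = (w.subIv hρ'.le c).u t r := ⟨_, rfl⟩
        have e : w.u t r = y + c * (t * iv r) := by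
          rw [hy]
          show _ = w.u t r + -c * (t * iv r) + c * (t * iv r)
          ring
        rw [← hy] at p2
        have v1 : vv r ^ 2 ≤ vv t ^ 2 :=
          pow_le_pow_left₀ (vv_nonneg r) (vv_anti ht (by linarith [hr.1])) 2
        have q1 : w.u t r ^ 2 * r ^ 5 ≤
            X ^ 2 / 2 * (ρ + t) + 2 * c ^ 2 * (r ^ 5 * (t ^ 2 * (r ^ 8)⁻¹)) := by
          have z1 : (y + c * (t * iv r)) ^ 2 ≤ 2 * y ^ 2 + 2 * (c * (t * iv r)) ^ 2 := by
            nlinarith [sq_nonneg (y - c * (t * iv r))]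
          have z2 := mul_le_mul_of_nonneg_right z1 (pow_pos hr0 5).le
          have z3 : 2 * y ^ 2 * r ^ 5 ≤ X ^ 2 / 2 * (ρ + t) := by
            have : 2 * y ^ 2 * r ^ 5 = (4 * (r ^ 4 * y ^ 2)) / 2 * r := by ring
            rw [this]
            exact mul_le_mul (by linarith) hr.2.le hr0.le (by positivity)
          have z4 : (c * (t * iv r)) ^ 2 = c ^ 2 * (t ^ 2 * (r ^ 8)⁻¹) := by
            rw [iv, mul_pow, mul_pow, inv_pow, ← pow_mul]
          rw [e]
          rw [z4] at z2
          linarith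
        calc (vv r * w.u t r) ^ 2 * r ^ 5 = vv r ^ 2 * (w.u t r ^ 2 * r ^ 5) := by ring
          _ ≤ vv t ^ 2 * (w.u t r ^ 2 * r ^ 5) := by gcongr
          _ ≤ _ := mul_le_mul_of_nonneg_left q1 (sq_nonneg _)
      have ii : IntervalIntegrable (fun r => r ^ 5 * (t ^ 2 * (r ^ 8)⁻¹)) volume
          (ρ' + t) (ρ + t) := ((continuous_pow 5).continuousOn.mul (continuousOn_const.mul
            ((continuous_pow 8).continuousOn.inv₀ fun r hr => by
              have := pos r hr
              positivity))).intervalIntegrable_of_Icc hab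
      have i0 : IntervalIntegrable (fun r => (vv r * w.u t r) ^ 2 * r ^ 5) volume
          (ρ' + t) (ρ + t) := by
        rw [intervalIntegrable_iff_integrableOn_Ioc_of_le hab]
        exact t1.2.mono_set Ioc_subset_Ioi_self
      have i1 := intervalIntegral.integral_mono_on_of_le_Ioo hab i0
        (((intervalIntegrable_const (c := X ^ 2 / 2 * (ρ + t))).add
          (ii.const_mul (2 * c ^ 2))).const_mul (vv t ^ 2)) bd
      refine i1.trans ?_
      rw [intervalIntegral.integral_const_mul, intervalIntegral.integral_add
        intervalIntegrable_const (ii.const_mul _), intervalIntegral.integral_const_mul (2 * c ^ 2),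
        intervalIntegral.integral_const]
      have p8 := pow8_integral (A := ρ' + t) (B := ρ + t) (t := t) (by linarith) hab ht
        (by linarith)
      obtain ⟨J, hJ⟩ : ∃ J, J = ∫ r in (ρ' + t)..(ρ + t), r ^ 5 * (t ^ 2 * (r ^ 8)⁻¹) := ⟨_, rfl⟩
      rw [← hJ] at p8 ⊢
      have v2 := vv_sq_mul_le (hρ'.le.trans hρ) ht
      have v3 : vv t ^ 2 ≤ 4 * kk t ^ 2 := by
        have := kk_le_one t
        have : kk t ^ 2 ≤ 1 := pow_le_one₀ hk.le this
        rw [vv]; nlinarith [sq_nonneg (kk t)]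
      have s1 : vv t ^ 2 * (2 * c ^ 2 * J) ≤ 4 * kk t ^ 2 * c ^ 2 := by
        have : 2 * c ^ 2 * J ≤ c ^ 2 := by nlinarith [sq_nonneg c]
        calc _ ≤ vv t ^ 2 * c ^ 2 := mul_le_mul_of_nonneg_left this (sq_nonneg _)
          _ ≤ _ := mul_le_mul_of_nonneg_right v3 (sq_nonneg _)
      have s2 : vv t ^ 2 * (ρ + t) * (X ^ 2 / 2 * (ρ - ρ')) ≤
          16 * (1 + ρ) * kk t ^ 2 * (X ^ 2 / 2 * (ρ - ρ')) :=
        mul_le_mul_of_nonneg_right v2 (mul_nonneg (by positivity) (by linarith))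
      have s3 : vv t ^ 2 * ((ρ + t - (ρ' + t)) • (X ^ 2 / 2 * (ρ + t)) + 2 * c ^ 2 * J) =
          vv t ^ 2 * (ρ + t) * (X ^ 2 / 2 * (ρ - ρ')) + vv t ^ 2 * (2 * c ^ 2 * J) := by
        rw [smul_eq_mul]; ring
      rw [s3]
      have s4 : 16 * (1 + ρ) * kk t ^ 2 * (X ^ 2 / 2 * (ρ - ρ')) = 8 * S ^ 2 * X ^ 2 * kk t ^ 2 := by
        rw [hS2]; ring
      have s5 : ((3 * S * X + 2 * |c|) * kk t) ^ 2 =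
          9 * S ^ 2 * X ^ 2 * kk t ^ 2 + 12 * (S * X * |c|) * kk t ^ 2 +
            4 * kk t ^ 2 * c ^ 2 := by
        rw [← sq_abs c]; ring
      rw [s5]
      have s6 : 0 ≤ S ^ 2 * X ^ 2 * kk t ^ 2 := by positivity
      have s7 : 0 ≤ S * X * |c| * kk t ^ 2 := by positivity
      linarith)
  refine main.trans ?_
  have k1 : kk (ρ + t) ≤ kk t := kk_anti ht (by linarith)
  have b5' : nrm (ρ + t) (w.ur t) ≤ CE * nrm ρ (w.ut 0) := by
    have := b5
    rw [abs_zero, add_zero] at this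
    exact this
  have hN := nrm_nonneg (ρ + t) (w.ur t)
  have : 5 / 2 * kk (ρ + t) * nrm (ρ + t) (w.ur t) ≤ 5 / 2 * kk t * (CE * nrm ρ (w.ut 0)) := by
    gcongr
  linarith

lemma IsSol.tail_source_le {R : ℝ} (hR : 0 < R) {w : Wv R} (h : IsSol w 0)
    {t : ℝ} (ht : 0 ≤ t) : L2 (R + t) (w.P t) ∧
    nrm (R + t) (w.P t) ≤ 5 / 2 * CE * nrm R (w.ut 0) * kk (R + t) := by
  obtain ⟨a1, -, a3, -, a5⟩ := h.energy hR ht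
  have hx : ∀ r, R + t < r → R + |t| < r := fun r hr => by rwa [abs_of_nonneg ht]
  have cur := Wv.slice_continuousOn w.cur t
  rw [abs_of_nonneg ht] at cur
  have hEq : EqOn (fun r => vv r * w.u t r) (w.P t) (Ioi (R + t)) := fun r hr => by
    rw [h.eq t r (hx r hr)]; ring
  obtain ⟨t1, t2⟩ :=
    vv_mul_tail (by linarith) (fun r hr => (w.hu t r (hx r hr)).dr) cur a1 a3
  refine ⟨t1.congr hEq, ?_⟩
  rw [← nrm_congr hEq]
  rw [abs_zero, add_zero] at a5
  have := kk_pos (R + t)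
  calc _ ≤ _ := t2
    _ ≤ 5 / 2 * kk (R + t) * (CE * nrm R (w.ut 0)) := by gcongr
    _ = _ := by ring

/-- The projected initial velocity is controlled by the outgoing energy and the source. -/
lemma IsSol.proj_le {R : ℝ} (hR : 0 < R) {w : Wv R} (h : IsSol w 0) {T B c : ℝ} (hT : 0 ≤ T)
    (hB : nrm (R + T) (w.ut T) ≤ B ∧ nrm (R + T) (w.ur T) ≤ B) {b H : ℝ → ℝ}
    (hH : ∀ t ∈ Icc 0 T, HasDerivAt H (b t) t)
    (hP : ∀ t ∈ Icc 0 T, L2 (R + t) (w.P t) ∧ nrm (R + t) (w.P t) ≤ b t)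
    (hc : (∫ r in Ioi R, (w.ut 0 r - c * iv r) * iv r * r ^ 5) = 0) :
    nrm R (fun r => w.ut 0 r - c * iv r) ≤ 80 * (B + (H T - H 0)) := by
  have cut := Wv.slice_continuousOn w.cut 0
  rw [abs_zero, add_zero] at cut
  have hB0 : 0 ≤ B := (nrm_nonneg _ _).trans hB.1
  have hH0 : 0 ≤ H T - H 0 := by
    have := sub_le_of_deriv_le hT (Z := fun _ => 0) (Z' := fun _ => 0)
      (fun t _ => hasDerivAt_const t 0) hH fun t ht => (nrm_nonneg _ _).trans (hP t ht).2
    simpa using this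
  refine dual_le hR (by positivity) (h.fin.sub hR.le ((iv_L2 hR).1.const_mul c))
    (cut.sub (continuousOn_const.mul (iv_continuousOn hR.le))) hc (m := w.ut 0) (c := c)
    (fun r _ => by ring) fun p q γ hγ hp => ?_
  refine w.duality hR h.odd hγ hp hT (M := CE * (nrm R (w.ut 0) + |0|)) (fun t ht => ?_)
    (fun t ht => ?_) hH hP hB
  · obtain ⟨a1, a2, a3, -, -⟩ := h.energy hR ht.1
    exact ⟨a1, a2, a3⟩
  · obtain ⟨-, -, -, a4, a5⟩ := h.energy hR ht.1
    exact ⟨a4, a5⟩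

lemma iv_nrm_eq {R : ℝ} (hR : 0 < R) : nrm R iv ^ 2 = 1 / (2 * R ^ 2) := by
  rw [nrm_sq hR.le, (iv_L2 hR).2]

/-- The coefficient of the projection of `m` on `r⁻⁴` in `L²_R`. -/
def ivCoef (R : ℝ) (m : ℝ → ℝ) : ℝ := 2 * R ^ 2 * ∫ r in Ioi R, m r * iv r * r ^ 5

lemma ivCoef_orth {R : ℝ} (hR : 0 < R) {m : ℝ → ℝ} (hm : L2 R m) :
    (∫ r in Ioi R, (m r - ivCoef R m * iv r) * iv r * r ^ 5) = 0 := by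
  have i1 : IntegrableOn (fun r => m r * iv r * r ^ 5) (Ioi R) :=
    hm.integrable_mul hR.le (iv_L2 hR).1
  have i2 : IntegrableOn (fun r => iv r ^ 2 * r ^ 5) (Ioi R) := (iv_L2 hR).1.2
  have e : ∀ r, (m r - ivCoef R m * iv r) * iv r * r ^ 5 =
      m r * iv r * r ^ 5 - ivCoef R m * (iv r ^ 2 * r ^ 5) := fun r => by ring
  simp_rw [e]
  rw [integral_sub i1 (i2.const_mul _), integral_const_mul, (iv_L2 hR).2, ivCoef]
  field_simp
  ring

lemma ivCoef_le {R : ℝ} (hR : 0 < R) {m : ℝ → ℝ} (hm : L2 R m) :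
    |ivCoef R m| ≤ 2 * R * nrm R m := by
  have h1 := inner_le_nrm hR.le hm (iv_L2 hR).1
  have h2 := mul_le_mul_of_nonneg_left (iv_nrm hR) (nrm_nonneg R m)
  rw [ivCoef, abs_mul, abs_of_nonneg (by positivity)]
  calc _ ≤ 2 * R ^ 2 * (nrm R m * (1 / R)) := by gcongr; linarith
    _ = _ := by field_simp

/-- The coefficient of `r⁻⁴` is already determined far out. -/
lemma coef_le_of_sub {ρ c : ℝ} (hρ : 0 < ρ) {m : ℝ → ℝ} (hm : L2 ρ m) :
    |c| ≤ 2 * ρ * (nrm ρ m + nrm ρ (fun r => m r - c * iv r)) := by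
  have h1 := nrm_sub_le hρ.le hm (hm.sub hρ.le ((iv_L2 hρ).1.const_mul c))
  have e : (fun r => m r - (m r - c * iv r)) = fun r => c * iv r := by funext r; ring
  rw [e, nrm_const_mul] at h1
  have h2 : 1 / (2 * ρ) ≤ nrm ρ iv := by
    refine abs_le_of_sq_le_sq' ?_ (nrm_nonneg _ _) |>.2
    rw [iv_nrm_eq hρ, div_pow, mul_pow]
    gcongr
    · norm_num
    · norm_num
  have h3 : |c| * (1 / (2 * ρ)) ≤ _ := (mul_le_mul_of_nonneg_left h2 (abs_nonneg c)).trans h1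
  rw [mul_one_div, div_le_iff₀ (by positivity)] at h3
  linarith

/-- Energy bound on the slice at time `T`. -/
def Wv.Bd {R : ℝ} (w : Wv R) (T B : ℝ) : Prop :=
  L2 (R + T) (w.ut T) ∧ L2 (R + T) (w.ur T) ∧
    nrm (R + T) (w.ut T) ≤ B ∧ nrm (R + T) (w.ur T) ≤ B

lemma Wv.Bd.restrict {R : ℝ} {w : Wv R} {T B : ℝ} (h : w.Bd T B) (hR : 0 ≤ R + T) {ρ : ℝ}
    (hρ : R ≤ ρ) : (w.restrict hρ).Bd T B :=
  ⟨h.1.mono (by linarith), h.2.1.mono (by linarith),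
    (nrm_mono hR (by linarith) h.1).trans h.2.2.1, (nrm_mono hR (by linarith) h.2.1).trans h.2.2.2⟩

lemma IsSol.tail_le {R : ℝ} (hR : 0 < R) {w : Wv R} (h : IsSol w 0) {T B : ℝ} (hT : 0 ≤ T)
    (hB : w.Bd T B) (hη : ∀ t, 0 ≤ t → kH (R + t) - kH R ≤ 1 / (400 * CE))
    (h0 : (∫ r in Ioi R, w.ut 0 r * iv r * r ^ 5) = 0) : nrm R (w.ut 0) ≤ 160 * B := by
  have hCE := CE_pos
  have := h.proj_le hR (c := 0) hT hB.2.2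
    (b := fun t => 5 / 2 * CE * nrm R (w.ut 0) * kk (R + t))
    (H := fun t => 5 / 2 * CE * nrm R (w.ut 0) * kH (R + t))
    (fun t _ => ((kH_deriv (R + t)).comp_const_add R t).const_mul _)
    (fun t ht => h.tail_source_le hR ht.1) (by simpa using h0)
  simp only [zero_mul, sub_zero, add_zero, ← mul_sub] at this
  have hN := nrm_nonneg R (w.ut 0)
  have h2 : 5 / 2 * CE * nrm R (w.ut 0) * (kH (R + T) - kH R) ≤
      5 / 2 * CE * nrm R (w.ut 0) * (1 / (400 * CE)) :=
    mul_le_mul_of_nonneg_left (hη T hT) (by positivity)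
  have h3 : 5 / 2 * CE * nrm R (w.ut 0) * (1 / (400 * CE)) = nrm R (w.ut 0) / 160 := by
    field_simp; ring
  linarith

lemma IsSol.layer_le {ρ' ρ : ℝ} (hρ' : 0 < ρ') (hρ : ρ' ≤ ρ) {w : Wv ρ'} (h : IsSol w 0)
    {T B : ℝ} (hT : 0 ≤ T) (hB : w.Bd T B) (c : ℝ) :
    nrm ρ' (fun r => w.ut 0 r - ivCoef ρ' (w.ut 0) * iv r) ≤ 80 * (B + 8 *
      (5 / 2 * CE * nrm ρ (w.ut 0) + 3 * √((1 + ρ) * (ρ - ρ')) *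
      (CE * (nrm ρ' (fun r => w.ut 0 r - c * iv r) + |c|)) + 2 * |c|)) := by
  obtain ⟨β, hβ⟩ : ∃ β, β = 5 / 2 * CE * nrm ρ (w.ut 0) + 3 * √((1 + ρ) * (ρ - ρ')) *
      (CE * (nrm ρ' (fun r => w.ut 0 r - c * iv r) + |c|)) + 2 * |c| := ⟨_, rfl⟩
  have hβ0 : 0 ≤ β := by
    have := CE_pos
    have := nrm_nonneg ρ (w.ut 0)
    have := nrm_nonneg ρ' (fun r => w.ut 0 r - c * iv r)
    rw [hβ]; positivity
  have := h.proj_le hρ' hT hB.2.2 (b := fun t => β * kk t) (H := fun t => β * kH t)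
    (fun t _ => (kH_deriv t).const_mul β)
    (fun t ht => by rw [hβ]; exact h.source_le hρ' hρ c ht.1) (ivCoef_orth hρ' h.fin)
  rw [← hβ]
  simp only [← mul_sub] at this
  have h2 := mul_le_mul_of_nonneg_left (kH_le (s := 0) (t := T) le_rfl) hβ0
  linarith

/-- The growth factor of one step towards the origin. -/
def stepC : ℝ := 16000 * CE + 808

lemma IsSol.step_le {ρ' ρ : ℝ} (hρ' : 0 < ρ') (hρ : ρ' ≤ ρ) (hρ2 : ρ ≤ 2 * ρ') {w : Wv ρ'}
    (h : IsSol w 0) {T B : ℝ} (hT : 0 ≤ T) (hB : w.Bd T B)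
    (hs : (1 + ρ) * (ρ - ρ') ≤ (1 / (19200 * CE)) ^ 2) :
    nrm ρ' (w.ut 0) ≤ stepC * (B + nrm ρ (w.ut 0)) := by
  have hCE := CE_pos
  have hB0 : 0 ≤ B := (nrm_nonneg _ _).trans hB.2.2.1
  have h1 := h.layer_le hρ' hρ hT hB 0
  simp only [zero_mul, sub_zero, abs_zero, add_zero, mul_zero] at h1
  have hsq : √((1 + ρ) * (ρ - ρ')) ≤ 1 / (19200 * CE) :=
    (Real.sqrt_le_sqrt hs).trans (Real.sqrt_sq (by positivity)).le
  obtain ⟨c, hc⟩ : ∃ c, c = ivCoef ρ' (w.ut 0) := ⟨_, rfl⟩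
  rw [← hc] at h1
  have L1 := (iv_L2 hρ').1.const_mul c
  have h2 := coef_le_of_sub (c := c) (hρ'.trans_le hρ) (h.fin.mono hρ)
  have h3 := nrm_mono hρ'.le hρ (h.fin.sub hρ'.le L1)
  have h4 := nrm_add_le hρ'.le (h.fin.sub hρ'.le L1) L1
  have e : (fun r => w.ut 0 r - c * iv r + c * iv r) = w.ut 0 := by funext r; ring
  rw [e, nrm_const_mul] at h4
  have eta : (fun r => w.ut 0 r) = w.ut 0 := rfl
  rw [eta] at h1
  have x0 := nrm_nonneg ρ (fun r => w.ut 0 r - c * iv r)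
  have N0 := nrm_nonneg ρ (w.ut 0)
  have N0' := nrm_nonneg ρ' (w.ut 0)
  clear hB
  generalize nrm ρ' (fun r => w.ut 0 r - c * iv r) = x at *
  generalize nrm ρ (fun r => w.ut 0 r - c * iv r) = y at *
  generalize nrm ρ (w.ut 0) = N at *
  generalize nrm ρ' (w.ut 0) = N' at *
  have hρ0 : 0 < ρ := hρ'.trans_le hρ
  have h5 : |c| * nrm ρ' iv ≤ 4 * (N + x) := by
    calc |c| * nrm ρ' iv ≤ (2 * ρ * (N + y)) * (1 / ρ') :=
          mul_le_mul h2 (iv_nrm hρ') (nrm_nonneg _ _) (by positivity)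
      _ ≤ (2 * (2 * ρ') * (N + x)) * (1 / ρ') := by gcongr
      _ = _ := by field_simp; ring
  have h6 : 3 * √((1 + ρ) * (ρ - ρ')) * (CE * N') ≤ 3 * (1 / (19200 * CE)) * (CE * N') := by
    gcongr
  have h7 : 3 * (1 / (19200 * CE)) * (CE * N') = N' / 6400 := by field_simp; ring
  rw [stepC]
  nlinarith [mul_nonneg hCE.le N0, mul_nonneg hCE.le hB0]

lemma IsSol.steps_le {R0 ε : ℝ} (hε : 0 < ε) (hεR : ε ≤ R0) : ∃ C : ℝ, 0 < C ∧
    ∀ (R : ℝ) (w : Wv R), 0 < R → IsSol w 0 → ∀ T B, 0 ≤ T → w.Bd T B →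
      ∀ ρ, R ≤ ρ → ε ≤ ρ → ρ ≤ R0 → nrm ρ (w.ut 0) ≤ C * (B + nrm R0 (w.ut 0)) := by
  have hCE := CE_pos
  obtain ⟨δ, hδ⟩ : ∃ δ, δ = min (ε / 2) ((1 / (19200 * CE)) ^ 2 / (1 + R0)) := ⟨_, rfl⟩
  have hR0 : 0 < R0 := hε.trans_le hεR
  have hδ0 : 0 < δ := by rw [hδ]; positivity
  have hδ1 : δ ≤ ε / 2 := hδ ▸ min_le_left _ _
  have hδ2 : (1 + R0) * δ ≤ (1 / (19200 * CE)) ^ 2 := by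
    have : δ ≤ (1 / (19200 * CE)) ^ 2 / (1 + R0) := hδ ▸ min_le_right _ _
    rw [le_div_iff₀ (by positivity)] at this
    linarith
  have hA : 1 ≤ stepC := by rw [stepC]; nlinarith
  have key : ∀ n : ℕ, ∀ (R : ℝ) (w : Wv R), 0 < R → IsSol w 0 → ∀ T B, 0 ≤ T → w.Bd T B →
      ∀ ρ, R ≤ ρ → ε ≤ ρ → ρ ≤ R0 → R0 - n * δ ≤ ρ →
        nrm ρ (w.ut 0) ≤ (2 * stepC) ^ n * (B + nrm R0 (w.ut 0)) := by
    intro n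
    induction n with
    | zero =>
      intro R w hR h T B hT hB ρ h1 h2 h3 h4
      have : ρ = R0 := le_antisymm h3 (by simpa using h4)
      have hB0 : 0 ≤ B := (nrm_nonneg _ _).trans hB.2.2.1
      rw [this]; simp [hB0]
    | succ n ih =>
      intro R w hR h T B hT hB ρ h1 h2 h3 h4
      have hB0 : 0 ≤ B := (nrm_nonneg _ _).trans hB.2.2.1
      have g1 : ρ ≤ min (ρ + δ) R0 := le_min (by linarith) h3
      have g2 : min (ρ + δ) R0 ≤ ρ + δ := min_le_left _ _
      have g3 : min (ρ + δ) R0 ≤ R0 := min_le_right _ _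
      have g4 : R0 - n * δ ≤ min (ρ + δ) R0 := by
        refine le_min ?_ (by have : (0 : ℝ) ≤ n * δ := by positivity
                             linarith)
        push_cast at h4; linarith
      have hρ0 : 0 < ρ := hR.trans_le h1
      have s1 := ih R w hR h T B hT hB _ (h1.trans g1) (h2.trans g1) g3 g4
      have s2 := (h.restrict h1).step_le hρ0 g1 (by linarith) hT (hB.restrict (by linarith) h1)
        (le_trans (mul_le_mul (by linarith) (by linarith) (by linarith) (by linarith)) hδ2)
      have s3 : nrm ρ (w.ut 0) ≤ stepC * (B + nrm (min (ρ + δ) R0) (w.ut 0)) := s2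
      obtain ⟨N, hN⟩ : ∃ N, N = nrm R0 (w.ut 0) := ⟨_, rfl⟩
      have N0 : 0 ≤ N := hN ▸ nrm_nonneg _ _
      rw [← hN] at s1 ⊢
      have p1 : 1 ≤ (2 * stepC) ^ n := one_le_pow₀ (by linarith)
      obtain ⟨q, hq⟩ : ∃ q, q = (2 * stepC) ^ n := ⟨_, rfl⟩
      rw [pow_succ]
      rw [← hq] at s1 p1 ⊢
      calc nrm ρ (w.ut 0) ≤ stepC * (B + nrm (min (ρ + δ) R0) (w.ut 0)) := s3
        _ ≤ stepC * (q * (B + N) + q * (B + N)) := by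
          refine mul_le_mul_of_nonneg_left ?_ (by linarith)
          nlinarith
        _ = _ := by ring
  obtain ⟨n, hn⟩ := exists_nat_ge (R0 / δ)
  rw [div_le_iff₀ hδ0] at hn
  refine ⟨(2 * stepC) ^ n, by positivity, fun R w hR h T B hT hB ρ h1 h2 h3 =>
    key n R w hR h T B hT hB ρ h1 h2 h3 (by linarith)⟩

/-- The radius below which the singular direction has to be projected away. -/
def epsC : ℝ := (1 / (15360 * CE)) ^ 2 / 2

lemma one_le_CE : 1 ≤ CE := one_le_exp (by norm_num)

lemma epsC_bounds : 0 < epsC ∧ 20480 * epsC ≤ 1 := by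
  have h := one_le_CE
  have h1 : 1 / (15360 * CE) ≤ 1 / 15360 := by
    apply one_div_le_one_div_of_le <;> linarith
  have h2 := pow_le_pow_left₀ (by positivity) h1 2
  refine ⟨by unfold epsC; positivity, ?_⟩
  rw [epsC]; norm_num at h2 ⊢; linarith

lemma IsSol.core_le {R : ℝ} (hR : 0 < R) (hRε : R ≤ epsC) {w : Wv R} (h : IsSol w 0)
    {T B : ℝ} (hT : 0 ≤ T) (hB : w.Bd T B) :
    nrm R (fun r => w.ut 0 r - ivCoef R (w.ut 0) * iv r) ≤
      (2560 * CE + 128) * (B + nrm epsC (w.ut 0)) ∧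
    |ivCoef R (w.ut 0)| ≤ (2560 * CE + 129) * (B + nrm epsC (w.ut 0)) := by
  have hCE := CE_pos
  obtain ⟨e0, e1⟩ := epsC_bounds
  have hB0 : 0 ≤ B := (nrm_nonneg _ _).trans hB.2.2.1
  obtain ⟨c, hc⟩ : ∃ c, c = ivCoef R (w.ut 0) := ⟨_, rfl⟩
  have h1 := h.layer_le hR hRε hT hB c
  rw [← hc] at h1 ⊢
  have hsq : √((1 + epsC) * (epsC - R)) ≤ 1 / (15360 * CE) := by
    refine (Real.sqrt_le_sqrt (y := (1 / (15360 * CE)) ^ 2) ?_).trans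
      (Real.sqrt_sq (by positivity)).le
    have : (1 / (15360 * CE)) ^ 2 = 2 * epsC := by rw [epsC]; ring
    rw [this]
    exact mul_le_mul (by linarith) (by linarith) (by linarith) (by norm_num)
  have L1 := (iv_L2 hR).1.const_mul c
  have h2 := coef_le_of_sub (c := c) e0 (h.fin.mono hRε)
  have h3 := nrm_mono hR.le hRε (h.fin.sub hR.le L1)
  have y0 := nrm_nonneg epsC (fun r => w.ut 0 r - c * iv r)
  have N0 := nrm_nonneg epsC (w.ut 0)
  clear hB
  generalize nrm R (fun r => w.ut 0 r - c * iv r) = x at *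
  generalize nrm epsC (fun r => w.ut 0 r - c * iv r) = y at *
  generalize nrm epsC (w.ut 0) = N at *
  have x0 : 0 ≤ x := y0.trans h3
  have c1 : 10240 * |c| ≤ N + x := by nlinarith
  have h6 : 3 * √((1 + epsC) * (epsC - R)) * (CE * (x + |c|)) ≤
      3 * (1 / (15360 * CE)) * (CE * (x + |c|)) := by gcongr
  have h7 : 3 * (1 / (15360 * CE)) * (CE * (x + |c|)) = (x + |c|) / 5120 := by
    field_simp; ring
  have p1 := mul_nonneg hCE.le N0
  have p2 := mul_nonneg hCE.le hB0
  have p3 := abs_nonneg c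
  constructor <;> nlinarith

lemma kk_relation (r : ℝ) : r ^ 2 * kk r = 24 * (1 - kk r) := by
  unfold kk
  have : (1 + r ^ 2 / 24) ≠ 0 := by positivity
  field_simp
  ring

lemma W1_eq : W1 = fun r => kk r ^ 2 := by
  funext r; rw [W1, kk, inv_pow]

lemma LW1_eq (r : ℝ) : LW1 r = 4 * kk r ^ 3 - 2 * kk r ^ 2 := by
  have h : HasDerivAt W1 (2 * kk r * (-(r / 12) * kk r ^ 2)) r := by
    rw [W1_eq]
    refine ((kk_deriv r).pow 2).congr_deriv ?_
    push_cast; ring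
  rw [LW1, h.deriv, W1_eq]
  linear_combination (-(kk r ^ 2) / 6) * kk_relation r

/-- The derivative of `ΛW`. -/
def LWd (r : ℝ) : ℝ := r / 3 * kk r ^ 3 - r * kk r ^ 4

/-- The second derivative of `ΛW`. -/
def LWdd (r : ℝ) : ℝ := kk r ^ 3 / 3 - kk r ^ 4 + r ^ 2 / 12 * (4 * kk r ^ 5 - kk r ^ 4)

lemma LW1_deriv (r : ℝ) : HasDerivAt LW1 (LWd r) r := by
  have e : LW1 = fun r => 4 * kk r ^ 3 - 2 * kk r ^ 2 := funext LW1_eq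
  rw [e]
  refine ((((kk_deriv r).pow 3).const_mul 4).sub (((kk_deriv r).pow 2).const_mul 2)).congr_deriv ?_
  rw [LWd]; push_cast; ring

lemma LWd_deriv (r : ℝ) : HasDerivAt LWd (LWdd r) r := by
  have h1 : HasDerivAt (fun r : ℝ => r / 3) (1 / 3) r := (hasDerivAt_id r).div_const 3
  refine ((h1.mul ((kk_deriv r).pow 3)).sub
    ((hasDerivAt_id r).mul ((kk_deriv r).pow 4))).congr_deriv ?_
  rw [LWdd]; simp only [id, Pi.pow_apply]; push_cast; ring

lemma LWdd_continuous : Continuous LWdd := by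
  have := kk_continuous
  unfold LWdd; fun_prop

lemma LW1_continuous : Continuous LW1 :=
  continuous_iff_continuousAt.2 fun t => (LW1_deriv t).continuousAt

lemma LWd_continuous : Continuous LWd :=
  continuous_iff_continuousAt.2 fun t => (LWd_deriv t).continuousAt

lemma LW1_ode {r : ℝ} (hr : 0 < r) : LWdd r + 5 * LWd r / r = -(vv r * LW1 r) := by
  rw [LW1_eq, LWdd, LWd, vv]
  field_simp
  linear_combination (12 * kk r ^ 4 - 3 * kk r ^ 3) * kk_relation r

lemma kk_le_div {r : ℝ} (hr : 0 < r) : kk r ≤ 24 / r ^ 2 := by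
  rw [le_div_iff₀ (by positivity), mul_comm, kk_relation]
  linarith [kk_pos r]

lemma LW1_abs_le (r : ℝ) : |LW1 r| ≤ 2 * kk r ^ 2 := by
  have h0 := kk_pos r
  have h1 := kk_le_one r
  have h2 := mul_le_mul_of_nonneg_right h1 (sq_nonneg (kk r))
  rw [LW1_eq, abs_le]
  constructor <;> nlinarith [pow_pos h0 3]

lemma LW1_le_iv {r : ℝ} (hr : 0 < r) : |LW1 r| ≤ 1152 * iv r := by
  have h := pow_le_pow_left₀ (kk_pos r).le (kk_le_div hr) 2
  have e : (24 / r ^ 2) ^ 2 = 576 * iv r := by rw [iv]; field_simp; norm_num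
  linarith [LW1_abs_le r]

lemma LWd_le_iv {r : ℝ} (hr : 0 < r) : r * |LWd r| ≤ 13824 * iv r := by
  have h0 := kk_pos r
  have h1 := kk_le_one r
  have h2 := pow_le_pow_left₀ h0.le (kk_le_div hr) 3
  have h3 := mul_le_mul_of_nonneg_right h1 (pow_pos h0 3).le
  have e : r * (r * (24 / r ^ 2) ^ 3) = 13824 * iv r := by rw [iv]; field_simp; norm_num
  rw [← e]
  refine mul_le_mul_of_nonneg_left ?_ hr.le
  have h4 : |LWd r| = r * |kk r ^ 3 / 3 - kk r ^ 4| := by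
    rw [LWd, ← abs_of_pos hr, ← abs_mul, abs_of_pos hr]; congr 1; ring
  rw [h4]
  refine mul_le_mul_of_nonneg_left ?_ hr.le
  rw [abs_le]
  constructor <;> nlinarith [pow_pos h0 3, pow_pos h0 4]

lemma LW1_nrm_le {ρ : ℝ} (hρ : 0 < ρ) : L2 ρ LW1 ∧ nrm ρ LW1 ≤ 13824 / ρ := by
  obtain ⟨h1, h2⟩ := L2.of_abs_le hρ.le (iv_L2 hρ).1 LW1_continuous.continuousOn
    (K := 1152) (by norm_num) fun r hr => by
      rw [abs_of_nonneg (a := iv r) (by unfold iv; positivity)]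
      exact LW1_le_iv (hρ.trans hr)
  refine ⟨h1, h2.trans ?_⟩
  have := iv_nrm hρ
  have h3 : 0 < 1 / ρ := by positivity
  rw [div_eq_mul_one_div]
  linarith

lemma LWd_nrm_le {R T : ℝ} (hR : 0 < R) (hT : 0 ≤ T) :
    L2 (R + T) (fun r => T * LWd r) ∧ nrm (R + T) (fun r => T * LWd r) ≤ 13824 / (R + T) := by
  have hρ : 0 < R + T := by linarith
  obtain ⟨h1, h2⟩ := L2.of_abs_le hρ.le (iv_L2 hρ).1 (f := fun r => T * LWd r)
    (continuous_const.mul LWd_continuous).continuousOn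
    (K := 13824) (by norm_num) fun r hr => by
      have hr0 := hρ.trans hr
      rw [abs_of_nonneg (a := iv r) (by unfold iv; positivity), abs_mul, abs_of_nonneg hT]
      refine le_trans ?_ (LWd_le_iv hr0)
      exact mul_le_mul_of_nonneg_right (by linarith) (abs_nonneg _)
  refine ⟨h1, h2.trans ?_⟩
  have := iv_nrm hρ
  rw [div_eq_mul_one_div]
  linarith

lemma LW1_L2 {ρ : ℝ} (hρ : 0 ≤ ρ) : L2 ρ LW1 := by
  refine L2.mono hρ ⟨LW1_continuous.aestronglyMeasurable, ?_⟩
  rw [← Ioc_union_Ioi_eq_Ioi (zero_le_one' ℝ)]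
  refine IntegrableOn.union ?_ (LW1_nrm_le one_pos).1.2
  exact (((LW1_continuous.pow 2).mul (continuous_pow 5)).continuousOn.integrableOn_Icc).mono_set
    Ioc_subset_Icc_self

lemma LW1_inner {ρ : ℝ} (hρ : 0 < ρ) :
    (∫ r in Ioi ρ, LW1 r * iv r * r ^ 5) = -(ρ ^ 2 * kk ρ ^ 2) := by
  have hd : ∀ r, HasDerivAt (fun r => r ^ 2 * kk r ^ 2) (r * LW1 r) r := fun r => by
    refine ((hasDerivAt_pow 2 r).mul ((kk_deriv r).pow 2)).congr_deriv ?_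
    rw [LW1_eq]; simp only [Pi.pow_apply]; push_cast
    linear_combination (-(r * kk r ^ 2) / 6) * kk_relation r
  have e : EqOn (fun r => LW1 r * iv r * r ^ 5) (fun r => r * LW1 r) (Ioi ρ) := fun r hr => by
    have : 0 < r := hρ.trans hr
    simp only [iv]; field_simp
  have hi : IntegrableOn (fun r => LW1 r * iv r * r ^ 5) (Ioi ρ) :=
    (LW1_L2 hρ.le).integrable_mul hρ.le (iv_L2 hρ).1
  have ht : Tendsto (fun r => r ^ 2 * kk r ^ 2) atTop (𝓝 0) := by
    have hk : Tendsto kk atTop (𝓝 0) := by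
      refine Tendsto.inv_tendsto_atTop ?_
      exact tendsto_atTop_add_const_left _ _ ((tendsto_pow_atTop two_ne_zero).atTop_div_const
        (by norm_num))
    have : Tendsto (fun r => 24 * (kk r - kk r ^ 2)) atTop (𝓝 (24 * (0 - 0 ^ 2))) :=
      (hk.sub (hk.pow 2)).const_mul 24
    simp only [ne_eq, OfNat.ofNat_ne_zero, not_false_eq_true, zero_pow, sub_zero, mul_zero] at this
    refine this.congr fun r => ?_
    linear_combination -(kk r) * kk_relation r
  rw [setIntegral_congr_fun measurableSet_Ioi e,
    integral_Ioi_of_hasDerivAt_of_tendsto' (fun r _ => hd r) (hi.congr_fun e measurableSet_Ioi) ht]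
  ring

/-- Subtracting `c t ΛW` from a wave. -/
def Wv.subLW {R : ℝ} (w : Wv R) (c : ℝ) : Wv R :=
  w.addTime (-c) LW1 LWd LWdd (fun r _ => LW1_deriv r) (fun r _ => LWd_deriv r)
    LWdd_continuous.continuousOn

lemma IsSol.subLW {R : ℝ} (hR : 0 < R) {w : Wv R} (h : IsSol w 0) (c : ℝ) :
    IsSol (w.subLW c) 0 where
  odd r hr := by
    show w.u 0 r + -c * (0 * LW1 r) = 0
    rw [h.odd r hr]; ring
  eq t r hr := by
    have hr0 : 0 < r := by linarith [abs_nonneg t]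
    have h1 := h.eq t r hr
    have h2 := LW1_ode hr0
    rw [Wv.P] at h1 ⊢
    show w.utt t r - (w.urr t r + -c * (t * LWdd r)) - 5 * (w.ur t r + -c * (t * LWd r)) / r =
      vv r * (w.u t r + -c * (t * LW1 r) + 0 * (t * iv r))
    have e : w.utt t r - (w.urr t r + -c * (t * LWdd r)) - 5 * (w.ur t r + -c * (t * LWd r)) / r =
      (w.utt t r - w.urr t r - 5 * w.ur t r / r) + c * t * (LWdd r + 5 * LWd r / r) := by ring
    rw [e, h1, h2]; ring
  fin := h.fin.add hR.le ((LW1_L2 hR.le).const_mul (-c))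

lemma subLW_Bd {R : ℝ} (hR : 0 < R) (w : Wv R) (c : ℝ) {B : ℝ} (hB : 0 < B)
    (h : ∃ᶠ T in atTop, w.Bd T B) : ∃ T, 0 ≤ T ∧ (w.subLW c).Bd T (2 * B) := by
  have hlarge : ∀ᶠ T : ℝ in atTop, 0 ≤ T ∧ |c| * 13824 / B ≤ T :=
    (eventually_ge_atTop 0).and (eventually_ge_atTop _)
  obtain ⟨T, ⟨a1, a2, a3, a4⟩, hT, hT2⟩ := (h.and_eventually hlarge).exists
  have hρ : 0 < R + T := by linarith
  have hs : |c| * (13824 / (R + T)) ≤ B := by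
    rw [div_le_iff₀ hB] at hT2
    rw [← mul_div_assoc, div_le_iff₀ hρ]
    nlinarith
  obtain ⟨b1, b2⟩ := LW1_nrm_le hρ
  obtain ⟨d1, d2⟩ := LWd_nrm_le hR hT
  have c1 := mul_le_mul_of_nonneg_left b2 (abs_nonneg c)
  have c2 := mul_le_mul_of_nonneg_left d2 (abs_nonneg c)
  have e1 := nrm_add_le hρ.le a1 (b1.const_mul (-c))
  have e2 := nrm_add_le hρ.le a2 (d1.const_mul (-c))
  rw [nrm_const_mul, abs_neg] at e1 e2
  refine ⟨T, hT, a1.add hρ.le (b1.const_mul (-c)), a2.add hρ.le (d1.const_mul (-c)), ?_, ?_⟩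
  · show nrm (R + T) (fun r => w.ut T r + -c * LW1 r) ≤ _
    linarith
  · show nrm (R + T) (fun r => w.ur T r + -c * (T * LWd r)) ≤ _
    linarith

lemma exists_large_radius : ∃ Rb : ℝ, 1 ≤ Rb ∧ ∀ R, Rb ≤ R → ∀ t, 0 ≤ t →
    kH (R + t) - kH R ≤ 1 / (400 * CE) := by
  have hCE := CE_pos
  have h24 : 0 < √(24 : ℝ) := by positivity
  have h1 : Tendsto kH atTop (𝓝 (√24 * (π / 2))) :=
    ((tendsto_nhds_of_tendsto_nhdsWithin tendsto_arctan_atTop).comp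
      (tendsto_id.atTop_div_const h24)).const_mul _
  have h2 := h1.eventually (lt_mem_nhds (show √24 * (π / 2) - 1 / (400 * CE) < √24 * (π / 2) by
    have : 0 < 1 / (400 * CE) := by positivity
    linarith))
  obtain ⟨Rb, h3⟩ := eventually_atTop.1 h2
  refine ⟨max Rb 1, le_max_right _ _, fun R hR t _ => ?_⟩
  have h4 := h3 R ((le_max_left _ _).trans hR)
  have h5 : kH (R + t) ≤ √24 * (π / 2) :=
    mul_le_mul_of_nonneg_left (arctan_lt_pi_div_two _).le h24.le
  linarith

/-- The channel estimate for waves on an exterior cone of positive radius, up to the two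
singular directions. -/
theorem core_estimate : ∃ C Rb : ℝ, 0 < C ∧ 1 ≤ Rb ∧ ∀ (R : ℝ) (w : Wv R), 0 < R → IsSol w 0 →
    ∀ B, 0 < B → (∃ᶠ T in atTop, w.Bd T B) → ∀ c,
    (∫ r in Ioi (max R Rb), (w.ut 0 r - c * LW1 r) * iv r * r ^ 5) = 0 →
    (epsC ≤ R → nrm R (fun r => w.ut 0 r - c * LW1 r) ≤ C * B) ∧
    (R ≤ epsC → nrm R (fun r => w.ut 0 r - c * LW1 r -
        ivCoef R (fun r => w.ut 0 r - c * LW1 r) * iv r) ≤ C * B ∧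
      |ivCoef R (fun r => w.ut 0 r - c * LW1 r)| ≤ C * B) := by
  have hCE := CE_pos
  obtain ⟨e0, e1⟩ := epsC_bounds
  obtain ⟨Rb, hRb1, hRb⟩ := exists_large_radius
  obtain ⟨C1, hC1, hstep⟩ := IsSol.steps_le e0 (by linarith : epsC ≤ Rb)
  refine ⟨320 + 322 * C1 + (2560 * CE + 129) * (2 + 322 * C1), Rb, by positivity, hRb1, ?_⟩
  intro R w hR h B hB hfreq c hc
  obtain ⟨T, hT, hBd⟩ := subLW_Bd hR w c hB hfreq
  have hs := h.subLW hR c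
  have em : (fun r => w.ut 0 r - c * LW1 r) = (w.subLW c).ut 0 := by
    funext r
    show _ = w.ut 0 r + -c * LW1 r
    ring
  have em' : ∀ r, w.ut 0 r - c * LW1 r = (w.subLW c).ut 0 r := fun r => congrFun em r
  simp only [em'] at hc ⊢
  have eta : (fun r => (w.subLW c).ut 0 r) = (w.subLW c).ut 0 := rfl
  rw [eta]
  generalize w.subLW c = v at *
  have hmax : 0 < max R Rb := hR.trans_le (le_max_left _ _)
  have t1 : nrm (max R Rb) (v.ut 0) ≤ 160 * (2 * B) :=
    (hs.restrict (le_max_left R Rb)).tail_le hmax hT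
      (hBd.restrict (by linarith) (le_max_left R Rb)) (fun t ht => hRb _ (le_max_right _ _) t ht) hc
  have p1 := mul_pos hC1 hB
  have p2 := mul_pos hCE hB
  have p3 := mul_pos hCE p1
  rcases le_total Rb R with hle | hle
  · rw [max_eq_left hle] at t1
    refine ⟨fun _ => by nlinarith, fun hRε => by linarith⟩
  rw [max_eq_right hle] at t1
  have s1 : ∀ ρ, R ≤ ρ → epsC ≤ ρ → ρ ≤ Rb → nrm ρ (v.ut 0) ≤ C1 * (322 * B) :=
    fun ρ g1 g2 g3 => (hstep R v hR hs T (2 * B) hT hBd ρ g1 g2 g3).trans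
      (mul_le_mul_of_nonneg_left (by linarith) hC1.le)
  refine ⟨fun hRε => ?_, fun hRε => ?_⟩
  · have := s1 R le_rfl hRε hle
    nlinarith
  · have s2 := s1 epsC hRε le_rfl (by linarith)
    obtain ⟨q1, q2⟩ := hs.core_le hR hRε hT hBd
    obtain ⟨N, hN⟩ : ∃ N, N = nrm epsC (v.ut 0) := ⟨_, rfl⟩
    rw [← hN] at q1 q2 s2
    have s3 : 2 * B + N ≤ (2 + 322 * C1) * B := by linarith
    have z : (2560 * CE + 129) * (2 * B + N) ≤ (2560 * CE + 129) * ((2 + 322 * C1) * B) :=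
      mul_le_mul_of_nonneg_left s3 (by positivity)
    have N0 : 0 ≤ N := hN ▸ nrm_nonneg _ _
    constructor
    · refine q1.trans ?_
      nlinarith
    · refine q2.trans ?_
      nlinarith

lemma LW1_eq_mul (r : ℝ) : LW1 r = kk r ^ 3 * (24 - r ^ 2) / 12 := by
  rw [LW1_eq]
  linear_combination (kk r ^ 2 / 12) * kk_relation r

lemma LW1_lower {r : ℝ} (hr : r ^ 2 ≤ 24) : (24 - r ^ 2) / 96 ≤ LW1 r := by
  have h : 1 / 2 ≤ kk r := by
    rw [kk, one_div]
    exact inv_anti₀ (by positivity) (by linarith)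
  have h3 := pow_le_pow_left₀ (by norm_num) h 3
  rw [LW1_eq_mul]
  nlinarith

lemma LW1_upper (r : ℝ) : |LW1 r| ≤ |24 - r ^ 2| / 12 := by
  have h3 : kk r ^ 3 ≤ 1 := pow_le_one₀ (kk_pos r).le (kk_le_one r)
  rw [LW1_eq_mul, abs_div, abs_mul, abs_of_pos (pow_pos (kk_pos r) 3), abs_of_pos (by norm_num :
    (0 : ℝ) < 12)]
  have := mul_le_mul_of_nonneg_right h3 (abs_nonneg (24 - r ^ 2))
  linarith

lemma LW1_near_zero {r : ℝ} (hr : r ^ 2 ≤ 1) :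
    1 ≤ LW1 r ∧ LW1 r ≤ 2 ∧ 2 - LW1 r ≤ r ^ 2 / 3 := by
  have h0 := kk_pos r
  have h1 := kk_le_one r
  have h2 := kk_relation r
  have hk : 24 / 25 ≤ kk r := by nlinarith
  have e : 2 - LW1 r = 2 * (1 - kk r) * (1 + kk r + 2 * kk r ^ 2) := by rw [LW1_eq]; ring
  have h4 : 1 - kk r ≤ r ^ 2 / 24 := by nlinarith [sq_nonneg r]
  have h5 : kk r ^ 2 ≤ 1 := pow_le_one₀ h0.le h1
  have h6 : 0 ≤ (1 - kk r) * (1 + kk r + 2 * kk r ^ 2) := mul_nonneg (by linarith) (by positivity)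
  have h7 : (1 - kk r) * (1 + kk r + 2 * kk r ^ 2) ≤ r ^ 2 / 24 * 4 :=
    mul_le_mul h4 (by linarith) (by positivity) (by positivity)
  refine ⟨?_, ?_, ?_⟩ <;> nlinarith

lemma gam_integrand_continuousOn :
    ContinuousOn (fun s => (s ^ 5 * LW1 s ^ 2)⁻¹) (Ioo 0 √24) := by
  refine ((continuous_pow 5).mul (LW1_continuous.pow 2)).continuousOn.inv₀ fun s hs => ?_
  have h := (Real.lt_sqrt hs.1.le).1 hs.2
  have : 0 < LW1 s := lt_of_lt_of_le (by linarith) (LW1_lower h.le)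
  exact (mul_pos (pow_pos hs.1 5) (pow_pos this 2)).ne'

lemma one_lt_sqrt24 : (1 : ℝ) < √24 := (Real.lt_sqrt (by norm_num)).2 (by norm_num)

lemma sqrt24_le : √(24 : ℝ) ≤ 5 := Real.sqrt_le_iff.2 ⟨by norm_num, by norm_num⟩

lemma Gam_continuousOn : ContinuousOn Gam (Ioo 0 √24) := by
  intro r hr
  have hsub : uIcc 1 r ⊆ Ioo 0 √24 := by
    have : OrdConnected (Ioo (0 : ℝ) √24) := ordConnected_Ioo
    exact this.uIcc_subset ⟨one_pos, one_lt_sqrt24⟩ hr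
  have hca := gam_integrand_continuousOn.continuousAt (Ioo_mem_nhds hr.1 hr.2)
  have hd := intervalIntegral.integral_hasDerivAt_right
    (gam_integrand_continuousOn.mono hsub).intervalIntegrable
    (gam_integrand_continuousOn.stronglyMeasurableAtFilter isOpen_Ioo r hr) hca
  exact (LW1_continuous.neg.continuousAt.mul hd.continuousAt).continuousWithinAt

lemma Gam_zero {r : ℝ} (hr : √24 ≤ r) : Gam r = 0 := by
  have h24 : √(24 : ℝ) ^ 2 = 24 := Real.sq_sqrt (by norm_num)
  obtain ⟨q, hq⟩ : ∃ q, q = √(24 : ℝ) := ⟨_, rfl⟩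
  have hq1 : 1 < q := hq ▸ one_lt_sqrt24
  have hq5 : q ≤ 5 := hq ▸ sqrt24_le
  have hq4 : 4 < q := hq ▸ (Real.lt_sqrt (by norm_num)).2 (by norm_num)
  rw [← hq] at h24 hr
  have hni : ¬ IntervalIntegrable (fun s => (s ^ 5 * LW1 s ^ 2)⁻¹) volume 1 r := by
    refine not_intervalIntegrable_of_sub_inv_isBigO_punctured (c := q) ?_ (by linarith)
      (by rw [uIcc_of_le (by linarith)]; exact ⟨hq1.le, hr⟩)
    refine Asymptotics.IsBigO.of_bound 10000 ?_
    have hU : Ioo (q - 1) (q + 1) ∈ 𝓝 q := Ioo_mem_nhds (by linarith) (by linarith)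
    filter_upwards [mem_nhdsWithin_of_mem_nhds hU, self_mem_nhdsWithin] with s hs hne
    have hs0 : 0 < s := by linarith [hs.1]
    have hx : 0 < |s - q| := abs_pos.2 (sub_ne_zero.2 hne)
    have hx1 : |s - q| ≤ 1 := abs_le.2 ⟨by linarith [hs.1], by linarith [hs.2]⟩
    have e1 : 24 - s ^ 2 = -((s - q) * (s + q)) := by rw [← h24]; ring
    have e2 : |24 - s ^ 2| = |s - q| * (s + q) := by
      rw [e1, abs_neg, abs_mul, abs_of_pos (by linarith : 0 < s + q)]
    have hL : |LW1 s| ≤ |s - q| := by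
      have := LW1_upper s
      rw [e2] at this
      nlinarith [hs.2]
    have hL0 : LW1 s ≠ 0 := by
      rw [LW1_eq_mul, e1]
      have n1 : s + q ≠ 0 := by linarith
      have n2 : s - q ≠ 0 := sub_ne_zero.2 hne
      exact div_ne_zero (mul_ne_zero (pow_pos (kk_pos s) 3).ne'
        (neg_ne_zero.2 (mul_ne_zero n2 n1))) (by norm_num)
    have hs5 : s ^ 5 ≤ 10000 := by
      have := pow_le_pow_left₀ hs0.le (by linarith [hs.2] : s ≤ 6) 5
      norm_num at this; linarith
    have hp : 0 < s ^ 5 * LW1 s ^ 2 := by positivity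
    rw [Real.norm_eq_abs, Real.norm_eq_abs, abs_inv, abs_inv, abs_of_pos hp, ← div_eq_mul_inv,
      le_div_iff₀ hp, inv_mul_le_iff₀ hx]
    have hL2 := pow_le_pow_left₀ (abs_nonneg _) hL 2
    rw [sq_abs] at hL2
    calc s ^ 5 * LW1 s ^ 2 ≤ 10000 * |s - q| ^ 2 := by gcongr
      _ ≤ |s - q| * 10000 := by nlinarith
  rw [Gam, intervalIntegral.integral_undef hni, mul_zero]

lemma Gam_bounded {r : ℝ} (h1 : 1 ≤ r) : |Gam r| ≤ 384 := by
  rcases le_or_gt √24 r with h | h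
  · rw [Gam_zero h]; norm_num
  have hr2 : r ^ 2 < 24 := (Real.lt_sqrt (by linarith)).1 h
  have hsub : Icc 1 r ⊆ Ioo 0 √24 := fun s hs => ⟨by linarith [hs.1], by linarith [hs.2]⟩
  have pos : ∀ s ∈ Icc 1 r, 0 < 24 - s ^ 2 := fun s hs => by nlinarith [hs.1, hs.2]
  have e : (∫ s in (1 : ℝ)..r, 9216 * s / (24 - s ^ 2) ^ 2) =
      4608 / (24 - r ^ 2) - 4608 / (24 - 1 ^ 2) := by
    refine intervalIntegral.integral_eq_sub_of_hasDerivAt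
      (f := fun s => 4608 / (24 - s ^ 2)) (fun s hs => ?_) ?_
    · rw [uIcc_of_le h1] at hs
      have := pos s hs
      refine ((hasDerivAt_const s (4608 : ℝ)).div ((hasDerivAt_pow 2 s).const_sub 24)
        this.ne').congr_deriv ?_
      push_cast; ring
    · refine ContinuousOn.intervalIntegrable_of_Icc h1 (ContinuousOn.div (by fun_prop)
        (by fun_prop) fun s hs => ?_)
      have := pos s hs
      positivity
  have hi : (∫ s in (1 : ℝ)..r, (s ^ 5 * LW1 s ^ 2)⁻¹) ≤
      ∫ s in (1 : ℝ)..r, 9216 * s / (24 - s ^ 2) ^ 2 := by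
    refine intervalIntegral.integral_mono_on h1
      ((gam_integrand_continuousOn.mono hsub).intervalIntegrable_of_Icc h1) ?_ fun s hs => ?_
    · refine ContinuousOn.intervalIntegrable_of_Icc h1 (ContinuousOn.div (by fun_prop)
        (by fun_prop) fun s hs => ?_)
      have := pos s hs
      positivity
    · have hp := pos s hs
      have hs0 : 0 < s := by linarith [hs.1]
      have hL := LW1_lower (r := s) (by linarith)
      have hL2 := pow_le_pow_left₀ (by positivity) hL 2
      have hs5 : 1 ≤ s ^ 6 := one_le_pow₀ hs.1
      have hLp : 0 < LW1 s := lt_of_lt_of_le (by positivity) hL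
      rw [inv_le_iff_one_le_mul₀ (by positivity), div_mul_eq_mul_div, le_div_iff₀ (by positivity)]
      rw [div_pow] at hL2
      have h9 : (24 - s ^ 2) ^ 2 ≤ 9216 * LW1 s ^ 2 := by
        rw [div_le_iff₀ (by norm_num)] at hL2; linarith
      have := mul_le_mul hs5 h9 (sq_nonneg _) (by positivity)
      linarith
  have h0 : 0 ≤ ∫ s in (1 : ℝ)..r, (s ^ 5 * LW1 s ^ 2)⁻¹ :=
    intervalIntegral.integral_nonneg h1 fun s hs => by
      have : 0 < s := by linarith [hs.1]
      positivity
  have hrp : 0 < 24 - r ^ 2 := by linarith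
  have hU := LW1_upper r
  rw [abs_of_pos hrp] at hU
  rw [Gam, abs_mul, abs_neg, abs_of_nonneg h0]
  calc _ ≤ (24 - r ^ 2) / 12 * (4608 / (24 - r ^ 2)) := by
        refine mul_le_mul hU ?_ h0 (by positivity)
        rw [e] at hi
        norm_num at hi ⊢; linarith
    _ = 384 := by field_simp; norm_num

lemma Gam_near_zero {r : ℝ} (h0 : 0 < r) (h1 : r ≤ 1) : |iv r - 8 * Gam r| ≤ 4 / r ^ 2 := by
  have hsub : Icc r 1 ⊆ Ioo 0 √24 := fun s hs =>
    ⟨by linarith [hs.1], by linarith [hs.2, one_lt_sqrt24]⟩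
  have ci := (gam_integrand_continuousOn.mono hsub).intervalIntegrable_of_Icc h1
    (μ := volume)
  have pos : ∀ s ∈ Icc r 1, 0 < s := fun s hs => by linarith [hs.1]
  have c5 : IntervalIntegrable (fun s : ℝ => (4 * s ^ 5)⁻¹) volume r 1 :=
    ContinuousOn.intervalIntegrable_of_Icc h1 (ContinuousOn.inv₀ (by fun_prop) fun s hs => by
      have := pos s hs
      positivity)
  have c3 : IntervalIntegrable (fun s : ℝ => (3 * s ^ 3)⁻¹) volume r 1 :=
    ContinuousOn.intervalIntegrable_of_Icc h1 (ContinuousOn.inv₀ (by fun_prop) fun s hs => by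
      have := pos s hs
      positivity)
  have e5 : (∫ s in r..1, (4 * s ^ 5)⁻¹) = -(16 * 1 ^ 4)⁻¹ - -(16 * r ^ 4)⁻¹ := by
    refine intervalIntegral.integral_eq_sub_of_hasDerivAt
      (f := fun s : ℝ => -(16 * s ^ 4)⁻¹) (fun s hs => ?_) c5
    rw [uIcc_of_le h1] at hs
    have := pos s hs
    refine ((((hasDerivAt_pow 4 s).const_mul 16).inv (by positivity)).neg).congr_deriv ?_
    push_cast; field_simp; norm_num
  have e3 : (∫ s in r..1, (3 * s ^ 3)⁻¹) = -(6 * 1 ^ 2)⁻¹ - -(6 * r ^ 2)⁻¹ := by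
    refine intervalIntegral.integral_eq_sub_of_hasDerivAt
      (f := fun s : ℝ => -(6 * s ^ 2)⁻¹) (fun s hs => ?_) c3
    rw [uIcc_of_le h1] at hs
    have := pos s hs
    refine ((((hasDerivAt_pow 2 s).const_mul 6).inv (by positivity)).neg).congr_deriv ?_
    push_cast; field_simp; norm_num
  have pt : ∀ s ∈ Icc r 1, (4 * s ^ 5)⁻¹ ≤ (s ^ 5 * LW1 s ^ 2)⁻¹ ∧
      (s ^ 5 * LW1 s ^ 2)⁻¹ ≤ (4 * s ^ 5)⁻¹ + (3 * s ^ 3)⁻¹ := by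
    intro s hs
    have hs0 := pos s hs
    obtain ⟨l1, l2, l3⟩ := LW1_near_zero (r := s) (pow_le_one₀ hs0.le hs.2)
    generalize LW1 s = l at *
    have hl : 0 < l := by linarith
    constructor
    · apply inv_anti₀ (by positivity)
      have : l ^ 2 ≤ 4 := by nlinarith
      nlinarith [pow_pos hs0 5]
    · have e : (4 * s ^ 5)⁻¹ + (3 * s ^ 3)⁻¹ = (3 + 4 * s ^ 2) / (12 * s ^ 5) := by
        field_simp
        norm_num
      rw [e, inv_le_iff_one_le_mul₀ (by positivity), div_mul_eq_mul_div,
        le_div_iff₀ (by positivity)]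
      have key : 12 ≤ (3 + 4 * s ^ 2) * l ^ 2 := by
        have q1 : 4 - l ^ 2 ≤ 4 * (s ^ 2 / 3) := by nlinarith
        have hs1 : s ^ 2 ≤ 1 := pow_le_one₀ hs0.le hs.2
        have := mul_nonneg (by positivity : 0 ≤ 3 + 4 * s ^ 2)
          (by linarith : 0 ≤ l ^ 2 - 4 + 4 * (s ^ 2 / 3))
        nlinarith [mul_nonneg (sq_nonneg s) (by linarith : 0 ≤ 1 - s ^ 2)]
      nlinarith [pow_pos hs0 5]
  have b1 := intervalIntegral.integral_mono_on h1 c5 ci fun s hs => (pt s hs).1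
  have b2 := intervalIntegral.integral_mono_on h1 ci (c5.add c3) fun s hs => (pt s hs).2
  rw [intervalIntegral.integral_add c5 c3, e3] at b2
  rw [e5] at b1 b2
  obtain ⟨l1, l2, l3⟩ := LW1_near_zero (r := r) (pow_le_one₀ h0.le h1)
  rw [Gam, intervalIntegral.integral_symm, iv]
  obtain ⟨J, hJ⟩ : ∃ J, J = ∫ s in r..1, (s ^ 5 * LW1 s ^ 2)⁻¹ := ⟨_, rfl⟩
  rw [← hJ] at b1 b2 ⊢
  generalize LW1 r = l at *
  have ha : (r ^ 4)⁻¹ = (r ^ 2)⁻¹ ^ 2 := by rw [inv_pow, ← pow_mul]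
  rw [mul_inv 16 (r ^ 4), ha] at b1 b2
  rw [mul_inv 6 (r ^ 2)] at b2
  have hx1 : 1 ≤ (r ^ 2)⁻¹ := (one_le_inv₀ (by positivity)).2 (pow_le_one₀ h0.le h1)
  have hx2 : (r ^ 2)⁻¹ * r ^ 2 = 1 := inv_mul_cancel₀ (by positivity)
  rw [ha, div_eq_mul_inv]
  generalize (r ^ 2)⁻¹ = x at *
  have hy : x ^ 2 * (2 - l) ≤ x / 3 := by
    have := mul_le_mul_of_nonneg_left l3 (sq_nonneg x)
    have e : x ^ 2 * (r ^ 2 / 3) = x / 3 := by linear_combination (x / 3) * hx2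
    linarith
  have hy0 : 0 ≤ x ^ 2 * (2 - l) := mul_nonneg (sq_nonneg x) (by linarith)
  obtain ⟨E, hE⟩ : ∃ E, E = J - (x ^ 2 - 1) / 16 := ⟨_, rfl⟩
  have hJE : J = E + (x ^ 2 - 1) / 16 := by rw [hE]; ring
  norm_num at b1 b2
  have E0 : 0 ≤ E := by rw [hE]; linarith
  have E1 : E ≤ x / 6 := by rw [hE]; linarith
  have e : x ^ 2 - 8 * (-l * -J) = x ^ 2 * (2 - l) / 2 + l / 2 - 8 * (l * E) := by
    rw [hJE]; ring
  have hlE0 : 0 ≤ l * E := mul_nonneg (by linarith) E0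
  have hlE : l * E ≤ 2 * (x / 6) := mul_le_mul l2 E1 E0 (by norm_num)
  rw [e, abs_le]
  constructor <;> linarith

/-- The singular zero mode is a multiple of `r⁻⁴` up to a square integrable error. -/
lemma Gam_L2 {χ : ℝ → ℝ} (hχ : ∀ r, r ≤ 10 → χ r = 1) :
    L2 0 (fun r => iv r - 8 * (χ r * Gam r)) := by
  have hcut : ∀ r, χ r * Gam r = Gam r := fun r => by
    rcases le_total r 10 with h | h
    · rw [hχ r h, one_mul]
    · rw [Gam_zero (sqrt24_le.trans (by linarith)), mul_zero]
  simp_rw [hcut]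
  have hm : AEStronglyMeasurable (fun r => iv r - 8 * Gam r) (volume.restrict (Ioi 0)) := by
    have e : EqOn (fun r => iv r - 8 * (Ioo 0 √24).indicator Gam r) (fun r => iv r - 8 * Gam r)
        (Ioi 0) := fun r hr => by
      by_cases h : r < √24
      · simp only [indicator_of_mem (show r ∈ Ioo 0 √24 from ⟨hr, h⟩)]
      · simp only [indicator_of_notMem (show r ∉ Ioo 0 √24 from fun h' => h h'.2),
          Gam_zero (not_lt.1 h)]
    have hg : AEStronglyMeasurable ((Ioo 0 √24).indicator Gam) volume :=
      (aestronglyMeasurable_indicator_iff measurableSet_Ioo).2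
        (Gam_continuousOn.aestronglyMeasurable measurableSet_Ioo)
    refine AEStronglyMeasurable.congr ?_ ((ae_restrict_iff' measurableSet_Ioi).2
      (Eventually.of_forall fun r hr => e hr))
    exact ((iv_continuousOn le_rfl).aestronglyMeasurable measurableSet_Ioi).sub
      (hg.restrict.const_mul 8)
  refine ⟨hm, ?_⟩
  have hm2 : AEStronglyMeasurable (fun r => (iv r - 8 * Gam r) ^ 2 * r ^ 5)
      (volume.restrict (Ioi 0)) :=
    (hm.pow 2).mul (continuous_pow 5).aestronglyMeasurable
  rw [← Ioc_union_Ioi_eq_Ioi (by norm_num : (0 : ℝ) ≤ 5)]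
  refine IntegrableOn.union ?_ ?_
  · refine Integrable.mono' (integrable_const (3073 ^ 2 * 5 ^ 5 : ℝ))
      (hm2.mono_set Ioc_subset_Ioi_self) ((ae_restrict_iff' measurableSet_Ioc).2
        (Eventually.of_forall fun r hr => ?_))
    have hr0 := hr.1
    rw [Real.norm_eq_abs, abs_of_nonneg (by positivity)]
    rcases le_total r 1 with h | h
    · have h2 := pow_le_pow_left₀ (abs_nonneg _) (Gam_near_zero hr0 h) 2
      rw [sq_abs] at h2
      calc _ ≤ (4 / r ^ 2) ^ 2 * r ^ 5 := by gcongr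
        _ = 16 * r := by field_simp; norm_num
        _ ≤ _ := by norm_num; linarith
    · have hiv : |iv r| ≤ 1 := by
        rw [iv, abs_of_pos (by positivity)]
        exact inv_le_one_of_one_le₀ (one_le_pow₀ h)
      have h3 : |iv r - 8 * Gam r| ≤ 3073 := by
        have h4 := Gam_bounded h
        rw [abs_le] at *
        constructor <;> linarith
      have h2 := pow_le_pow_left₀ (abs_nonneg _) h3 2
      rw [sq_abs] at h2
      exact mul_le_mul h2 (pow_le_pow_left₀ hr0.le hr.2 5) (by positivity) (by positivity)
  · refine (iv_L2 (by norm_num : (0 : ℝ) < 5)).1.2.congr_fun (fun r hr => ?_) measurableSet_Ioi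
    simp only [Gam_zero (sqrt24_le.trans (le_of_lt hr)), mul_zero, sub_zero]

lemma isOpen_Cone (R : ℝ) : IsOpen (Cone R) :=
  isOpen_lt (by fun_prop) (by fun_prop)

/-- A `C²` function on the exterior cone. -/
def Wv.ofC2 {R : ℝ} (g : ℝ × ℝ → ℝ) (hg : ContDiffOn ℝ 2 g (Cone R)) : Wv R :=
  have hd : ∀ z ∈ Cone R, ContDiffAt ℝ 2 g z := fun z hz =>
    hg.contDiffAt ((isOpen_Cone R).mem_nhds hz)
  have h1 : ∀ z ∈ Cone R, HasFDerivAt (fderiv ℝ g) (fderiv ℝ (fderiv ℝ g) z) z := fun z hz =>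
    (((hd z hz).fderiv_right (m := 1) (by norm_num)).differentiableAt (by norm_num)).hasFDerivAt
  have h2 : ContinuousOn (fderiv ℝ (fderiv ℝ g)) (Cone R) := fun z hz =>
    ((((hd z hz).fderiv_right (m := 1) (by norm_num)).fderiv_right (m := 0)
      (by norm_num)).continuousAt).continuousWithinAt
  { u := fun t r => g (t, r)
    ut := fun t r => fderiv ℝ g (t, r) (1, 0)
    ur := fun t r => fderiv ℝ g (t, r) (0, 1)
    utt := fun t r => fderiv ℝ (fderiv ℝ g) (t, r) (1, 0) (1, 0)
    utr := fun t r => fderiv ℝ (fderiv ℝ g) (t, r) (0, 1) (1, 0)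
    urr := fun t r => fderiv ℝ (fderiv ℝ g) (t, r) (0, 1) (0, 1)
    hu := fun t r h => by
      refine ((hd (t, r) h).differentiableAt (by norm_num)).hasFDerivAt.congr_fderiv ?_
      ext <;> simp
    hut := fun t r h => by
      refine ((h1 (t, r) h).clm_apply (hasFDerivAt_const ((1, 0) : ℝ × ℝ) (t, r))).congr_fderiv ?_
      ext <;> simp
    hur := fun t r h => by
      refine ((h1 (t, r) h).clm_apply (hasFDerivAt_const ((0, 1) : ℝ × ℝ) (t, r))).congr_fderiv ?_
      have := (hd (t, r) h).isSymmSndFDerivAt (by simp) (0, 1) (1, 0)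
      ext <;> simp [this]
    ctt := (h2.clm_apply continuousOn_const).clm_apply continuousOn_const
    ctr := (h2.clm_apply continuousOn_const).clm_apply continuousOn_const
    crr := (h2.clm_apply continuousOn_const).clm_apply continuousOn_const }

lemma norm_e0 : ‖e0‖ = 1 := by simp [e0]

lemma norm_smul_e0 {r : ℝ} (hr : 0 ≤ r) : ‖r • e0‖ = r := by
  rw [norm_smul, norm_e0, mul_one, Real.norm_of_nonneg hr]

lemma hasFDerivAt_norm {x : E6} (hx : x ≠ 0) :
    HasFDerivAt (fun y : E6 => ‖y‖) (‖x‖⁻¹ • innerSL ℝ x) x := by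
  have h := (hasStrictFDerivAt_norm_sq x).hasFDerivAt.sqrt (by simpa using hx)
  have e : (fun y : E6 => √(‖y‖ ^ 2)) = fun y => ‖y‖ := by
    funext y; exact Real.sqrt_sq (norm_nonneg y)
  rw [e, Real.sqrt_sq (norm_nonneg x)] at h
  refine h.congr_fderiv ?_
  ext v
  simp
  field_simp

section Radial
variable {f : E6 → ℝ} {h h' h'' : ℝ → ℝ} {ρ : ℝ}

lemma radial_fderiv (hρ : 0 ≤ ρ) (hf : ∀ x, ρ < ‖x‖ → f x = h ‖x‖)
    (h1 : ∀ r, ρ < r → HasDerivAt h (h' r) r) {x : E6} (hx : ρ < ‖x‖) :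
    HasFDerivAt f ((h' ‖x‖ * ‖x‖⁻¹) • innerSL ℝ x) x := by
  have hx0 : x ≠ 0 := norm_pos_iff.1 (hρ.trans_lt hx)
  have hc := HasDerivAt.comp_hasFDerivAt x (f := fun y : E6 => ‖y‖) (h1 _ hx)
    (hasFDerivAt_norm hx0)
  rw [smul_smul] at hc
  refine hc.congr_of_eventuallyEq ?_
  filter_upwards [(isOpen_lt continuous_const continuous_norm).mem_nhds hx] with y hy
  exact hf y hy

lemma radial_gradient (hρ : 0 ≤ ρ) (hf : ∀ x, ρ < ‖x‖ → f x = h ‖x‖)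
    (h1 : ∀ r, ρ < r → HasDerivAt h (h' r) r) {x : E6} (hx : ρ < ‖x‖) :
    ‖gradient f x‖ ^ 2 = h' ‖x‖ ^ 2 := by
  have hx0 : 0 < ‖x‖ := hρ.trans_lt hx
  rw [gradient, LinearIsometryEquiv.norm_map, (radial_fderiv hρ hf h1 hx).fderiv, norm_smul,
    innerSL_apply_norm, mul_pow, Real.norm_eq_abs, sq_abs]
  field_simp

lemma radial_laplacian (hρ : 0 ≤ ρ) (hf : ∀ x, ρ < ‖x‖ → f x = h ‖x‖)
    (h1 : ∀ r, ρ < r → HasDerivAt h (h' r) r) (h2 : ∀ r, ρ < r → HasDerivAt h' (h'' r) r)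
    {r : ℝ} (hr : ρ < r) : lap6 f (r • e0) = h'' r + 5 * h' r / r := by
  have hr0 : 0 < r := hρ.trans_lt hr
  have hn : ‖r • e0‖ = r := norm_smul_e0 hr0.le
  have hx0 : r • e0 ≠ 0 := norm_pos_iff.1 (by rw [hn]; exact hr0)
  have key : ∀ i : Fin 6, fderiv ℝ (fun y => fderiv ℝ f y (EuclideanSpace.single i 1)) (r • e0)
      (EuclideanSpace.single i 1) =
      (h'' r * r⁻¹ - h' r * r⁻¹ ^ 2) * r⁻¹ * ((r • e0) i) ^ 2 + h' r * r⁻¹ := by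
    intro i
    have hev : (fun y => fderiv ℝ f y (EuclideanSpace.single i 1)) =ᶠ[𝓝 (r • e0)]
        fun y => (h' ‖y‖ * ‖y‖⁻¹) * y i := by
      filter_upwards [(isOpen_lt continuous_const continuous_norm).mem_nhds
        (show ρ < ‖r • e0‖ by rw [hn]; exact hr)] with y hy
      rw [(radial_fderiv hρ hf h1 hy).fderiv]
      simp [EuclideanSpace.inner_single_right]
    rw [hev.fderiv_eq]
    have hq : HasDerivAt (fun s => h' s * s⁻¹) (h'' r * r⁻¹ - h' r * r⁻¹ ^ 2) r := by
      refine ((h2 r hr).mul (hasDerivAt_inv hr0.ne')).congr_deriv ?_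
      field_simp
      try ring
    rw [← hn] at hq
    have hq2 := HasDerivAt.comp_hasFDerivAt (r • e0) (f := fun y : E6 => ‖y‖) hq
      (hasFDerivAt_norm hx0)
    have hp : HasFDerivAt (fun y : E6 => y i) (EuclideanSpace.proj i : E6 →L[ℝ] ℝ) (r • e0) :=
      (EuclideanSpace.proj i : E6 →L[ℝ] ℝ).hasFDerivAt
    have hm := hq2.mul hp
    rw [hn] at hm
    have hm' : fderiv ℝ (fun y : E6 => (h' ‖y‖ * ‖y‖⁻¹) * y i) (r • e0) = _ := hm.fderiv
    rw [hm']
    simp [EuclideanSpace.inner_single_right, hn]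
    ring
  rw [lap6, Finset.sum_congr rfl fun i _ => key i, Finset.sum_add_distrib, ← Finset.mul_sum]
  have hs : ∑ i : Fin 6, ((r • e0) i) ^ 2 = r ^ 2 := by
    have := EuclideanSpace.norm_sq_eq (r • e0)
    rw [hn] at this
    rw [this]
    simp only [Real.norm_eq_abs, sq_abs]
  rw [hs]
  simp
  field_simp
  ring

end Radial

/-- The radial profile of a radial solution outside a light cone. -/
lemma exists_profile {R : ℝ} (hR : 0 ≤ R) {u : ℝ → E6 → ℝ}
    (hu : ContDiffOn ℝ 2 (fun p : ℝ × E6 => u p.1 p.2) {p : ℝ × E6 | R + |p.1| ≤ ‖p.2‖})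
    (hrad : ∀ t x y, ‖x‖ = ‖y‖ → R + |t| ≤ ‖x‖ → u t x = u t y)
    (heq : ∀ t x, R + |t| ≤ ‖x‖ → dttu u t x - lap6 (u t) x + V6 x * u t x = 0) :
    ∃ w : Wv R, (∀ t r, w.u t r = u t (r • e0)) ∧
      (∀ t r, R + |t| < r → w.P t r = vv r * w.u t r) ∧
      (∀ t x, R + |t| < ‖x‖ → dtu u t x = w.ut t ‖x‖) ∧
      (∀ t x, R + |t| < ‖x‖ → eDensity u t x = w.ut t ‖x‖ ^ 2 + w.ur t ‖x‖ ^ 2) := by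
  have hg : ContDiffOn ℝ 2 (fun z : ℝ × ℝ => u z.1 (z.2 • e0)) (Cone R) := by
    refine hu.comp (g := fun p : ℝ × E6 => u p.1 p.2) (f := fun z : ℝ × ℝ => (z.1, z.2 • e0))
      (by fun_prop) fun z hz => ?_
    have hz' : R + |z.1| < z.2 := hz
    have : 0 ≤ z.2 := by linarith [abs_nonneg z.1]
    change R + |z.1| ≤ ‖z.2 • e0‖
    rw [norm_smul_e0 this]; exact hz'.le
  let w : Wv R := Wv.ofC2 _ hg
  have hwu : ∀ t r, w.u t r = u t (r • e0) := fun t r => rfl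
  have hU : ∀ t x, R + |t| < ‖x‖ → u t x = w.u t ‖x‖ := fun t x hx =>
    hrad t _ _ (norm_smul_e0 (norm_nonneg x)).symm hx.le
  have nh : ∀ t (x : E6), R + |t| < ‖x‖ → ∀ᶠ s in 𝓝 t, R + |s| < ‖x‖ := fun t x hx =>
    (isOpen_lt (by fun_prop : Continuous fun s : ℝ => R + |s|) continuous_const).mem_nhds hx
  have hdt : ∀ t x, R + |t| < ‖x‖ → dtu u t x = w.ut t ‖x‖ := fun t x hx => by
    have : (fun s => u s x) =ᶠ[𝓝 t] fun s => w.u s ‖x‖ := by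
      filter_upwards [nh t x hx] with s hs using hU s x hs
    rw [dtu, this.deriv_eq, (w.hu t _ hx).dt.deriv]
  have hpos : ∀ t : ℝ, 0 ≤ R + |t| := fun t => add_nonneg hR (abs_nonneg t)
  refine ⟨w, hwu, fun t r hr => ?_, hdt, fun t x hx => ?_⟩
  · have hr0 : 0 < r := (hpos t).trans_lt hr
    have hn := norm_smul_e0 hr0.le
    have hx : R + |t| < ‖r • e0‖ := by rw [hn]; exact hr
    have htt : dttu u t (r • e0) = w.utt t r := by
      have : (fun s => dtu u s (r • e0)) =ᶠ[𝓝 t] fun s => w.ut s r := by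
        filter_upwards [nh t _ hx] with s hs
        rw [hdt s _ hs, hn]
      rw [dttu, this.deriv_eq, (w.hut t _ hr).dt.deriv]
    have hl := radial_laplacian (hpos t) (hU t) (fun s hs => (w.hu t s hs).dr)
      (fun s hs => (w.hur t s hs).dr) hr
    have h := heq t (r • e0) hx.le
    rw [htt, hl, V6, W6, hn, ← hwu] at h
    rw [Wv.P, vv, kk, inv_pow]
    linarith
  · rw [eDensity, hdt t x hx, radial_gradient (hpos t) (hU t) (fun s hs => (w.hu t s hs).dr) hx]

/-- The area of the unit sphere of `ℝ⁶`. -/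
def area6 : ℝ := 6 * volume.real (Metric.ball (0 : E6) 1)

lemma area6_pos : 0 < area6 := by
  have : 0 < volume.real (Metric.ball (0 : E6) 1) :=
    ENNReal.toReal_pos (Metric.measure_ball_pos volume _ one_pos).ne' measure_ball_lt_top.ne
  unfold area6; positivity

lemma polar {ρ : ℝ} (hρ : 0 ≤ ρ) (F : ℝ → ℝ) :
    (IntegrableOn (fun x : E6 => F ‖x‖) {x | ρ < ‖x‖} ↔
      IntegrableOn (fun r => r ^ 5 * F r) (Ioi ρ)) ∧
    (∫ x in {x : E6 | ρ < ‖x‖}, F ‖x‖) = area6 * ∫ r in Ioi ρ, r ^ 5 * F r := by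
  have hm : MeasurableSet {x : E6 | ρ < ‖x‖} :=
    (isOpen_lt continuous_const continuous_norm).measurableSet
  have e1 : {x : E6 | ρ < ‖x‖}.indicator (fun x => F ‖x‖) = fun x => (Ioi ρ).indicator F ‖x‖ := by
    funext x
    simp [indicator]
  have hdim : Module.finrank ℝ E6 - 1 = 5 := by simp
  have e2 : (fun r : ℝ => r ^ 5 * (Ioi ρ).indicator F r) =
      (Ioi ρ).indicator (fun r => r ^ 5 * F r) := by
    funext r
    simp [indicator]
  have hI : Ioi (0 : ℝ) ∩ Ioi ρ = Ioi ρ := by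
    rw [Ioi_inter_Ioi, sup_eq_right.2 hρ]
  constructor
  · rw [← integrable_indicator_iff hm, e1, integrable_fun_norm_addHaar volume, hdim]
    simp only [smul_eq_mul]
    rw [e2, IntegrableOn, integrable_indicator_iff measurableSet_Ioi, IntegrableOn,
      Measure.restrict_restrict measurableSet_Ioi, inter_comm, hI, IntegrableOn]
  · rw [← integral_indicator hm, e1, integral_fun_norm_addHaar volume, hdim]
    simp only [smul_eq_mul]
    rw [e2, setIntegral_indicator measurableSet_Ioi, hI, area6]
    simp [mul_assoc]

lemma setIntegral_norm_le (ρ : ℝ) (f : E6 → ℝ) :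
    (∫ x in {x : E6 | ρ ≤ ‖x‖}, f x) = ∫ x in {x : E6 | ρ < ‖x‖}, f x := by
  have e : {x : E6 | ρ ≤ ‖x‖} = {x : E6 | ρ < ‖x‖} ∪ Metric.sphere 0 ρ := by
    ext x
    simp [le_iff_lt_or_eq, eq_comm]
  refine setIntegral_congr_set ?_
  rw [e]
  exact union_ae_eq_left_of_ae_eq_empty (ae_eq_empty.2 (Measure.addHaar_sphere volume 0 ρ))

lemma L2.of_density {ρ : ℝ} (hρ : 0 ≤ ρ) {f e : ℝ → ℝ} (hf : ContinuousOn f (Ioi ρ))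
    (he : IntegrableOn (fun r => r ^ 5 * e r) (Ioi ρ)) (h : ∀ r, ρ < r → f r ^ 2 ≤ e r) :
    L2 ρ f :=
  (L2_of_density hρ hf he h (Real.sq_sqrt (setIntegral_nonneg measurableSet_Ioi fun r hr =>
    mul_nonneg (pow_pos (hρ.trans_lt hr) 5).le ((sq_nonneg _).trans (h r hr)))).ge
    (Real.sqrt_nonneg _)).1

lemma vv_L2 : L2 0 vv := by
  have hk : ∀ r, 1 < r → |vv r| ≤ 1152 * |iv r| := fun r hr => by
    have hr0 : 0 < r := by linarith
    have h1 : r ^ 2 * kk r ≤ 24 := by linarith [kk_relation r, kk_pos r]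
    have h2 := pow_le_pow_left₀ (mul_nonneg (sq_nonneg r) (kk_pos r).le) h1 2
    have h3 : 0 < iv r := by unfold iv; positivity
    rw [abs_of_nonneg (vv_nonneg r), abs_of_pos h3, iv, vv, ← div_eq_mul_inv,
      le_div_iff₀ (by positivity)]
    linarith
  refine ⟨vv_continuous.aestronglyMeasurable, ?_⟩
  rw [← Ioc_union_Ioi_eq_Ioi (zero_le_one' ℝ)]
  refine IntegrableOn.union ?_
    (L2.of_abs_le zero_le_one (iv_L2 one_pos).1 vv_continuous.continuousOn (by norm_num) hk).1.2
  exact (((vv_continuous.pow 2).mul (continuous_pow 5)).continuousOn.integrableOn_Icc).mono_set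
    Ioc_subset_Icc_self

namespace Wv
variable {R : ℝ} (w : Wv R)

/-- The energy density of a radial wave. -/
def dens (t r : ℝ) : ℝ := w.ut t r ^ 2 + w.ur t r ^ 2

lemma dens_nonneg (t r : ℝ) : 0 ≤ w.dens t r := by unfold dens; positivity

lemma dens_continuousOn (t : ℝ) : ContinuousOn (w.dens t) (Ioi (R + |t|)) :=
  ((slice_continuousOn w.cut t).pow 2).add ((slice_continuousOn w.cur t).pow 2)

lemma initial_bounded (hR : 0 ≤ R) (hc : ContinuousOn (w.u 0) (Ici R))
    (h0 : IntegrableOn (fun r => r ^ 5 * w.dens 0 r) (Ioi R)) :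
    ∃ M, ∀ r, R < r → |w.u 0 r| ≤ M := by
  have hx : ∀ r, R + 1 < r → R + |(0 : ℝ)| < r := fun r hr => by rw [abs_zero]; linarith
  obtain ⟨K, hK⟩ := isCompact_Icc.exists_bound_of_continuousOn
    (hc.mono (Icc_subset_Ici_self : Icc R (R + 2) ⊆ Ici R))
  have cr : ContinuousOn (w.ur 0) (Ioi (R + 1)) :=
    (slice_continuousOn w.cur 0).mono fun r hr => hx r hr
  have hL : L2 (R + 1) (w.ur 0) := L2.of_density (by linarith) cr
    (h0.mono_set (Ioi_subset_Ioi (by linarith))) fun r _ => by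
      unfold dens; nlinarith [sq_nonneg (w.ut 0 r)]
  obtain ⟨N, hN⟩ : ∃ N, N = nrm (R + 1) (w.ur 0) ^ 2 * (4 * (R + 2) ^ 4)⁻¹ := ⟨_, rfl⟩
  have hK0 : 0 ≤ K := (norm_nonneg _).trans (hK (R + 2) ⟨by linarith, le_rfl⟩)
  have hN0 : 0 ≤ N := by rw [hN]; positivity
  refine ⟨K + (1 + N), fun r hr => ?_⟩
  rcases le_total r (R + 2) with h | h
  · have := hK r ⟨hr.le, h⟩
    rw [Real.norm_eq_abs] at this
    linarith
  · have h1 := radial_increment_le (by linarith) (fun r hr => (w.hu 0 r (hx r hr)).dr) cr hL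
      (r := R + 2) (by linarith) h
    rw [← hN] at h1
    have h2 : |w.u 0 r - w.u 0 (R + 2)| ≤ 1 + N :=
      abs_le_of_sq_le_sq (by nlinarith) (by linarith)
    have h3 := hK (R + 2) ⟨by linarith, le_rfl⟩
    rw [Real.norm_eq_abs] at h3
    have h4 := abs_sub_abs_le_abs_sub (w.u 0 r) (w.u 0 (R + 2))
    linarith

/-- Finite energy propagates to the exterior slices at positive times. -/
lemma dens_integrable (hR : 0 ≤ R) (heq : ∀ t r, R + |t| < r → w.P t r = vv r * w.u t r)
    (h0 : IntegrableOn (fun r => r ^ 5 * w.dens 0 r) (Ioi R)) {M : ℝ}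
    (hM : ∀ r, R < r → |w.u 0 r| ≤ M) {T : ℝ} (hT : 0 ≤ T) :
    IntegrableOn (fun r => r ^ 5 * w.dens T r) (Ioi (R + T)) := by
  have hc0 : ContinuousOn (w.u 0) (Ioi R) := by
    have := slice_continuousOn w.cu 0
    rwa [abs_zero, add_zero] at this
  have hvu : L2 R (fun r => vv r * w.u 0 r) :=
    (L2.of_abs_le hR (vv_L2.mono hR) (vv_continuous.continuousOn.mul hc0)
      (le_max_right M 0) fun r hr => by
        change |vv r * w.u 0 r| ≤ _
        rw [abs_mul, mul_comm]
        exact mul_le_mul_of_nonneg_right ((hM r hr).trans (le_max_left M 0)) (abs_nonneg _)).1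
  have hi : IntegrableOn (fun r => r ^ 5 * w.en (fun r => vv r ^ 2) 0 r) (Ioi R) := by
    refine (h0.add hvu.2).congr_fun (fun r _ => ?_) measurableSet_Ioi
    simp only [Pi.add_apply, en, dens]; ring
  have hen : ∀ t r, 0 ≤ w.en (fun r => vv r ^ 2) t r := fun t r => by unfold en; positivity
  have hsub : ∀ x, R + T < x → ∀ r, x < r → R + |T| < r := fun x hx r hr => by
    rw [abs_of_nonneg hT]; linarith
  refine (integrableOn_of_exhaustion (C := exp (4 * (T - 0)) *
    ((∫ r in Ioi R, r ^ 5 * w.en (fun r => vv r ^ 2) 0 r) + 0 ^ 2)) ?_ (fun r hr => ?_)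
    fun x m hx hm => ?_).1
  · have := w.dens_continuousOn T
    rw [abs_of_nonneg hT] at this
    exact (continuous_pow 5).continuousOn.mul this
  · have : 0 < r := by have := mem_Ioi.1 hr; linarith
    have := w.dens_nonneg T r
    positivity
  obtain ⟨ρ, hρ⟩ : ∃ ρ, ρ = (x - T + R) / 2 := ⟨_, rfl⟩
  have hρR : R < ρ := by rw [hρ]; linarith
  have hρx : ρ + T < x := by rw [hρ]; linarith
  have hρ0 : 0 < ρ := hR.trans_lt hρR
  have hr5 : ∀ r ∈ Ioi R, 0 ≤ r ^ 5 * w.en (fun r => vv r ^ 2) 0 r := fun r hr => by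
    have : 0 < r := hR.trans_lt hr
    exact mul_nonneg (by positivity) (hen 0 r)
  obtain ⟨j1, j2⟩ := (w.restrict hρR.le).energy_estimate (ω := fun r => vv r ^ 2)
    (ω' := fun r => 2 * vv r * (-(r / 3) * kk r ^ 3)) hρ0
    (fun r _ => ((vv_deriv r).pow 2).congr_deriv (by push_cast; ring))
    (((vv_continuous.const_mul 2).mul (by
      have := kk_continuous
      fun_prop)).continuousOn) (fun r _ => sq_nonneg _)
    (c := 0) hT (H := fun t => t) (κ := fun _ => 1) (fun t _ => hasDerivAt_id t)
    (fun _ _ => zero_le_one) (fun t ht r hr => by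
      have e : (w.restrict hρR.le).P t r = vv r * w.u t r :=
        heq t r (by rw [abs_of_nonneg ht.1]; linarith)
      have hv2 : vv r ≤ 2 := by
        have := pow_le_one₀ (n := 2) (kk_pos r).le (kk_le_one r)
        unfold vv; linarith
      have hv0 := vv_nonneg r
      rw [e]
      change 2 * w.ut t r * (vv r * w.u t r) + 2 * vv r ^ 2 * w.u t r * w.ut t r ≤
        1 * (4 * (w.ut t r ^ 2 + w.ur t r ^ 2 + vv r ^ 2 * w.u t r ^ 2) + 2 * 0 ^ 2 * _)
      generalize vv r = v at *
      generalize w.u t r = a at *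
      generalize w.ut t r = b at *
      generalize w.ur t r = d at *
      nlinarith [sq_nonneg (b - v * a), mul_nonneg hv0 (sq_nonneg (b - v * a)),
        mul_nonneg (by linarith : 0 ≤ 2 - v) (sq_nonneg b),
        mul_nonneg (by linarith : 0 ≤ 2 - v) (sq_nonneg (v * a)), sq_nonneg d])
    (hi.mono_set (Ioi_subset_Ioi hρR.le))
    (setIntegral_mono_set hi ((ae_restrict_iff' measurableSet_Ioi).2 (Eventually.of_forall hr5))
      (Ioi_subset_Ioi hρR.le).eventuallyLE)
  have hx0 : ∀ r, ρ + T < r → 0 < r := fun r hr => by linarith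
  have hle : ∀ r, ρ + T < r → r ^ 5 * w.dens T r ≤ r ^ 5 * w.en (fun r => vv r ^ 2) T r :=
    fun r hr => mul_le_mul_of_nonneg_left (by
      have : 0 ≤ vv r ^ 2 * w.u T r ^ 2 := by positivity
      unfold dens en; linarith) (pow_pos (hx0 r hr) 5).le
  have hcI : IntervalIntegrable (fun r => r ^ 5 * w.dens T r) volume x m := by
    refine ContinuousOn.intervalIntegrable_of_Icc hm ((continuous_pow 5).continuousOn.mul
      ((w.dens_continuousOn T).mono fun r hr => ?_))
    rw [abs_of_nonneg hT]; exact hx.trans_le hr.1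
  have hcE : IntervalIntegrable (fun r => r ^ 5 * w.en (fun r => vv r ^ 2) T r) volume x m := by
    rw [intervalIntegrable_iff_integrableOn_Ioc_of_le hm]
    exact j1.mono_set fun r hr => hρx.trans hr.1
  calc _ ≤ ∫ r in x..m, r ^ 5 * w.en (fun r => vv r ^ 2) T r :=
        intervalIntegral.integral_mono_on hm hcI hcE fun r hr => hle r (hρx.trans_le hr.1)
    _ ≤ _ := interval_le_Ioi j1 (fun r hr =>
        mul_nonneg (pow_pos (hx0 r hr) 5).le (hen T r)) hρx.le hm
    _ ≤ _ := j2

lemma _root_.HD.of_eq {f : ℝ → ℝ → ℝ} {A B A' B' t r : ℝ} (h : HD f A B t r) (hA : A = A')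
    (hB : B = B') : HD f A' B' t r := by rwa [← hA, ← hB]

lemma _root_.HD.rev {f : ℝ → ℝ → ℝ} {A B t r : ℝ} (h : HD f A B (-t) r) :
    HD (fun t r => f (-t) r) (-A) B t r := by
  have h1 : HasFDerivAt (fun z : ℝ × ℝ => (-z.1, z.2))
      ((-ContinuousLinearMap.fst ℝ ℝ ℝ).prod (ContinuousLinearMap.snd ℝ ℝ ℝ)) (t, r) :=
    hasFDerivAt_fst.neg.prodMk hasFDerivAt_snd
  refine (HasFDerivAt.comp (t, r) (f := fun z : ℝ × ℝ => (-z.1, z.2)) h h1).congr_fderiv ?_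
  ext <;> simp

lemma continuousOn_rev {f : ℝ → ℝ → ℝ}
    (hf : ContinuousOn (fun z : ℝ × ℝ => f z.1 z.2) (Cone R)) :
    ContinuousOn (fun z : ℝ × ℝ => f (-z.1) z.2) (Cone R) :=
  hf.comp (f := fun z : ℝ × ℝ => (-z.1, z.2)) (by fun_prop) fun z hz => by
    change R + |-z.1| < z.2
    rw [abs_neg]; exact hz

/-- Time reversal. -/
def rev : Wv R where
  u t r := w.u (-t) r
  ut t r := -w.ut (-t) r
  ur t r := w.ur (-t) r
  utt t r := w.utt (-t) r
  utr t r := -w.utr (-t) r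
  urr t r := w.urr (-t) r
  hu t r h := (w.hu (-t) r (by rwa [abs_neg])).rev
  hut t r h := by
    have := (w.hut (-t) r (by rwa [abs_neg])).rev.const_mul (-1)
    simp only [neg_one_mul] at this
    exact this.of_eq (neg_neg _) rfl
  hur t r h := (w.hur (-t) r (by rwa [abs_neg])).rev
  ctt := continuousOn_rev w.ctt
  ctr := (continuousOn_rev w.ctr).neg
  crr := continuousOn_rev w.crr

lemma rev_eq (heq : ∀ t r, R + |t| < r → w.P t r = vv r * w.u t r) :
    ∀ t r, R + |t| < r → w.rev.P t r = vv r * w.rev.u t r := fun t r h =>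
  heq (-t) r (by rwa [abs_neg])

lemma rev_dens (t r : ℝ) : w.rev.dens t r = w.dens (-t) r := by
  change (-w.ut (-t) r) ^ 2 + _ = _
  rw [neg_sq]; rfl

/-- The odd part in time. -/
def oddPart : Wv R where
  u t r := 1 / 2 * w.u t r + -1 / 2 * w.rev.u t r
  ut t r := 1 / 2 * w.ut t r + -1 / 2 * w.rev.ut t r
  ur t r := 1 / 2 * w.ur t r + -1 / 2 * w.rev.ur t r
  utt t r := 1 / 2 * w.utt t r + -1 / 2 * w.rev.utt t r
  utr t r := 1 / 2 * w.utr t r + -1 / 2 * w.rev.utr t r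
  urr t r := 1 / 2 * w.urr t r + -1 / 2 * w.rev.urr t r
  hu t r h := ((w.hu t r h).const_mul _).add ((w.rev.hu t r h).const_mul _)
  hut t r h := ((w.hut t r h).const_mul _).add ((w.rev.hut t r h).const_mul _)
  hur t r h := ((w.hur t r h).const_mul _).add ((w.rev.hur t r h).const_mul _)
  ctt := (w.ctt.const_mul _).add (w.rev.ctt.const_mul _)
  ctr := (w.ctr.const_mul _).add (w.rev.ctr.const_mul _)
  crr := (w.crr.const_mul _).add (w.rev.crr.const_mul _)

lemma oddPart_ut_zero (r : ℝ) : w.oddPart.ut 0 r = w.ut 0 r := by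
  change 1 / 2 * w.ut 0 r + -1 / 2 * -w.ut (-0) r = _
  rw [neg_zero]; ring

lemma oddPart_isSol (hR : 0 ≤ R) (heq : ∀ t r, R + |t| < r → w.P t r = vv r * w.u t r)
    (h0 : IntegrableOn (fun r => r ^ 5 * w.dens 0 r) (Ioi R)) : IsSol w.oddPart 0 where
  odd r _ := by
    change 1 / 2 * w.u 0 r + -1 / 2 * w.u (-0) r = 0
    rw [neg_zero]; ring
  eq t r h := by
    have h1 := heq t r h
    have h2 := w.rev_eq heq t r h
    have e : w.oddPart.P t r = 1 / 2 * w.P t r + -1 / 2 * w.rev.P t r := by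
      unfold P oddPart; simp only []; ring
    have e2 : w.oddPart.u t r = 1 / 2 * w.u t r + -1 / 2 * w.rev.u t r := rfl
    rw [e, e2, h1, h2]; ring
  fin := by
    have hc := slice_continuousOn w.cut 0
    rw [abs_zero, add_zero] at hc
    have := L2.of_density hR hc h0 fun r _ => by
      unfold dens; nlinarith [sq_nonneg (w.ur 0 r)]
    have e : w.oddPart.ut 0 = w.ut 0 := funext w.oddPart_ut_zero
    rw [e]; exact this

lemma oddPart_dens_le (t r : ℝ) :
    w.oddPart.dens t r ≤ (1 / 2) * (w.dens t r + w.dens (-t) r) := by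
  change (1 / 2 * w.ut t r + -1 / 2 * -w.ut (-t) r) ^ 2 +
    (1 / 2 * w.ur t r + -1 / 2 * w.ur (-t) r) ^ 2 ≤ _
  unfold dens
  nlinarith [sq_nonneg (w.ut t r - w.ut (-t) r), sq_nonneg (w.ur t r + w.ur (-t) r)]

end Wv

lemma Wv.oddPart_bd {R : ℝ} (w : Wv R) (hR : 0 ≤ R)
    (heq : ∀ t r, R + |t| < r → w.P t r = vv r * w.u t r)
    (h0 : IntegrableOn (fun r => r ^ 5 * w.dens 0 r) (Ioi R)) {M : ℝ}
    (hM : ∀ r, R < r → |w.u 0 r| ≤ M) {T B : ℝ} (hT : 0 ≤ T) (hB : 0 ≤ B)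
    (h : (∫ r in Ioi (R + T), r ^ 5 * w.dens T r) + (∫ r in Ioi (R + T), r ^ 5 * w.dens (-T) r) ≤
      2 * B ^ 2) : w.oddPart.Bd T B := by
  have hρ : 0 ≤ R + T := by linarith
  have i1 := w.dens_integrable hR heq h0 hM hT
  have i2 : IntegrableOn (fun r => r ^ 5 * w.dens (-T) r) (Ioi (R + T)) := by
    have := w.rev.dens_integrable hR (w.rev_eq heq) (by simpa only [rev_dens, neg_zero] using h0)
      (M := M) (fun r hr => by
        change |w.u (-0) r| ≤ M
        rw [neg_zero]; exact hM r hr) hT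
    simpa only [rev_dens] using this
  have e : (fun r => r ^ 5 * (1 / 2 * (w.dens T r + w.dens (-T) r))) =
      fun r => 1 / 2 * (r ^ 5 * w.dens T r + r ^ 5 * w.dens (-T) r) := by funext r; ring
  have hi : IntegrableOn (fun r => r ^ 5 * (1 / 2 * (w.dens T r + w.dens (-T) r)))
      (Ioi (R + T)) := by
    rw [e]; exact (i1.add i2).const_mul _
  have hI : (∫ r in Ioi (R + T), r ^ 5 * (1 / 2 * (w.dens T r + w.dens (-T) r))) ≤ B ^ 2 := by
    rw [e, integral_const_mul, integral_add i1 i2]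
    linarith
  have c1 := slice_continuousOn w.oddPart.cut T
  have c2 := slice_continuousOn w.oddPart.cur T
  rw [abs_of_nonneg hT] at c1 c2
  have a1 := L2_of_density hρ c1 hi (fun r _ => by
    refine le_trans ?_ (w.oddPart_dens_le T r)
    unfold dens; nlinarith [sq_nonneg (w.oddPart.ur T r)]) hI hB
  have a2 := L2_of_density hρ c2 hi (fun r _ => by
    refine le_trans ?_ (w.oddPart_dens_le T r)
    unfold dens; nlinarith [sq_nonneg (w.oddPart.ut T r)]) hI hB
  exact ⟨a1.1, a2.1, a1.2, a2.2⟩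

lemma nrm_zero_le {f : ℝ → ℝ} (hf : ContinuousOn f (Ioi 0)) (h2 : L2 0 f) {B : ℝ} (hB : 0 ≤ B)
    (h : ∀ x, 0 < x → nrm x f ≤ B) : nrm 0 f ≤ B := by
  refine nrm_le_of_sq hB ?_
  refine (integrableOn_of_exhaustion (hf.pow 2 |>.mul (continuous_pow 5).continuousOn)
    (fun r hr => by
      have : 0 < r := hr
      exact mul_nonneg (sq_nonneg (f r)) (pow_pos this 5).le) fun x M hx hM => ?_).2
  refine (interval_le_Ioi (h2.mono hx.le).2 (fun r hr => ?_) le_rfl hM).trans ?_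
  · have : 0 < r := hx.trans hr
    positivity
  · rw [← nrm_sq hx.le]
    exact pow_le_pow_left₀ (nrm_nonneg x f) (h x hx) 2

lemma singular_L2 {χ : ℝ → ℝ} (hχ : ∀ r, r ≤ 10 → χ r = 1) {R : ℝ} (hR : 0 < R) :
    L2 R (fun r => χ r * Gam r) :=
  (((iv_L2 hR).1.sub hR.le ((Gam_L2 hχ).mono hR.le)).const_mul (1 / 8)).congr fun r _ => by
    ring

/-- The time derivative is controlled modulo the zero modes. -/
theorem span_estimate {χ : ℝ → ℝ} (hχ : ∀ r, r ≤ 10 → χ r = 1) :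
    ∃ K, 0 < K ∧ ∀ (R : ℝ) (w : Wv R), 0 ≤ R → IsSol w 0 → ∀ B, 0 < B →
      (∃ᶠ T in atTop, w.Bd T B) → ∃ c d, ((R = 0 ∨ 1 ≤ R) → d = 0) ∧
        nrm R (fun r => w.ut 0 r - c * LW1 r - d * (χ r * Gam r)) ≤ K * B := by
  obtain ⟨C, Rb, hC, hRb, H⟩ := core_estimate
  obtain ⟨he0, he1⟩ := epsC_bounds
  have hG := nrm_nonneg 0 (fun r => iv r - 8 * (χ r * Gam r))
  refine ⟨C * (1 + nrm 0 (fun r => iv r - 8 * (χ r * Gam r))), by positivity, ?_⟩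
  intro R w hR hw B hB hBd
  have hmx : 0 < max R Rb := lt_of_lt_of_le (by linarith) (le_max_right R Rb)
  have hRm : R ≤ max R Rb := le_max_left R Rb
  -- the coefficient of `ΛW`
  obtain ⟨c, hc⟩ : ∃ c, (∫ r in Ioi (max R Rb), (w.ut 0 r - c * LW1 r) * iv r * r ^ 5) = 0 := by
    have hne : (∫ r in Ioi (max R Rb), LW1 r * iv r * r ^ 5) ≠ 0 := by
      rw [LW1_inner hmx]
      have := kk_pos (max R Rb)
      exact neg_ne_zero.2 (by positivity)
    refine ⟨(∫ r in Ioi (max R Rb), w.ut 0 r * iv r * r ^ 5) /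
      ∫ r in Ioi (max R Rb), LW1 r * iv r * r ^ 5, ?_⟩
    obtain ⟨q, hq⟩ : ∃ q, q = (∫ r in Ioi (max R Rb), w.ut 0 r * iv r * r ^ 5) /
      ∫ r in Ioi (max R Rb), LW1 r * iv r * r ^ 5 := ⟨_, rfl⟩
    rw [← hq]
    have e : (fun r => (w.ut 0 r - q * LW1 r) * iv r * r ^ 5) =
        fun r => w.ut 0 r * iv r * r ^ 5 - q * (LW1 r * iv r * r ^ 5) := by funext r; ring
    have i1 : Integrable (fun r => w.ut 0 r * iv r * r ^ 5) (volume.restrict (Ioi (max R Rb))) :=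
      (hw.fin.mono hRm).integrable_mul hmx.le (iv_L2 hmx).1
    have i2 : Integrable (fun r => q * (LW1 r * iv r * r ^ 5))
        (volume.restrict (Ioi (max R Rb))) :=
      ((LW1_L2 hmx.le).integrable_mul hmx.le (iv_L2 hmx).1).const_mul q
    rw [e, integral_sub i1 i2, integral_const_mul, hq, div_mul_cancel₀ _ hne, sub_self]
  have hCK : C * B ≤ C * (1 + nrm 0 (fun r => iv r - 8 * (χ r * Gam r))) * B := by
    have : 0 ≤ C * nrm 0 (fun r => iv r - 8 * (χ r * Gam r)) * B := by positivity
    linarith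
  have hm : L2 R (fun r => w.ut 0 r - c * LW1 r) := hw.fin.sub hR ((LW1_L2 hR).const_mul c)
  rcases hR.eq_or_lt with h0 | hR0
  · -- the case of the full cone
    refine ⟨c, 0, fun _ => rfl, ?_⟩
    simp only [zero_mul, sub_zero]
    refine le_trans ?_ hCK
    subst h0
    have hcont : ContinuousOn (fun r => w.ut 0 r - c * LW1 r) (Ioi 0) := by
      have := Wv.slice_continuousOn w.cut 0
      rw [abs_zero, add_zero] at this
      exact this.sub (LW1_continuous.const_mul c).continuousOn
    refine nrm_zero_le hcont hm (by positivity) fun x hx => ?_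
    obtain ⟨N, hN⟩ : ∃ N, N = nrm 0 (fun r => w.ut 0 r - c * LW1 r) := ⟨_, rfl⟩
    have hN0 : 0 ≤ N := hN ▸ nrm_nonneg _ _
    refine le_of_forall_pos_le_add fun δ hδ => ?_
    obtain ⟨ρ, hρ0, hρx, hρe, hρδ⟩ : ∃ ρ, 0 < ρ ∧ ρ ≤ x ∧ ρ ≤ epsC ∧ 2 * ρ * N * (1 / x) ≤ δ := by
      refine ⟨min (min x epsC) (δ * x / (2 * (N + 1))), by positivity,
        (min_le_left _ _).trans (min_le_left _ _), (min_le_left _ _).trans (min_le_right _ _), ?_⟩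
      have h1 := min_le_right (min x epsC) (δ * x / (2 * (N + 1)))
      generalize min (min x epsC) (δ * x / (2 * (N + 1))) = ρ at *
      rw [le_div_iff₀ (by positivity)] at h1
      rw [mul_one_div, div_le_iff₀ hx]
      have : 0 ≤ ρ ∨ ρ < 0 := le_or_gt 0 ρ
      rcases this with h | h <;> nlinarith [mul_pos hδ hx]
    have hmax : max ρ Rb = max 0 Rb := by
      rw [max_eq_right (by linarith), max_eq_right (by linarith)]
    have hmρ : L2 ρ (fun r => w.ut 0 r - c * LW1 r) := hm.mono hρ0.le
    have h1 := ((H ρ (w.restrict hρ0.le) hρ0 (hw.restrict hρ0.le) B hB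
      ((hBd.and_eventually (eventually_ge_atTop 0)).mono fun T hT =>
        hT.1.restrict (by linarith [hT.2]) hρ0.le) c (by rw [hmax]; exact hc)).2 hρe).1
    change nrm ρ (fun r => w.ut 0 r - c * LW1 r -
      ivCoef ρ (fun r => w.ut 0 r - c * LW1 r) * iv r) ≤ C * B at h1
    have h2 := ivCoef_le hρ0 hmρ
    have h3 : nrm ρ (fun r => w.ut 0 r - c * LW1 r) ≤ N := hN ▸ nrm_mono le_rfl hρ0.le hm
    obtain ⟨k, hk⟩ : ∃ k, k = ivCoef ρ (fun r => w.ut 0 r - c * LW1 r) := ⟨_, rfl⟩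
    rw [← hk] at h1 h2
    have l1 : L2 ρ (fun r => w.ut 0 r - c * LW1 r - k * iv r) :=
      hmρ.sub hρ0.le ((iv_L2 hρ0).1.const_mul k)
    have l2 : L2 x (fun r => k * iv r) := (iv_L2 hx).1.const_mul k
    have e : EqOn (fun r => w.ut 0 r - c * LW1 r)
        (fun r => (w.ut 0 r - c * LW1 r - k * iv r) + k * iv r) (Ioi x) := fun r _ => by
      simp only []; ring
    calc nrm x (fun r => w.ut 0 r - c * LW1 r)
        = nrm x (fun r => (w.ut 0 r - c * LW1 r - k * iv r) + k * iv r) := nrm_congr e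
      _ ≤ nrm x (fun r => w.ut 0 r - c * LW1 r - k * iv r) + nrm x (fun r => k * iv r) :=
          nrm_add_le hx.le (l1.mono hρx) l2
      _ ≤ C * B + 2 * ρ * N * (1 / x) := by
          refine add_le_add ((nrm_mono hρ0.le hρx l1).trans h1) ?_
          rw [nrm_const_mul]
          exact mul_le_mul (h2.trans (by gcongr)) (iv_nrm hx) (nrm_nonneg _ _) (by positivity)
      _ ≤ _ := by linarith
  obtain ⟨H1, H2⟩ := H R w hR0 hw B hB hBd c hc
  rcases le_total epsC R with h | h
  · refine ⟨c, 0, fun _ => rfl, ?_⟩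
    simp only [zero_mul, sub_zero]
    exact (H1 h).trans hCK
  · obtain ⟨h1, h2⟩ := H2 h
    obtain ⟨k, hk⟩ : ∃ k, k = ivCoef R (fun r => w.ut 0 r - c * LW1 r) := ⟨_, rfl⟩
    rw [← hk] at h1 h2
    refine ⟨c, 8 * k, fun h' => ?_, ?_⟩
    · rcases h' with h' | h' <;> linarith
    have l1 : L2 R (fun r => w.ut 0 r - c * LW1 r - k * iv r) :=
      hm.sub hR ((iv_L2 hR0).1.const_mul k)
    have l2 := ((Gam_L2 hχ).mono hR).const_mul k
    have e : EqOn (fun r => w.ut 0 r - c * LW1 r - 8 * k * (χ r * Gam r))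
        (fun r => (w.ut 0 r - c * LW1 r - k * iv r) + k * (iv r - 8 * (χ r * Gam r)))
        (Ioi R) := fun r _ => by
      simp only []; ring
    rw [nrm_congr e]
    refine (nrm_add_le hR l1 l2).trans ?_
    rw [nrm_const_mul]
    have h3 := mul_le_mul h2 (nrm_mono le_rfl hR (Gam_L2 hχ)) (nrm_nonneg _ _) (by positivity)
    linarith

/-- An orthogonal projection does not increase the norm. -/
lemma nrm_le_of_orthogonal {R : ℝ} (hR : 0 ≤ R) {F G Y Z : ℝ → ℝ} {a b : ℝ} (hF : L2 R F)
    (hG : L2 R G) (hY : L2 R Y) (hZ : L2 R Z)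
    (e : ∀ r, R < r → F r = G r + a * Y r + b * Z r)
    (h1 : (∫ r in Ioi R, F r * Y r * r ^ 5) = 0) (h2 : b * (∫ r in Ioi R, F r * Z r * r ^ 5) = 0) :
    nrm R F ≤ nrm R G := by
  have i1 := hF.integrable_mul hR hG
  have i2 : Integrable (fun r => a * (F r * Y r * r ^ 5)) (volume.restrict (Ioi R)) :=
    (hF.integrable_mul hR hY).const_mul a
  have i3 : Integrable (fun r => b * (F r * Z r * r ^ 5)) (volume.restrict (Ioi R)) :=
    (hF.integrable_mul hR hZ).const_mul b
  have i12 : Integrable (fun r => F r * G r * r ^ 5 + a * (F r * Y r * r ^ 5))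
      (volume.restrict (Ioi R)) := i1.add i2
  have h3 : nrm R F ^ 2 = ∫ r in Ioi R, F r * G r * r ^ 5 := by
    have : (∫ r in Ioi R, F r ^ 2 * r ^ 5) =
        ∫ r in Ioi R, ((F r * G r * r ^ 5 + a * (F r * Y r * r ^ 5)) +
          b * (F r * Z r * r ^ 5)) := by
      refine setIntegral_congr_fun measurableSet_Ioi fun r hr => ?_
      linear_combination (F r * r ^ 5) * e r hr
    rw [nrm_sq hR, this, integral_add i12 i3, integral_add i1 i2, integral_const_mul,
      integral_const_mul, h1, h2]
    ring
  have h4 := le_of_abs_le (inner_le_nrm hR hF hG)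
  rw [← h3] at h4
  have := nrm_nonneg R F
  have := nrm_nonneg R G
  by_contra! hlt
  nlinarith

/-- Channels of energy for the odd-in-time part of solutions around a soliton. The projection
`Π⊥_{L²_R} u₁ = u₁ - c ΛW - d Γ̃` is characterized by orthogonality in `L²_R` to `ΛW`
(and to `Γ̃ = χ₀Γ` when `0 < R < 1`, in which case `d` need not vanish). -/
theorem stmt3 (χ0 : ℝ → ℝ) (hsm : ContDiff ℝ (⊤ : ℕ∞) χ0)
    (h1 : ∀ r : ℝ, r ≤ 10 → χ0 r = 1) (h0 : ∀ r : ℝ, 12 ≤ r → χ0 r = 0) :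
    ∃ C : ℝ, 0 < C ∧
      ∀ R : ℝ, 0 ≤ R → ∀ (u : ℝ → E6 → ℝ) (Ep Em : ℝ),
        ContDiffOn ℝ 2 (fun p : ℝ × E6 => u p.1 p.2) {p : ℝ × E6 | R + |p.1| ≤ ‖p.2‖} →
        (∀ t x y, ‖x‖ = ‖y‖ → R + |t| ≤ ‖x‖ → u t x = u t y) →
        (∀ t x, R + |t| ≤ ‖x‖ → dttu u t x - lap6 (u t) x + V6 x * u t x = 0) →
        IntegrableOn (fun x => eDensity u 0 x) {x : E6 | R < ‖x‖} →
        Tendsto (fun t => ∫ x in {x : E6 | R + |t| ≤ ‖x‖}, eDensity u t x) atTop (𝓝 Ep) →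
        Tendsto (fun t => ∫ x in {x : E6 | R + |t| ≤ ‖x‖}, eDensity u t x) atBot (𝓝 Em) →
        ∀ c d : ℝ,
          ((R = 0 ∨ 1 ≤ R) → d = 0) →
          (∫ r in Ioi R,
            (dtu u 0 (r • e0) - c * LW1 r - d * (χ0 r * Gam r)) * LW1 r * r ^ 5) = 0 →
          (0 < R → R < 1 →
            (∫ r in Ioi R,
              (dtu u 0 (r • e0) - c * LW1 r - d * (χ0 r * Gam r)) *
                (χ0 r * Gam r) * r ^ 5) = 0) →
          (∫ r in Ioi R,
              (dtu u 0 (r • e0) - c * LW1 r - d * (χ0 r * Gam r)) ^ 2 * r ^ 5) ≤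
            C * (Ep + Em) := by
  obtain ⟨K, hK, H⟩ := span_estimate h1
  have ha := area6_pos
  refine ⟨K ^ 2 / (2 * area6), by positivity, ?_⟩
  intro R hR u Ep Em hu hrad heq hfin hEp hEm c d hd o1 o2
  obtain ⟨w, wu, weq, wt, we⟩ := exists_profile hR hu hrad heq
  have hdens : ∀ t, (∫ x in {x : E6 | R + |t| ≤ ‖x‖}, eDensity u t x) =
      area6 * ∫ r in Ioi (R + |t|), r ^ 5 * w.dens t r := by
    intro t
    rw [setIntegral_norm_le, ← (polar (add_nonneg hR (abs_nonneg t)) (w.dens t)).2]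
    exact setIntegral_congr_fun
      (isOpen_lt continuous_const continuous_norm).measurableSet fun x hx => we t x hx
  have hz : R + |(0 : ℝ)| = R := by rw [abs_zero, add_zero]
  have hi : IntegrableOn (fun r => r ^ 5 * w.dens 0 r) (Ioi R) := by
    refine (polar hR (w.dens 0)).1.1 (hfin.congr_fun (fun x hx => we 0 x (hz.trans_lt hx))
      (isOpen_lt continuous_const continuous_norm).measurableSet)
  have hc : ContinuousOn (w.u 0) (Ici R) := by
    have h := hu.continuousOn.comp (g := fun p : ℝ × E6 => u p.1 p.2)
      (f := fun r : ℝ => ((0 : ℝ), r • e0)) (s := Ici R) (by fun_prop) fun r hr => by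
        change R + |(0 : ℝ)| ≤ ‖r • e0‖
        rw [norm_smul_e0 (hR.trans hr), hz]
        exact hr
    exact h.congr fun r _ => wu 0 r
  obtain ⟨M, hM⟩ := w.initial_bounded hR hc hi
  have hEm' := hEm.comp tendsto_neg_atTop_atBot
  have hnn : ∀ t, 0 ≤ ∫ x in {x : E6 | R + |t| ≤ ‖x‖}, eDensity u t x := fun t =>
    integral_nonneg fun x => add_nonneg (sq_nonneg _) (sq_nonneg _)
  have hEp0 : 0 ≤ Ep := ge_of_tendsto' hEp hnn
  have hEm0 : 0 ≤ Em := ge_of_tendsto' hEm hnn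
  have hsol := w.oddPart_isSol hR weq hi
  have hut : EqOn (fun r => dtu u 0 (r • e0)) (w.oddPart.ut 0) (Ioi R) := fun r hr => by
    have hn := norm_smul_e0 (hR.trans (le_of_lt hr))
    change dtu u 0 (r • e0) = _
    rw [w.oddPart_ut_zero, wt 0 (r • e0) (by rw [hn, hz]; exact hr), hn]
  have hLW := LW1_L2 hR
  set F : ℝ → ℝ := fun r => dtu u 0 (r • e0) - c * LW1 r - d * (χ0 r * Gam r) with hF
  have key : ∀ B, 0 < B → (∃ᶠ T in atTop, w.oddPart.Bd T B) → nrm R F ≤ K * B := by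
    intro B hB hfr
    obtain ⟨c', d', hd', hn⟩ := H R w.oddPart hR hsol B hB hfr
    refine le_trans ?_ hn
    by_cases hcase : R = 0 ∨ 1 ≤ R
    · have hF2 : L2 R F := ((hsol.fin.sub hR (hLW.const_mul c))).congr fun r hr => by
        rw [hF]; simp only [hd hcase, ← hut hr]; ring
      refine nrm_le_of_orthogonal (Y := LW1) (Z := LW1) (a := c' - c) (b := 0) hR hF2
        ((hsol.fin.sub hR (hLW.const_mul c')).congr fun r hr => ?_) hLW hLW (fun r hr => ?_) o1
        (zero_mul _)
      · rw [hd' hcase]; ring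
      · have := hut hr
        simp only [hF, hd hcase, hd' hcase] at this ⊢
        linear_combination this
    · push Not at hcase
      have hR0 : 0 < R := lt_of_le_of_ne hR (Ne.symm hcase.1)
      have hS := singular_L2 h1 hR0
      have hF2 : L2 R F := ((hsol.fin.sub hR (hLW.const_mul c)).sub hR (hS.const_mul d)).congr
        fun r hr => by
          have := hut hr
          simp only [hF] at this ⊢
          linear_combination -this
      refine nrm_le_of_orthogonal (Y := LW1) (Z := fun r => χ0 r * Gam r) (a := c' - c)
        (b := d' - d) hR hF2 ((hsol.fin.sub hR (hLW.const_mul c')).sub hR (hS.const_mul d')) hLW hS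
        (fun r hr => ?_) o1 (by rw [o2 hR0 hcase.2, mul_zero])
      have := hut hr
      simp only [hF] at this ⊢
      linear_combination this
  rw [← nrm_sq hR F]
  refine le_of_forall_pos_le_add fun ε hε => ?_
  obtain ⟨η, hη, hηε⟩ : ∃ η, 0 < η ∧ K ^ 2 * η = ε := ⟨ε / K ^ 2, by positivity, by field_simp⟩
  have hq : 0 < (Ep + Em) / (2 * area6) + η := by positivity
  have hsq := Real.sq_sqrt hq.le
  have hbd : ∀ᶠ T in atTop, w.oddPart.Bd T √((Ep + Em) / (2 * area6) + η) := by
    have hlim := (hEp.add hEm').eventually_lt_const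
      (show Ep + Em < Ep + Em + 2 * area6 * η by linarith [mul_pos (mul_pos two_pos ha) hη])
    filter_upwards [hlim, eventually_ge_atTop 0] with T hT hT0
    refine w.oddPart_bd hR weq hi hM hT0 (Real.sqrt_nonneg _) ?_
    simp only [Function.comp_apply, hdens] at hT
    simp only [abs_neg, abs_of_nonneg hT0] at hT
    rw [hsq]
    refine le_of_mul_le_mul_left (le_of_lt (lt_of_eq_of_lt (mul_add _ _ _) (hT.trans_eq ?_))) ha
    field_simp
  have h := key _ (Real.sqrt_pos.2 hq) hbd.frequently
  have h2 := pow_le_pow_left₀ (nrm_nonneg R F) h 2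
  rw [mul_pow, hsq] at h2
  refine h2.trans_eq ?_
  rw [← hηε]
  ring

end
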